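/- (Lemma 3.1, second part: large deviation estimate at the new scale) Fix ε > 0 small, let ω ∈ Ω_ε, let α : 𝕋² → 𝔻 be real-analytic, λ ∈ (0,1) and z ∈ ∂𝔻. Let γ > 0 be sufficiently small and suppose positive integers n < N satisfy: (i) mes[(x,y) ∈ 𝕋² : |(1/n)·log‖M_n^z(x,y)‖ − L_n(z)| > (γ/10)·P(z)] ≤ N^{−10}; (ii) mes[(x,y) ∈ 𝕋² : |(1/(2n))·log‖M_{2n}^z(x,y)‖ − L_{2n}(z)| > (γ/10)·P(z)] ≤ N^{−10}; (iii) min(L_n(z), L_{2n}(z)) ≥ γ·P(z); (iv) L_n(z) − L_{2n}(z) ≤ (γ/40)·P(z); (v) 9γ·n·P(z) ≥ 10·log(2N) and n² ≤ N. Then for any σ < 1/24 there exists τ = τ(σ) > 0 such that mes[(x,y) ∈ 𝕋² : |(1/N)·log‖M_N^z(x,y)‖ − L_N(z)| > P(z)·N^{−τ}] ≤ C·exp(−N^σ) with a constant C depending only on α, σ and ε. -/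

import Mathlib

open MeasureTheory Complex Filter Matrix

noncomputable section

/-- The circle `𝕋 = ℝ/ℤ`. -/
abbrev Torus : Type := AddCircle (1 : ℝ)

/-- The two-torus `𝕋² = (ℝ/ℤ)²`. -/
abbrev Torus2 : Type := Torus × Torus

/-- The skew-shift `T_ω(x,y) = (x+y, y+ω)`. -/
def skewShift (ω : Torus) (p : Torus2) : Torus2 := (p.1 + p.2, p.2 + ω)

/-- The `n`-th iterate (`n ∈ ℤ`) of the skew-shift:
`T_ω^n(x,y) = (x + n·y + (n(n−1)/2)·ω, y + n·ω)`. -/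
def skewIter (ω : Torus) (n : ℤ) (p : Torus2) : Torus2 :=
  (p.1 + n • p.2 + (n * (n - 1) / 2) • ω, p.2 + n • ω)

/-- The set `Ω_ε` of Diophantine frequencies:
`‖nω‖ ≥ ε · n⁻¹ · (1 + log n)⁻²` for every positive integer `n`. -/
def DiophSet (ε : ℝ) : Set Torus :=
  {ω | ∀ n : ℕ, 0 < n → ε * (n : ℝ)⁻¹ * ((1 + Real.log n) ^ 2)⁻¹ ≤ ‖(n : ℤ) • ω‖}

/-- A trigonometric polynomial on `𝕋²`: a finite linear combination of the characters
`e^{2πi(mx+ky)}`, `(m,k) ∈ ℤ²`. -/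
def IsTrigPoly (α : Torus2 → ℂ) : Prop :=
  ∃ (F : Finset (ℤ × ℤ)) (c : ℤ × ℤ → ℂ), ∀ p : Torus2,
    α p = ∑ mk ∈ F, c mk * (AddCircle.toCircle (mk.1 • p.1) : ℂ) *
      (AddCircle.toCircle (mk.2 • p.2) : ℂ)

/-- `α : 𝕋² → ℂ` is real-analytic: its lift to `ℝ²` is real-analytic. -/
def IsRealAnalyticT2 (α : Torus2 → ℂ) : Prop :=
  ∃ f : ℝ × ℝ → ℂ, (∀ q : ℝ × ℝ, AnalyticAt ℝ f q) ∧
    ∀ x y : ℝ, f (x, y) = α ((x : Torus), (y : Torus))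

/-- The operator norm (w.r.t. the Euclidean norm) of a finite square complex matrix. -/
def matOpNorm {n : Type*} [Fintype n] [DecidableEq n] (A : Matrix n n ℂ) : ℝ :=
  ‖Matrix.toEuclideanCLM (𝕜 := ℂ) A‖

/-- The Szegő cocycle matrix `M^z(x,y)`, where `sz` is a fixed square root of `z` and the
Verblunsky coefficient is `α₀(x,y) = λ·α(x,y)`, `ρ₀ = (1−|α₀|²)^{1/2}`. -/
def szegoCocycle (α : Torus2 → ℂ) (lam : ℝ) (sz : ℂ) (p : Torus2) :
    Matrix (Fin 2) (Fin 2) ℂ :=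
  ((Real.sqrt (1 - ‖(lam : ℂ) * α p‖ ^ 2) : ℂ))⁻¹ •
    !![sz, -(starRingEnd ℂ) ((lam : ℂ) * α p) / sz;
       -((lam : ℂ) * α p) * sz, 1 / sz]

/-- The `n`-step transfer matrix `M_n^z(x,y) = M^z(T_ω^{n−1}(x,y)) ⋯ M^z(T_ω(x,y))·M^z(x,y)`. -/
def transfer (α : Torus2 → ℂ) (lam : ℝ) (ω : Torus) (sz : ℂ) :
    ℕ → Torus2 → Matrix (Fin 2) (Fin 2) ℂ
  | 0, _ => 1
  | n + 1, p => szegoCocycle α lam sz ((skewShift ω)^[n] p) * transfer α lam ω sz n p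

/-- The finite-scale Lyapunov exponent `L_n(z) = (1/n)∫_{𝕋²} log‖M_n^z(x,y)‖ dx dy`. -/
def LyapFin (α : Torus2 → ℂ) (lam : ℝ) (ω : Torus) (sz : ℂ) (n : ℕ) : ℝ :=
  (n : ℝ)⁻¹ * ∫ p : Torus2, Real.log (matOpNorm (transfer α lam ω sz n p))

/-- The scaling factor `P(z) = log((1−λ²·(sup|α|)²)^{−1/2} + C_α + (1−λ²)^{−1} + |z|)`. -/
def Pscale (α : Torus2 → ℂ) (lam : ℝ) (Cα : ℝ) (z : ℂ) : ℝ :=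
  Real.log ((Real.sqrt (1 - lam ^ 2 * (⨆ p : Torus2, ‖α p‖) ^ 2))⁻¹ + Cα +
    (1 - lam ^ 2)⁻¹ + ‖z‖)

lemma exists_separated_points (k : ℕ) {δ : ℝ} (hδ : 0 < δ) :
    ∀ {a : ℝ} {E : Set ℝ}, E ⊆ Set.Ici a → ENNReal.ofReal (k * δ) < volume E →
      ∃ x : ℕ → ℝ, (∀ i ≤ k, x i ∈ E) ∧
        ∀ i j, i ≤ j → j ≤ k → x i + (j - i : ℝ) * δ ≤ x j := by
  induction k with
  | zero =>
    intro a E _ hE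
    have : E.Nonempty := by
      by_contra h
      rw [Set.not_nonempty_iff_eq_empty] at h
      simp [h] at hE
    obtain ⟨y, hy⟩ := this
    refine ⟨fun _ => y, fun _ _ => hy, fun i j hij hj => ?_⟩
    obtain rfl : j = 0 := by omega
    obtain rfl : i = 0 := by omega
    simp
  | succ k ih =>
    intro a E hEa hE
    have hne : E.Nonempty := by
      by_contra h
      rw [Set.not_nonempty_iff_eq_empty] at h
      simp [h] at hE
    have hbdd : BddBelow E := ⟨a, fun y hy => hEa hy⟩
    obtain ⟨c, hc1, hc2⟩ : ∃ c : ℝ, (k + 1 : ℕ) * δ < c ∧ ENNReal.ofReal c < volume E := by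
      obtain ⟨q, hq1, hq2⟩ := ENNReal.lt_iff_exists_nnreal_btwn.mp hE
      refine ⟨q, ?_, by simpa using hq2⟩
      rw [← ENNReal.ofReal_coe_nnreal] at hq1
      exact (ENNReal.ofReal_lt_ofReal_iff_of_nonneg (by positivity)).mp hq1
    set t := c - (k + 1 : ℕ) * δ with ht
    obtain ⟨y, hyE, hy⟩ := exists_lt_of_csInf_lt hne
      (show sInf E < sInf E + t by linarith)
    have hvol : ENNReal.ofReal (k * δ) < volume (E ∩ Set.Ici (y + δ)) := by
      have hsub : E ⊆ (E ∩ Set.Ici (y + δ)) ∪ Set.Ico (sInf E) (y + δ) := by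
        intro z hz
        by_cases hzy : y + δ ≤ z
        · exact Or.inl ⟨hz, hzy⟩
        · exact Or.inr ⟨csInf_le hbdd hz, not_le.mp hzy⟩
      have h1 := (measure_mono hsub).trans (measure_union_le (μ := volume) _ _)
      rw [Real.volume_Ico] at h1
      by_contra hcon
      have h2 : volume E ≤ ENNReal.ofReal (k * δ) + ENNReal.ofReal (y + δ - sInf E) :=
        h1.trans (by gcongr; exact not_lt.mp hcon)
      rw [← ENNReal.ofReal_add (by positivity)
        (by have := csInf_le hbdd hyE; linarith)] at h2
      have h3 := hc2.trans_le h2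
      have h4 := (ENNReal.ofReal_lt_ofReal_iff'.mp h3).1
      push_cast at ht
      linarith
    obtain ⟨x, hx1, hx2⟩ := ih (a := y + δ) Set.inter_subset_right hvol
    refine ⟨fun i => if i = 0 then y else x (i - 1), fun i hi => ?_, fun i j hij hj => ?_⟩
    · by_cases h0 : i = 0
      · simpa [h0] using hyE
      · simpa [h0] using (hx1 (i - 1) (by omega)).1
    · by_cases hj0 : j = 0
      · obtain rfl : i = 0 := by omega
        simp [hj0]
      · obtain ⟨j, rfl⟩ := Nat.exists_eq_succ_of_ne_zero hj0
        by_cases hi0 : i = 0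
        · have h5 := hx2 0 j (by omega) (by omega)
          have h6 := (hx1 0 (by omega)).2
          simp only [Set.mem_Ici] at h6
          simp [hi0]
          push_cast at h5
          linarith
        · obtain ⟨i, rfl⟩ := Nat.exists_eq_succ_of_ne_zero hi0
          have h5 := hx2 i j (by omega) (by omega)
          simp
          linarith

/-- A bounded holomorphic function with `k` zeros near the centre is small at the centre. -/
lemma norm_center_le_of_zeros {E : Type*} [NormedAddCommGroup E] [NormedSpace ℂ E] [CompleteSpace E]
    {R : ℝ} (hR : 0 < R) {c : ℂ} (S : Finset ℂ) :
    ∀ {f : ℂ → E} {M : ℝ}, (∀ z ∈ Metric.closedBall c R, DifferentiableAt ℂ f z) →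
      (∀ z ∈ Metric.closedBall c R, ‖f z‖ ≤ M) →
      (∀ ζ ∈ S, ‖ζ - c‖ ≤ R / 4 ∧ f ζ = 0) → ‖f c‖ ≤ M * (1 / 3) ^ S.card := by
  induction S using Finset.induction_on with
  | empty =>
    intro f M _ hM _
    simpa using hM c (Metric.mem_closedBall_self hR.le)
  | insert ζ S hζ ih =>
    intro f M hd hM hS
    have hζ1 := hS ζ (Finset.mem_insert_self _ _)
    have hζball : ζ ∈ Metric.ball c R := by
      rw [Metric.mem_ball, dist_eq_norm]; linarith
    have hζn : Metric.closedBall c R ⊆ Metric.closedBall c R := subset_rfl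
    have hds : ∀ z ∈ Metric.closedBall c R, DifferentiableAt ℂ (dslope f ζ) z := by
      intro z hz
      by_cases hzz : z = ζ
      · subst hzz
        have hn : Metric.ball c R ∈ nhds z := Metric.isOpen_ball.mem_nhds hζball
        have : DifferentiableOn ℂ f (Metric.ball c R) := fun w hw =>
          (hd w (Metric.ball_subset_closedBall hw)).differentiableWithinAt
        exact ((differentiableOn_dslope hn).mpr this).differentiableAt hn
      · exact (differentiableAt_dslope_of_ne hzz).mpr (hd z hz)
    have hfr : ∀ z ∈ frontier (Metric.ball c R), ‖dslope f ζ z‖ ≤ M / (3 * R / 4) := by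
      intro z hz
      rw [frontier_ball c hR.ne', mem_sphere_iff_norm] at hz
      have hne : 3 * R / 4 ≤ ‖z - ζ‖ := by
        have := norm_sub_norm_le (z - c) (ζ - c)
        rw [sub_sub_sub_cancel_right] at this
        linarith [hζ1.1]
      have hzz : z ≠ ζ := by
        rintro rfl
        simp at hne; linarith
      rw [dslope_of_ne _ hzz, slope_def_module, hζ1.2, sub_zero, norm_smul, norm_inv,
        div_eq_inv_mul]
      have hMz := hM z (by rw [Metric.mem_closedBall, dist_eq_norm]; exact hz.le)
      gcongr
    have hbd : ∀ z ∈ Metric.closedBall c R, ‖dslope f ζ z‖ ≤ M / (3 * R / 4) := by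
      intro z hz
      refine Complex.norm_le_of_forall_mem_frontier_norm_le Metric.isBounded_ball
        ⟨fun w hw => (hds w (Metric.ball_subset_closedBall hw)).differentiableWithinAt,
          fun w hw => ((hds w ?_).continuousAt).continuousWithinAt⟩ hfr ?_
      · rwa [closure_ball c hR.ne'] at hw
      · rwa [closure_ball c hR.ne']
    have h := ih hds hbd (fun w hw => ⟨(hS w (Finset.mem_insert_of_mem hw)).1, by
      have hwz : w ≠ ζ := fun h => hζ (h ▸ hw)
      rw [dslope_of_ne _ hwz, slope_def_module, hζ1.2,
        (hS w (Finset.mem_insert_of_mem hw)).2]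
      simp⟩)
    have hM0 : 0 ≤ M := (norm_nonneg _).trans (hM c (Metric.mem_closedBall_self hR.le))
    have key : ‖f c‖ ≤ R / 4 * ‖dslope f ζ c‖ := by
      have : f c = (c - ζ) • dslope f ζ c := by
        rw [sub_smul_dslope, hζ1.2, sub_zero]
      rw [this, norm_smul, norm_sub_rev]
      gcongr
      exact hζ1.1
    rw [Finset.card_insert_of_notMem hζ]
    calc ‖f c‖ ≤ R / 4 * (M / (3 * R / 4) * (1 / 3) ^ S.card) := key.trans (by gcongr)
      _ = M * (1 / 3) ^ (S.card + 1) := by field_simp; ring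

lemma prod_separated_ge {k : ℕ} {δ : ℝ} (hδ : 0 ≤ δ) {x : ℕ → ℝ}
    (hx : ∀ i j, i ≤ j → j ≤ k → x i + (j - i : ℝ) * δ ≤ x j) {j : ℕ} (hj : j ≤ k) :
    δ ^ k * (j.factorial * (k - j).factorial : ℝ) ≤
      ∏ i ∈ (Finset.range (k + 1)).erase j, |x j - x i| := by
  have hsplit : (Finset.range (k + 1)).erase j =
      Finset.range j ∪ Finset.Ico (j + 1) (k + 1) := by
    ext i; simp; omega
  have hdisj : Disjoint (Finset.range j) (Finset.Ico (j + 1) (k + 1)) := by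
    rw [Finset.disjoint_left]; intro i; simp; omega
  rw [hsplit, Finset.prod_union hdisj]
  have h1 : δ ^ j * (j.factorial : ℝ) ≤ ∏ i ∈ Finset.range j, |x j - x i| := by
    have : δ ^ j * (j.factorial : ℝ) = ∏ i ∈ Finset.range j, (((j - 1 - i : ℕ) : ℝ) + 1) * δ := by
      rw [Finset.prod_mul_distrib, Finset.prod_const, Finset.card_range, mul_comm]
      congr 1
      rw [Finset.prod_range_reflect (fun i => (i : ℝ) + 1) j]
      rw [← Finset.prod_range_add_one_eq_factorial]
      push_cast
      rfl
    rw [this]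
    refine Finset.prod_le_prod (fun i _ => by positivity) fun i hi => ?_
    have hi' := Finset.mem_range.mp hi
    have h := hx i j hi'.le hj
    have hc : ((j - 1 - i : ℕ) : ℝ) + 1 = j - i := by
      have : j - 1 - i + 1 + i = j := by omega
      have h2 : ((j - 1 - i : ℕ) : ℝ) + 1 + i = j := by exact_mod_cast this
      linarith
    rw [hc]
    exact le_trans (by linarith) (le_abs_self _)
  have h2 : δ ^ (k - j) * ((k - j).factorial : ℝ) ≤
      ∏ i ∈ Finset.Ico (j + 1) (k + 1), |x j - x i| := by
    rw [Finset.prod_Ico_eq_prod_range]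
    have hk : k + 1 - (j + 1) = k - j := by omega
    rw [hk]
    have : δ ^ (k - j) * ((k - j).factorial : ℝ) =
        ∏ i ∈ Finset.range (k - j), ((i : ℝ) + 1) * δ := by
      rw [Finset.prod_mul_distrib, Finset.prod_const, Finset.card_range, mul_comm]
      congr 1
      rw [← Finset.prod_range_add_one_eq_factorial]
      push_cast
      rfl
    rw [this]
    refine Finset.prod_le_prod (fun i _ => by positivity) fun i hi => ?_
    have hi' := Finset.mem_range.mp hi
    have h := hx j (j + 1 + i) (by omega) (by omega)
    push_cast at h
    rw [abs_sub_comm]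
    refine le_trans ?_ (le_abs_self _)
    linarith
  calc δ ^ k * (j.factorial * (k - j).factorial : ℝ)
      = (δ ^ j * j.factorial) * (δ ^ (k - j) * (k - j).factorial) := by
        rw [show δ ^ k = δ ^ j * δ ^ (k - j) by rw [← pow_add]; congr 1; omega]; ring
    _ ≤ _ := mul_le_mul h1 h2 (by positivity) (Finset.prod_nonneg fun _ _ => abs_nonneg _)

lemma sum_inv_factorial_mul (k : ℕ) :
    ∑ j ∈ Finset.range (k + 1), ((j.factorial * (k - j).factorial : ℝ))⁻¹ =
      2 ^ k / k.factorial := by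
  have h := Nat.sum_range_choose k
  have h' : ∑ j ∈ Finset.range (k + 1), (k.choose j : ℝ) = 2 ^ k := by exact_mod_cast h
  rw [← h', Finset.sum_div]
  refine Finset.sum_congr rfl fun j hj => ?_
  rw [Nat.cast_choose ℝ (Finset.mem_range_succ_iff.mp hj)]
  have := Nat.factorial_pos k
  field_simp

lemma norm_center_le_of_small_on_separated {E : Type*} [NormedAddCommGroup E] [NormedSpace ℂ E]
    [CompleteSpace E] {R : ℝ} (hR : 0 < R) {c : ℝ} {f : ℂ → E} {M η : ℝ}
    (hd : ∀ z ∈ Metric.closedBall (c : ℂ) R, DifferentiableAt ℂ f z)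
    (hM : ∀ z ∈ Metric.closedBall (c : ℂ) R, ‖f z‖ ≤ M) {k : ℕ} {δ : ℝ} (hδ : 0 < δ) {x : ℕ → ℝ}
    (hx : ∀ i j, i ≤ j → j ≤ k → x i + (j - i : ℝ) * δ ≤ x j)
    (hxc : ∀ i ≤ k, |x i - c| ≤ R / 4 ∧ ‖f (x i)‖ ≤ η) :
    ‖f c‖ ≤ (M + η * (5 * R / (2 * δ)) ^ k / k.factorial) * (1 / 3) ^ (k + 1) +
      η * (5 * R / (2 * δ)) ^ k / k.factorial := by
  set S := Finset.range (k + 1) with hS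
  set l : ℕ → ℂ → ℂ := fun j z => ∏ i ∈ S.erase j, (z - x i) / (x j - x i) with hl
  set L : ℂ → E := fun z => ∑ j ∈ S, l j z • f (x j) with hL
  have hinj : ∀ i ≤ k, ∀ j ≤ k, x i = x j → i = j := by
    intro i hi j hj hij
    by_contra hne
    rcases lt_or_gt_of_ne hne with h | h
    · have h1 := hx i j h.le hj
      have h2 : (0 : ℝ) < (j - i : ℝ) * δ :=
        mul_pos (sub_pos.mpr (by exact_mod_cast h)) hδ
      linarith
    · have h1 := hx j i h.le hi
      have h2 : (0 : ℝ) < (i - j : ℝ) * δ :=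
        mul_pos (sub_pos.mpr (by exact_mod_cast h)) hδ
      linarith
  have hLd : Differentiable ℂ L := by
    intro z
    simp only [hL]
    refine DifferentiableAt.fun_sum fun j _ => DifferentiableAt.smul_const ?_ _
    simp only [hl]
    exact DifferentiableAt.fun_finsetProd fun i _ =>
      ((differentiableAt_id.sub_const _).div_const _)
  have hLb : ∀ z ∈ Metric.closedBall (c : ℂ) R,
      ‖L z‖ ≤ η * (5 * R / (2 * δ)) ^ k / k.factorial := by
    intro z hz
    rw [Metric.mem_closedBall, dist_eq_norm] at hz
    have hlj : ∀ j ∈ S, ‖l j z‖ ≤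
        (5 * R / 4 / δ) ^ k * ((j.factorial * (k - j).factorial : ℝ))⁻¹ := by
      intro j hj
      have hjk : j ≤ k := Finset.mem_range_succ_iff.mp hj
      simp only [hl]
      rw [norm_prod]
      simp only [norm_div]
      rw [Finset.prod_div_distrib]
      have hnum : ∏ i ∈ S.erase j, ‖z - x i‖ ≤ (5 * R / 4) ^ k := by
        have hcard : (S.erase j).card = k := by
          rw [Finset.card_erase_of_mem hj, hS, Finset.card_range]; rfl
        rw [← hcard, ← Finset.prod_const]
        refine Finset.prod_le_prod (fun i _ => norm_nonneg _) fun i hi => ?_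
        have hik : i ≤ k := Finset.mem_range_succ_iff.mp (Finset.mem_of_mem_erase hi)
        have h1 := (hxc i hik).1
        have h2 : ‖(c : ℂ) - x i‖ ≤ R / 4 := by
          rw [← ofReal_sub, norm_real, Real.norm_eq_abs, abs_sub_comm]; exact h1
        calc ‖z - x i‖ ≤ ‖z - c‖ + ‖(c : ℂ) - x i‖ := norm_sub_le_norm_sub_add_norm_sub _ _ _
          _ ≤ 5 * R / 4 := by linarith
      have hden : δ ^ k * (j.factorial * (k - j).factorial : ℝ) ≤
          ∏ i ∈ S.erase j, ‖(x j : ℂ) - x i‖ := by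
        refine (prod_separated_ge hδ.le hx hjk).trans_eq (Finset.prod_congr rfl fun i _ => ?_)
        rw [← ofReal_sub, norm_real, Real.norm_eq_abs]
      calc _ ≤ (5 * R / 4) ^ k / (δ ^ k * (j.factorial * (k - j).factorial : ℝ)) := by gcongr
        _ = _ := by rw [div_pow (5 * R / 4) δ, ← div_div, div_eq_mul_inv (_ / _) (_ * _)]
    calc ‖L z‖ ≤ ∑ j ∈ S, ‖l j z • f (x j)‖ := norm_sum_le _ _
      _ ≤ ∑ j ∈ S, (5 * R / 4 / δ) ^ k * ((j.factorial * (k - j).factorial : ℝ))⁻¹ * η := by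
        refine Finset.sum_le_sum fun j hj => ?_
        rw [norm_smul]
        have := (hxc j (Finset.mem_range_succ_iff.mp hj)).2
        have := hlj j hj
        gcongr
      _ = _ := by
        rw [← Finset.sum_mul, ← Finset.mul_sum, hS, sum_inv_factorial_mul]
        rw [show 5 * R / (2 * δ) = 5 * R / 4 / δ * 2 by field_simp; norm_num, mul_pow]
        ring
  have hlself : ∀ j ≤ k, ∀ i ≤ k, l j (x i) = if i = j then 1 else 0 := by
    intro j hj i hi
    simp only [hl]
    split_ifs with h
    · subst h
      refine Finset.prod_eq_one fun m hm => div_self ?_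
      rw [sub_ne_zero]
      intro heq
      have hmk := Finset.mem_range_succ_iff.mp (Finset.mem_of_mem_erase hm)
      exact Finset.ne_of_mem_erase hm (hinj m hmk i hi (by exact_mod_cast heq.symm))
    · refine Finset.prod_eq_zero (i := i)
        (Finset.mem_erase.mpr ⟨h, Finset.mem_range_succ_iff.mpr hi⟩) ?_
      simp
  have hLx : ∀ i ≤ k, L (x i) = f (x i) := by
    intro i hi
    simp only [hL]
    rw [Finset.sum_eq_single i]
    · rw [hlself i hi i hi]; simp
    · intro j hj hji
      rw [hlself j (Finset.mem_range_succ_iff.mp hj) i hi, if_neg (Ne.symm hji), zero_smul]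
    · intro h; exact absurd (Finset.mem_range_succ_iff.mpr hi) h
  have hz := norm_center_le_of_zeros hR (c := (c : ℂ)) (S.image fun i => (x i : ℂ))
    (f := fun z => f z - L z) (M := M + η * (5 * R / (2 * δ)) ^ k / k.factorial)
    (fun z hz => (hd z hz).sub (hLd z))
    (fun z hz => (norm_sub_le _ _).trans (add_le_add (hM z hz) (hLb z hz)))
    (by
      intro ζ hζ
      obtain ⟨i, hi, rfl⟩ := Finset.mem_image.mp hζ
      have hik := Finset.mem_range_succ_iff.mp hi
      refine ⟨?_, by simp [hLx i hik]⟩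
      rw [← ofReal_sub, norm_real, Real.norm_eq_abs]
      exact (hxc i hik).1)
  have hcard : (S.image fun i => (x i : ℂ)).card = k + 1 := by
    rw [Finset.card_image_of_injOn, hS, Finset.card_range]
    intro i hi j hj hij
    exact hinj i (Finset.mem_range_succ_iff.mp hi) j (Finset.mem_range_succ_iff.mp hj)
      (by simpa using hij)
  rw [hcard] at hz
  have hLc := hLb c (Metric.mem_closedBall_self hR.le)
  calc ‖f c‖ = ‖(f c - L c) + L c‖ := by simp
    _ ≤ _ := (norm_add_le _ _).trans (add_le_add hz hLc)

/-- A Cartan type estimate: a bounded holomorphic function which is not too small at the centre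
of a disc is extremely small only on a set of small measure. -/
theorem volume_small_values_le {E : Type*} [NormedAddCommGroup E] [NormedSpace ℂ E]
    [CompleteSpace E] {R : ℝ} (hR : 0 < R) {c : ℝ} {f : ℂ → E} {M m H : ℝ} (hM0 : 0 < M)
    (hm : 1 ≤ m) (hH : 1 ≤ H)
    (hd : ∀ z ∈ Metric.closedBall (c : ℂ) R, DifferentiableAt ℂ f z)
    (hM : ∀ z ∈ Metric.closedBall (c : ℂ) R, ‖f z‖ ≤ M)
    (hc : M * Real.exp (-m) ≤ ‖f c‖) :
    volume {x : ℝ | |x - c| ≤ R / 4 ∧ ‖f x‖ ≤ M * Real.exp (-(m * H))} ≤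
      ENNReal.ofReal (5 * Real.exp 1 * R * Real.exp (-((H - 1) / 3))) := by
  set E' := {x : ℝ | |x - c| ≤ R / 4 ∧ ‖f x‖ ≤ M * Real.exp (-(m * H))} with hE'
  set k := ⌈m⌉₊ + 1 with hk
  set θ := 5 * Real.exp 1 * R * Real.exp (-((H - 1) / 3)) with hθ
  have hθ0 : 0 < θ := by positivity
  have hk0 : (0 : ℝ) < k := by rw [hk]; positivity
  have hkm : m + 1 ≤ k := by
    rw [hk]; push_cast; linarith [Nat.le_ceil m]
  have hkm' : (k : ℝ) ≤ 3 * m := by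
    have := Nat.ceil_lt_add_one (by linarith : 0 ≤ m)
    rw [hk]; push_cast; linarith
  by_contra hcon
  rw [not_le] at hcon
  have hδ : 0 < θ / k := by positivity
  obtain ⟨x, hx1, hx2⟩ := exists_separated_points k hδ (a := c - R / 4) (E := E')
    (fun y hy => by have := (abs_le.mp hy.1).1; simp only [Set.mem_Ici]; linarith)
    (by rw [mul_div_cancel₀ _ hk0.ne']; exact hcon)
  have h := norm_center_le_of_small_on_separated hR (η := M * Real.exp (-(m * H)))
    hd hM hδ hx2 hx1
  have hfac : (5 * R / (2 * (θ / k))) ^ k / k.factorial ≤ Real.exp (m * (H - 1)) / 2 := by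
    have h1 : (k : ℝ) ^ k / k.factorial ≤ Real.exp k := Real.pow_div_factorial_le_exp _ hk0.le k
    have h2 : 5 * R / (2 * (θ / k)) =
        k * ((Real.exp 1)⁻¹ * Real.exp ((H - 1) / 3) * (1 / 2)) := by
      rw [hθ, Real.exp_neg]; field_simp
    have h3 : Real.exp ((H - 1) / 3) ^ k ≤ Real.exp (m * (H - 1)) := by
      rw [← Real.exp_nat_mul]
      apply Real.exp_le_exp.mpr
      nlinarith
    have h4 : ((1 : ℝ) / 2) ^ k ≤ 1 / 2 := by
      have : (1 : ℝ) / 2 ≤ 1 := by norm_num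
      calc ((1 : ℝ) / 2) ^ k ≤ (1 / 2) ^ 1 :=
            pow_le_pow_of_le_one (by norm_num) this (by omega)
        _ = 1 / 2 := by norm_num
    rw [h2, mul_pow, mul_pow, mul_pow]
    calc (k : ℝ) ^ k * ((Real.exp 1)⁻¹ ^ k * Real.exp ((H - 1) / 3) ^ k * (1 / 2) ^ k) /
          k.factorial
        = ((k : ℝ) ^ k / k.factorial) * (Real.exp 1)⁻¹ ^ k * Real.exp ((H - 1) / 3) ^ k *
          (1 / 2) ^ k := by ring
      _ ≤ Real.exp k * (Real.exp 1)⁻¹ ^ k * Real.exp (m * (H - 1)) * (1 / 2) := by gcongr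
      _ = Real.exp (m * (H - 1)) / 2 := by
        rw [inv_pow, ← Real.exp_nat_mul, mul_one]; field_simp
  have hη : M * Real.exp (-(m * H)) * (5 * R / (2 * (θ / k))) ^ k / k.factorial ≤
      M * Real.exp (-m) / 2 := by
    calc _ = M * Real.exp (-(m * H)) * ((5 * R / (2 * (θ / k))) ^ k / k.factorial) := by ring
      _ ≤ M * Real.exp (-(m * H)) * (Real.exp (m * (H - 1)) / 2) := by gcongr
      _ = M * (Real.exp (-(m * H)) * Real.exp (m * (H - 1))) / 2 := by ring
      _ = _ := by rw [← Real.exp_add]; ring_nf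
  have h3 : ((1 : ℝ) / 3) ^ (k + 1) ≤ Real.exp (-m) / 9 := by
    have he : (1 : ℝ) / 3 ≤ Real.exp (-1) := by
      rw [Real.exp_neg, one_div]
      exact inv_anti₀ (Real.exp_pos _) (by linarith [Real.exp_one_lt_d9])
    have h5 : ((1 : ℝ) / 3) ^ (k - 1) ≤ Real.exp (-m) := by
      calc ((1 : ℝ) / 3) ^ (k - 1) ≤ Real.exp (-1) ^ (k - 1) := by gcongr
        _ = Real.exp (-(k - 1 : ℕ)) := by rw [← Real.exp_nat_mul]; ring_nf
        _ ≤ Real.exp (-m) := by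
          apply Real.exp_le_exp.mpr
          have : m ≤ ((k - 1 : ℕ) : ℝ) := by
            rw [hk, Nat.add_sub_cancel]; exact Nat.le_ceil m
          linarith
    have h6 : k + 1 = (k - 1) + 2 := by omega
    rw [h6, pow_add]
    linarith
  have hexp1 : Real.exp (-m) ≤ 1 := Real.exp_le_one_iff.mpr (by linarith)
  have hep : 0 < M * Real.exp (-m) := by positivity
  have hb : M + M * Real.exp (-(m * H)) * (5 * R / (2 * (θ / k))) ^ k / k.factorial ≤
      M * 3 / 2 := by nlinarith
  have := calc M * Real.exp (-m) ≤ _ := hc.trans h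
    _ ≤ (M * 3 / 2) * (Real.exp (-m) / 9) + M * Real.exp (-m) / 2 := by gcongr
  nlinarith

instance isProbabilityMeasure_torus : IsProbabilityMeasure (volume : Measure Torus) :=
  ⟨by simp⟩

lemma volume_torus_eq_haar : (volume : Measure Torus) = AddCircle.haarAddCircle := by
  rw [AddCircle.volume_eq_smul_haarAddCircle]; simp

lemma fourierCoeff_eq_integral_torus (f : Torus → ℂ) (m : ℤ) :
    fourierCoeff f m = ∫ x, fourier (-m) x * f x := by
  rw [volume_torus_eq_haar]; rfl

lemma norm_fourier_apply (m : ℤ) (x : Torus) : ‖(fourier m x : ℂ)‖ = 1 := by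
  rw [fourier_apply]; exact Circle.norm_coe _

/-- The Poisson kernel of the unit disc, as a function on the circle `ℝ/ℤ`. -/
def circlePoisson (r : ℝ) (x : Torus) : ℝ := (1 - r ^ 2) / ‖1 - (r : ℂ) * fourier 1 x‖ ^ 2

lemma norm_one_sub_mul_fourier_ge {r : ℝ} (hr0 : 0 ≤ r) (x : Torus) :
    1 - r ≤ ‖1 - (r : ℂ) * fourier 1 x‖ := by
  have := norm_sub_norm_le (1 : ℂ) ((r : ℂ) * fourier 1 x)
  rwa [norm_one, norm_mul, norm_fourier_apply, mul_one, norm_real, Real.norm_of_nonneg hr0] at this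

lemma circlePoisson_nonneg {r : ℝ} (hr0 : 0 ≤ r) (hr1 : r < 1) (x : Torus) :
    0 ≤ circlePoisson r x :=
  div_nonneg (by nlinarith) (by positivity)

lemma circlePoisson_le {r : ℝ} (hr0 : 0 ≤ r) (hr1 : r < 1) (x : Torus) :
    circlePoisson r x ≤ 2 / (1 - r) := by
  have h := norm_one_sub_mul_fourier_ge hr0 x
  have h1 : 0 < 1 - r := by linarith
  calc circlePoisson r x ≤ (1 - r ^ 2) / (1 - r) ^ 2 := by
        unfold circlePoisson
        have : 0 ≤ 1 - r ^ 2 := by nlinarith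
        gcongr
    _ = (1 + r) / (1 - r) := by field_simp; ring
    _ ≤ 2 / (1 - r) := by gcongr; linarith

@[fun_prop]
lemma continuous_circlePoisson {r : ℝ} (hr0 : 0 ≤ r) (hr1 : r < 1) :
    Continuous (circlePoisson r) := by
  unfold circlePoisson
  refine Continuous.div (by fun_prop) (by fun_prop) fun x => ?_
  have := norm_one_sub_mul_fourier_ge hr0 x
  have h2 : 0 < ‖1 - (r : ℂ) * fourier 1 x‖ := by linarith
  positivity

lemma hasSum_circlePoisson {r : ℝ} (hr0 : 0 ≤ r) (hr1 : r < 1) (x : Torus) :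
    HasSum (fun m : ℤ => ((r ^ m.natAbs : ℝ) : ℂ) * fourier m x) (circlePoisson r x : ℂ) := by
  set w : ℂ := (r : ℂ) * fourier 1 x with hw
  have hwn : ‖w‖ = r := by
    rw [hw, norm_mul, norm_fourier_apply, mul_one, norm_real, Real.norm_of_nonneg hr0]
  have hpow : ∀ n : ℕ, (fourier (n : ℤ) x : ℂ) = (fourier 1 x : ℂ) ^ n := by
    intro n
    induction n with
    | zero => simp
    | succ n ih => rw [Nat.cast_succ, fourier_add, ih, pow_succ]
  have h1 : HasSum (fun n : ℕ => ((r ^ (n : ℤ).natAbs : ℝ) : ℂ) * fourier (n : ℤ) x)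
      (1 - w)⁻¹ := by
    have := hasSum_geometric_of_norm_lt_one (ξ := w) (by rw [hwn]; exact hr1)
    refine (funext fun n => ?_ :
      (fun n : ℕ => ((r ^ (n : ℤ).natAbs : ℝ) : ℂ) * fourier (n : ℤ) x) = _) ▸ this
    rw [hpow, Int.natAbs_natCast, hw, mul_pow, ofReal_pow]
  have h2 : HasSum (fun n : ℕ => ((r ^ (-((n : ℤ) + 1)).natAbs : ℝ) : ℂ) *
      fourier (-((n : ℤ) + 1)) x) ((starRingEnd ℂ) w * (1 - (starRingEnd ℂ) w)⁻¹) := by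
    have := (hasSum_geometric_of_norm_lt_one (ξ := (starRingEnd ℂ) w)
      (by rw [RCLike.norm_conj, hwn]; exact hr1)).mul_left ((starRingEnd ℂ) w)
    refine (funext fun n => ?_ : (fun n : ℕ => ((r ^ (-((n : ℤ) + 1)).natAbs : ℝ) : ℂ) *
      fourier (-((n : ℤ) + 1)) x) = _) ▸ this
    have hnat : (-((n : ℤ) + 1)).natAbs = n + 1 := by omega
    rw [hnat, fourier_neg, ← Nat.cast_succ, hpow, hw,
      ofReal_pow, map_pow, ← pow_succ', map_mul, conj_ofReal, mul_pow]
  have h3 := HasSum.of_nat_of_neg_add_one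
    (f := fun m : ℤ => ((r ^ m.natAbs : ℝ) : ℂ) * fourier m x) h1 h2
  suffices h : (circlePoisson r x : ℂ) =
      (1 - w)⁻¹ + (starRingEnd ℂ) w * (1 - (starRingEnd ℂ) w)⁻¹ by rw [h]; exact h3
  have hne : (1 - w) ≠ 0 := by
    intro h
    have := norm_one_sub_mul_fourier_ge hr0 x
    rw [← hw, h, norm_zero] at this
    linarith
  have hne2 : (1 - (starRingEnd ℂ) w) ≠ 0 := by
    intro h
    apply hne
    have := congrArg (starRingEnd ℂ) h
    simpa using this
  have hsq : ((‖1 - w‖ ^ 2 : ℝ) : ℂ) = (1 - w) * (1 - (starRingEnd ℂ) w) := by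
    rw [← Complex.normSq_eq_norm_sq, Complex.normSq_eq_conj_mul_self]; simp [mul_comm]
  have hr2 : ((r ^ 2 : ℝ) : ℂ) = w * (starRingEnd ℂ) w := by
    rw [Complex.mul_conj, Complex.normSq_eq_norm_sq, hwn]
  unfold circlePoisson
  rw [← hw, ofReal_div, hsq, ofReal_sub, hr2]
  field_simp
  push_cast
  ring

lemma summable_pow_natAbs {r : ℝ} (hr0 : 0 ≤ r) (hr1 : r < 1) :
    Summable fun m : ℤ => r ^ m.natAbs := by
  have := (hasSum_circlePoisson hr0 hr1 0).summable
  simpa [fourier_eval_zero, ← ofReal_pow] using Complex.reCLM.summable this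

lemma integral_fourier_torus (m : ℤ) : ∫ x : Torus, (fourier m x : ℂ) = if m = 0 then 1 else 0 := by
  have h := fourierCoeff_fourier (T := 1) m
  have h0 := congrFun h 0
  rw [fourierCoeff_eq_integral_torus] at h0
  simp only [neg_zero, fourier_zero, one_mul] at h0
  rw [h0, Pi.single_apply]
  simp [eq_comm]

lemma fourierCoeff_circlePoisson {r : ℝ} (hr0 : 0 ≤ r) (hr1 : r < 1) (m : ℤ) :
    fourierCoeff (fun x => (circlePoisson r x : ℂ)) m = (r ^ m.natAbs : ℝ) := by
  rw [fourierCoeff_eq_integral_torus]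
  have hs : HasSum (fun k : ℤ => ∫ x : Torus, fourier (-m) x *
      (((r ^ k.natAbs : ℝ) : ℂ) * fourier k x))
      (∫ x : Torus, ∑' k : ℤ, fourier (-m) x * (((r ^ k.natAbs : ℝ) : ℂ) * fourier k x)) := by
    refine hasSum_integral_of_summable_integral_norm (fun k => ?_) ?_
    · exact Continuous.integrable_of_hasCompactSupport (by fun_prop)
        (HasCompactSupport.of_compactSpace _)
    · refine (summable_pow_natAbs hr0 hr1).congr fun k => ?_
      simp only [norm_mul, norm_fourier_apply, norm_real, Real.norm_eq_abs, abs_pow,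
        abs_of_nonneg hr0, one_mul, mul_one]
      simp
  have h1 : ∀ x : Torus, ∑' k : ℤ, fourier (-m) x * (((r ^ k.natAbs : ℝ) : ℂ) * fourier k x) =
      fourier (-m) x * (circlePoisson r x : ℂ) := fun x =>
    ((hasSum_circlePoisson hr0 hr1 x).mul_left _).tsum_eq
  simp only [h1] at hs
  refine hs.unique ?_
  have h2 : ∀ k : ℤ, ∫ x : Torus, fourier (-m) x * (((r ^ k.natAbs : ℝ) : ℂ) * fourier k x) =
      if k = m then ((r ^ m.natAbs : ℝ) : ℂ) else 0 := by
    intro k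
    have : ∀ x : Torus, (fourier (-m) x : ℂ) * (((r ^ k.natAbs : ℝ) : ℂ) * fourier k x) =
        ((r ^ k.natAbs : ℝ) : ℂ) * fourier (k - m) x := by
      intro x
      rw [sub_eq_add_neg, fourier_add]; ring
    simp only [this]
    rw [integral_const_mul, integral_fourier_torus]
    split_ifs with h1 h2 h2
    · subst h2; simp
    · omega
    · omega
    · simp
  simp only [h2]
  exact hasSum_ite_eq m _

lemma integral_circlePoisson {r : ℝ} (hr0 : 0 ≤ r) (hr1 : r < 1) :
    ∫ x : Torus, circlePoisson r x = 1 := by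
  have := fourierCoeff_circlePoisson hr0 hr1 0
  rw [fourierCoeff_eq_integral_torus] at this
  simp only [neg_zero, fourier_zero, one_mul, integral_complex_ofReal] at this
  simpa using this

lemma circlePoisson_neg (r : ℝ) (x : Torus) : circlePoisson r (-x) = circlePoisson r x := by
  unfold circlePoisson
  have : (1 - (r : ℂ) * fourier 1 (-x)) = (starRingEnd ℂ) (1 - (r : ℂ) * fourier 1 x) := by
    rw [map_sub, map_mul, ← fourier_neg]
    simp
  rw [this, RCLike.norm_conj]

/-- Poisson extension of a function on the circle. -/
def poissonAvg (r : ℝ) (u : Torus → ℝ) (x : Torus) : ℝ := ∫ t, circlePoisson r (x - t) * u t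

lemma integrable_of_continuous_torus {E : Type*} [NormedAddCommGroup E]
    {f : Torus → E} (hf : Continuous f) : Integrable f :=
  hf.integrable_of_hasCompactSupport (HasCompactSupport.of_compactSpace _)

lemma integrable_circlePoisson_mul {r : ℝ} (hr0 : 0 ≤ r) (hr1 : r < 1) {u : Torus → ℝ}
    (hu : Continuous u) (x : Torus) : Integrable fun t => circlePoisson r (x - t) * u t := by
  have := continuous_circlePoisson hr0 hr1
  exact integrable_of_continuous_torus (by fun_prop)

lemma continuous_poissonAvg {r : ℝ} (hr0 : 0 ≤ r) (hr1 : r < 1) {u : Torus → ℝ}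
    (hu : Continuous u) : Continuous (poissonAvg r u) := by
  have := continuous_circlePoisson hr0 hr1
  unfold poissonAvg
  refine continuous_parametric_integral_of_continuous (μ := (volume : Measure Torus))
    (f := fun x t => circlePoisson r (x - t) * u t)
    (by fun_prop) (s := Set.univ) isCompact_univ |>.congr fun x => ?_
  simp

lemma poissonAvg_mono {r : ℝ} (hr0 : 0 ≤ r) (hr1 : r < 1) {u v : Torus → ℝ}
    (hu : Continuous u) (hv : Continuous v) (h : ∀ t, u t ≤ v t) (x : Torus) :
    poissonAvg r u x ≤ poissonAvg r v x :=
  integral_mono (integrable_circlePoisson_mul hr0 hr1 hu x)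
    (integrable_circlePoisson_mul hr0 hr1 hv x)
    fun t => mul_le_mul_of_nonneg_left (h t) (circlePoisson_nonneg hr0 hr1 _)

lemma poissonAvg_const {r : ℝ} (hr0 : 0 ≤ r) (hr1 : r < 1) (c : ℝ) (x : Torus) :
    poissonAvg r (fun _ => c) x = c := by
  unfold poissonAvg
  rw [integral_mul_const, integral_sub_left_eq_self (circlePoisson r) volume x,
    integral_circlePoisson hr0 hr1, one_mul]

lemma poissonAvg_add {r : ℝ} (hr0 : 0 ≤ r) (hr1 : r < 1) {u v : Torus → ℝ}
    (hu : Continuous u) (hv : Continuous v) (x : Torus) :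
    poissonAvg r (fun t => u t + v t) x = poissonAvg r u x + poissonAvg r v x := by
  unfold poissonAvg
  simp only [mul_add]
  exact integral_add (integrable_circlePoisson_mul hr0 hr1 hu x)
    (integrable_circlePoisson_mul hr0 hr1 hv x)

lemma poissonAvg_nonneg {r : ℝ} (hr0 : 0 ≤ r) (hr1 : r < 1) {u : Torus → ℝ}
    (h : ∀ t, 0 ≤ u t) (x : Torus) : 0 ≤ poissonAvg r u x :=
  integral_nonneg fun t => mul_nonneg (circlePoisson_nonneg hr0 hr1 _) (h t)

/-- The complex Poisson average of a character. -/
lemma integral_circlePoisson_mul_fourier {r : ℝ} (hr0 : 0 ≤ r) (hr1 : r < 1) (m : ℤ) (x : Torus) :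
    ∫ t : Torus, (circlePoisson r (x - t) : ℂ) * fourier m t =
      (r ^ m.natAbs : ℝ) * fourier m x := by
  have h1 : ∫ t : Torus, (circlePoisson r (x - t) : ℂ) * fourier m t =
      ∫ t : Torus, (circlePoisson r t : ℂ) * fourier m (x - t) := by
    rw [← integral_sub_left_eq_self
      (fun t : Torus => (circlePoisson r t : ℂ) * fourier m (x - t)) volume x]
    simp
  have h2 : ∀ t : Torus, (circlePoisson r t : ℂ) * fourier m (x - t) =
      fourier m x * (fourier (-m) t * (circlePoisson r t : ℂ)) := by
    intro t
    have : (fourier m (x - t) : ℂ) = fourier m x * fourier (-m) t := by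
      simp only [fourier_apply]
      rw [smul_sub, sub_eq_add_neg, AddCircle.toCircle_add, neg_smul]; simp
    rw [this]; ring
  rw [h1]
  simp only [h2]
  rw [integral_const_mul, ← fourierCoeff_eq_integral_torus (fun t => (circlePoisson r t : ℂ)),
    fourierCoeff_circlePoisson hr0 hr1, mul_comm]

lemma fourierCoeff_poissonAvg {r : ℝ} (hr0 : 0 ≤ r) (hr1 : r < 1) {u : Torus → ℝ}
    (hu : Continuous u) (m : ℤ) :
    fourierCoeff (fun x => (poissonAvg r u x : ℂ)) m =
      (r ^ m.natAbs : ℝ) * fourierCoeff (fun x => (u x : ℂ)) m := by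
  have hc := continuous_circlePoisson hr0 hr1
  simp only [fourierCoeff_eq_integral_torus]
  have h1 : ∀ x : Torus, (fourier (-m) x : ℂ) * (poissonAvg r u x : ℂ) =
      ∫ t : Torus, fourier (-m) x * ((circlePoisson r (x - t) : ℂ) * u t) := by
    intro x
    rw [integral_const_mul]
    congr 1
    unfold poissonAvg
    rw [← integral_complex_ofReal]
    simp
  simp only [h1]
  rw [integral_integral_swap_of_hasCompactSupport (by fun_prop)
    (HasCompactSupport.of_compactSpace _), ← integral_const_mul]
  refine integral_congr_ae (Eventually.of_forall fun t => ?_)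
  have h2 : ∀ x : Torus, (fourier (-m) x : ℂ) * ((circlePoisson r (x - t) : ℂ) * u t) =
      (u t : ℂ) * ((circlePoisson r (t - x) : ℂ) * fourier (-m) x) := by
    intro x
    rw [← circlePoisson_neg r (x - t), neg_sub]; ring
  simp only [h2]
  rw [integral_const_mul, integral_circlePoisson_mul_fourier hr0 hr1, Int.natAbs_neg]
  ring

lemma exp_neg_lt_one {η : ℝ} (hη : 0 < η) : Real.exp (-(2 * Real.pi * η)) < 1 := by
  exact Real.exp_lt_one_iff.mpr (by have := mul_pos Real.pi_pos hη; linarith)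

/-- An entire function with prescribed real part on the real line. -/
lemma re_entire_of_trigPoly (c : ℤ → ℂ) (m : ℤ) (z : ℂ) :
    ((if 0 ≤ m then c m else (starRingEnd ℂ) (c m)) *
      Complex.exp (2 * Real.pi * I * m.natAbs * z)).re =
      (c m * ((Real.exp (-(2 * Real.pi * z.im)) ^ m.natAbs : ℝ) *
        fourier m (z.re : Torus))).re := by
  have hexp : Complex.exp (2 * Real.pi * I * m.natAbs * z) =
      (Real.exp (-(2 * Real.pi * z.im)) ^ m.natAbs : ℝ) *
        Complex.exp (2 * Real.pi * I * m.natAbs * z.re) := by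
    rw [← Real.exp_nat_mul, ofReal_exp, ← Complex.exp_add]
    congr 1
    conv_lhs => rw [← re_add_im z]
    push_cast
    linear_combination (2 * Real.pi * m.natAbs * z.im : ℂ) * I_sq
  rw [hexp, fourier_coe_apply]
  by_cases hm : 0 ≤ m
  · rw [if_pos hm]
    have : ((m.natAbs : ℂ)) = (m : ℂ) := by
      have : ((m.natAbs : ℤ) : ℂ) = (m : ℂ) := by rw [Int.natAbs_of_nonneg hm]
      rwa [Int.cast_natCast] at this
    rw [this]; simp
  · rw [if_neg hm]
    have : ((m.natAbs : ℂ)) = -(m : ℂ) := by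
      have : ((m.natAbs : ℤ) : ℂ) = ((-m : ℤ) : ℂ) := by
        congr 1; omega
      rw [Int.cast_natCast] at this; rw [this]; simp
    have h3 : Complex.exp (2 * Real.pi * I * m.natAbs * z.re) = (starRingEnd ℂ)
        (Complex.exp (2 * Real.pi * I * m * z.re / (1 : ℝ))) := by
      rw [← Complex.exp_conj, this]
      congr 1
      simp [conj_ofNat]
    rw [h3, ← conj_ofReal (Real.exp (-(2 * Real.pi * z.im)) ^ m.natAbs), ← map_mul, ← map_mul,
      conj_re, conj_ofReal]

/-- The logarithm of a bounded holomorphic function on a strip is majorised by the Poisson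
average of its boundary values on the real line. -/
theorem norm_le_exp_poissonAvg {E : Type*} [NormedAddCommGroup E] [NormedSpace ℂ E]
    {A : ℂ → E} {h b η : ℝ} (hb0 : 0 ≤ b) (hη : 0 < η) (hηh : η ≤ h)
    (hd : ∀ z : ℂ, 0 ≤ z.im → z.im ≤ h → DifferentiableAt ℂ A z)
    {u : Torus → ℝ} (huc : Continuous u) (hu0 : ∀ t, 0 ≤ u t)
    (hu : ∀ x : ℝ, ‖A x‖ ≤ Real.exp (u x))
    (hb : ∀ z : ℂ, 0 ≤ z.im → z.im ≤ h → ‖A z‖ ≤ Real.exp b) (x : ℝ) :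
    ‖A (x + η * I)‖ ≤ Real.exp (poissonAvg (Real.exp (-(2 * Real.pi * η))) u x + b * η / h) := by
  have hh : 0 < h := hη.trans_le hηh
  suffices H : ∀ κ > 0, ‖A (x + η * I)‖ ≤
      Real.exp (poissonAvg (Real.exp (-(2 * Real.pi * η))) u x + b * η / h + κ) by
    have hlim : Tendsto (fun κ : ℝ => Real.exp
        (poissonAvg (Real.exp (-(2 * Real.pi * η))) u x + b * η / h + κ)) (nhdsWithin 0 (Set.Ioi 0))
        (nhds (Real.exp (poissonAvg (Real.exp (-(2 * Real.pi * η))) u x + b * η / h + 0))) :=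
      (Continuous.tendsto (by fun_prop) _).mono_left nhdsWithin_le_nhds
    rw [add_zero] at hlim
    exact ge_of_tendsto hlim (eventually_mem_nhdsWithin.mono fun κ hκ => H κ hκ)
  intro κ hκ
  obtain ⟨q, hqspan, hq⟩ : ∃ q ∈ Submodule.span ℂ (Set.range (@fourier (1 : ℝ))),
      ‖(⟨fun t => ((u t + κ / 2 : ℝ) : ℂ), by fun_prop⟩ : C(Torus, ℂ)) - q‖ < κ / 2 := by
    have hmem : (⟨fun t => ((u t + κ / 2 : ℝ) : ℂ), by fun_prop⟩ : C(Torus, ℂ)) ∈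
        closure (Submodule.span ℂ (Set.range (@fourier (1 : ℝ))) : Set C(Torus, ℂ)) := by
      rw [← Submodule.topologicalClosure_coe, span_fourier_closure_eq_top]
      trivial
    obtain ⟨q, hq1, hq2⟩ := Metric.mem_closure_iff.mp hmem (κ / 2) (by positivity)
    exact ⟨q, hq1, by rwa [dist_eq_norm] at hq2⟩
  obtain ⟨c, hc⟩ := (Finsupp.mem_span_range_iff_exists_finsupp).mp hqspan
  have hqx : ∀ t : Torus, q t = ∑ m ∈ c.support, c m * fourier m t := by
    intro t
    rw [← hc, Finsupp.sum]
    simp [ContinuousMap.sum_apply]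
  have hqre : ∀ t : Torus, u t ≤ (q t).re ∧ (q t).re ≤ u t + κ := by
    intro t
    have h1 := (ContinuousMap.norm_coe_le_norm _ t).trans hq.le
    have h2 := (abs_re_le_norm _).trans h1
    simp only [ContinuousMap.sub_apply, ContinuousMap.coe_mk, sub_re, ofReal_re] at h2
    have := abs_le.mp h2
    constructor <;> linarith
  set G : ℂ → ℂ := fun z => ∑ m ∈ c.support,
    (if 0 ≤ m then c m else (starRingEnd ℂ) (c m)) *
      Complex.exp (2 * Real.pi * I * m.natAbs * z) with hG
  have hGre : ∀ z : ℂ, (G z).re = (∑ m ∈ c.support, c m *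
      ((Real.exp (-(2 * Real.pi * z.im)) ^ m.natAbs : ℝ) * fourier m (z.re : Torus))).re := by
    intro z
    simp only [hG, re_sum]
    exact Finset.sum_congr rfl fun m _ => re_entire_of_trigPoly c m z
  have hGreal : ∀ z : ℂ, z.im = 0 → (G z).re = (q (z.re : Torus)).re := by
    intro z hz
    rw [hGre, hqx, hz]
    simp
  have hqc : Continuous fun t : Torus => (q t).re := by fun_prop
  have hGpos : ∀ z : ℂ, 0 < z.im →
      (G z).re = poissonAvg (Real.exp (-(2 * Real.pi * z.im))) (fun t => (q t).re) z.re := by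
    intro z hz
    rw [hGre]
    have hr1 := exp_neg_lt_one hz
    have hr0 := (Real.exp_pos (-(2 * Real.pi * z.im))).le
    have hcp := continuous_circlePoisson hr0 hr1
    have : (∑ m ∈ c.support, c m *
        ((Real.exp (-(2 * Real.pi * z.im)) ^ m.natAbs : ℝ) * fourier m (z.re : Torus))) =
        ∫ t : Torus, (circlePoisson (Real.exp (-(2 * Real.pi * z.im))) (z.re - t) : ℂ) * q t := by
      simp only [hqx, Finset.mul_sum]
      rw [integral_finsetSum _ fun m _ => integrable_of_continuous_torus (by fun_prop)]
      refine Finset.sum_congr rfl fun m _ => ?_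
      rw [← integral_circlePoisson_mul_fourier hr0 hr1, ← integral_const_mul]
      congr 1
      funext t
      ring
    rw [this]
    unfold poissonAvg
    rw [← reCLM_apply, ← ContinuousLinearMap.integral_comp_comm _
      (integrable_of_continuous_torus (by fun_prop))]
    simp
  have hGnonneg : ∀ z : ℂ, 0 ≤ z.im → 0 ≤ (G z).re := by
    intro z hz
    rcases hz.eq_or_lt with h0 | h0
    · rw [hGreal z h0.symm]; exact (hu0 _).trans (hqre _).1
    · rw [hGpos z h0]
      exact poissonAvg_nonneg (Real.exp_pos _).le (exp_neg_lt_one h0)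
        (fun t => (hu0 t).trans (hqre t).1) _
  have hGd : Differentiable ℂ G := by
    intro z
    simp only [hG]
    fun_prop
  set W : ℂ → E := fun z => Complex.exp (-G z + I * b * z / h) • A z with hW
  have hWnorm : ∀ z, ‖W z‖ = Real.exp (-(G z).re - b * z.im / h) * ‖A z‖ := by
    intro z
    simp only [hW, norm_smul, Complex.norm_exp]
    congr 2
    have : I * b * z / h = ((b / h : ℝ) : ℂ) * (I * z) := by push_cast; ring
    rw [add_re, neg_re, this, re_ofReal_mul, I_mul_re]
    ring
  have hWle : ∀ z : ℂ, 0 ≤ z.im → z.im ≤ h → ‖W z‖ ≤ 1 := by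
    intro z hz0 hzh
    refine PhragmenLindelof.horizontal_strip (a := 0) (b := h) (f := W) ?_ ?_ ?_ ?_ hz0 hzh
    · refine DifferentiableOn.diffContOnCl ?_
      intro w hw
      have hw' : w ∈ im ⁻¹' Set.Icc 0 h := by
        refine closure_minimal (Set.preimage_mono Set.Ioo_subset_Icc_self)
          (isClosed_Icc.preimage continuous_im) hw
      refine DifferentiableAt.differentiableWithinAt ?_
      simp only [hW]
      exact DifferentiableAt.smul (by fun_prop) (hd w hw'.1 hw'.2)
    · refine ⟨0, div_pos Real.pi_pos (by linarith), 0, ?_⟩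
      refine Asymptotics.IsBigO.of_bound (Real.exp b) ?_
      refine eventually_inf_principal.mpr (Eventually.of_forall fun w hw => ?_)
      rw [hWnorm]
      have h1 := hGnonneg w hw.1.le
      have h2 := hb w hw.1.le hw.2.le
      have h3 : Real.exp (-(G w).re - b * w.im / h) ≤ 1 := by
        apply Real.exp_le_one_iff.mpr
        have : 0 ≤ b * w.im / h := by have := hw.1; positivity
        linarith
      calc _ ≤ 1 * Real.exp b := by gcongr
        _ = _ := by simp
    · intro w hw
      rw [hWnorm, hw, hGreal w hw]
      have hw2 : w = (w.re : ℂ) := by apply Complex.ext <;> simp [hw]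
      have h1 := hu w.re
      rw [← hw2] at h1
      calc _ ≤ Real.exp (-(q (w.re : Torus)).re - b * 0 / h) * Real.exp (u (w.re : Torus)) := by
            gcongr
        _ ≤ 1 := by
          rw [← Real.exp_add]
          apply Real.exp_le_one_iff.mpr
          have := (hqre (w.re : Torus)).1
          simp; linarith
    · intro w hw
      rw [hWnorm, hw]
      have h1 := hb w (by linarith) hw.le
      have h2 := hGnonneg w (by linarith)
      calc _ ≤ Real.exp (-(G w).re - b * h / h) * Real.exp b := by gcongr
        _ ≤ 1 := by
          rw [← Real.exp_add]
          apply Real.exp_le_one_iff.mpr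
          rw [mul_div_assoc, div_self hh.ne']
          linarith
  have hfin := hWle (x + η * I) (by simp [hη.le]) (by simpa using hηh)
  rw [hWnorm] at hfin
  have him : ((x : ℂ) + η * I).im = η := by simp
  have hre : ((x : ℂ) + η * I).re = x := by simp
  rw [hGpos _ (by rw [him]; exact hη), him, hre] at hfin
  have hPle : poissonAvg (Real.exp (-(2 * Real.pi * η))) (fun t => (q t).re) x ≤
      poissonAvg (Real.exp (-(2 * Real.pi * η))) u x + κ := by
    have hr1 := exp_neg_lt_one hη
    have hr0 := (Real.exp_pos (-(2 * Real.pi * η))).le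
    refine (poissonAvg_mono hr0 hr1 hqc (by fun_prop : Continuous fun t => u t + κ)
      (fun t => (hqre t).2) _).trans_eq ?_
    rw [poissonAvg_add hr0 hr1 huc (by fun_prop), poissonAvg_const hr0 hr1]
  rw [show -poissonAvg (Real.exp (-(2 * Real.pi * η))) (fun t => (q t).re) x - b * η / h =
    -(poissonAvg (Real.exp (-(2 * Real.pi * η))) (fun t => (q t).re) x + b * η / h) by ring,
    Real.exp_neg, inv_mul_le_iff₀ (Real.exp_pos _), mul_one] at hfin
  exact hfin.trans (Real.exp_le_exp.mpr (by linarith))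

lemma norm_fourierCoeff_le_of_bound {u : Torus → ℂ} {B : ℝ} (hB : ∀ t, ‖u t‖ ≤ B) (m : ℤ) :
    ‖fourierCoeff u m‖ ≤ B := by
  rw [fourierCoeff_eq_integral_torus]
  refine (norm_integral_le_of_norm_le_const (C := B) (Eventually.of_forall fun t => ?_)).trans ?_
  · rw [norm_mul, norm_fourier_apply, one_mul]; exact hB t
  · simp

lemma exists_bound_of_continuous_torus {u : Torus → ℝ} (hu : Continuous u) :
    ∃ B, ∀ t, ‖(u t : ℂ)‖ ≤ B := by
  obtain ⟨B, hB⟩ := isCompact_univ.exists_bound_of_continuousOn (f := fun t => (u t : ℂ))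
    (by fun_prop : Continuous fun t => (u t : ℂ)).continuousOn
  exact ⟨B, fun t => hB t trivial⟩

lemma hasSum_poissonAvg {r : ℝ} (hr0 : 0 ≤ r) (hr1 : r < 1) {u : Torus → ℝ}
    (hu : Continuous u) (x : Torus) :
    HasSum (fun m : ℤ => (r ^ m.natAbs : ℝ) * fourierCoeff (fun t => (u t : ℂ)) m * fourier m x)
      (poissonAvg r u x : ℂ) := by
  obtain ⟨B, hB⟩ := exists_bound_of_continuous_torus hu
  have hc := continuous_poissonAvg hr0 hr1 hu
  set f : C(Torus, ℂ) := ⟨fun x => (poissonAvg r u x : ℂ), by fun_prop⟩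
  have hf : ∀ m, fourierCoeff f m = (r ^ m.natAbs : ℝ) * fourierCoeff (fun t => (u t : ℂ)) m :=
    fun m => fourierCoeff_poissonAvg hr0 hr1 hu m
  have hs : Summable (fourierCoeff f) := by
    refine Summable.of_norm_bounded (g := fun m : ℤ => r ^ m.natAbs * B)
      ((summable_pow_natAbs hr0 hr1).mul_right B) fun m => ?_
    rw [hf, norm_mul, norm_real, Real.norm_of_nonneg (by positivity)]
    exact mul_le_mul_of_nonneg_left (norm_fourierCoeff_le_of_bound hB m) (by positivity)
  have := has_pointwise_sum_fourier_series_of_summable hs x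
  simp only [hf, smul_eq_mul] at this
  exact this

lemma poissonAvg_poissonAvg {r : ℝ} (hr0 : 0 ≤ r) (hr1 : r < 1) {u : Torus → ℝ}
    (hu : Continuous u) (x : Torus) :
    poissonAvg r (poissonAvg r u) x = poissonAvg (r ^ 2) u x := by
  have h1 := hasSum_poissonAvg hr0 hr1 (continuous_poissonAvg hr0 hr1 hu) x
  have h2 := hasSum_poissonAvg (sq_nonneg r) (by nlinarith) hu x
  simp only [fourierCoeff_poissonAvg hr0 hr1 hu] at h1
  have h3 : (fun m : ℤ => (r ^ m.natAbs : ℝ) * ((r ^ m.natAbs : ℝ) *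
      fourierCoeff (fun t => (u t : ℂ)) m) * fourier m x) =
      fun m : ℤ => ((r ^ 2) ^ m.natAbs : ℝ) * fourierCoeff (fun t => (u t : ℂ)) m *
        fourier m x := by
    funext m
    push_cast
    ring
  rw [h3] at h1
  exact_mod_cast h1.unique h2

lemma integral_poissonAvg {r : ℝ} (hr0 : 0 ≤ r) (hr1 : r < 1) {u : Torus → ℝ}
    (hu : Continuous u) : ∫ x, poissonAvg r u x = ∫ x, u x := by
  have h := fourierCoeff_poissonAvg hr0 hr1 hu 0
  simp only [fourierCoeff_eq_integral_torus, neg_zero, fourier_zero, one_mul, Int.natAbs_zero,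
    pow_zero, ofReal_one] at h
  rw [integral_complex_ofReal, integral_complex_ofReal] at h
  exact_mod_cast h

lemma poissonAvg_comp_neg (r : ℝ) (u : Torus → ℝ) (x : Torus) :
    poissonAvg r (fun t => u (-t)) (-x) = poissonAvg r u x := by
  unfold poissonAvg
  rw [← integral_neg_eq_self (fun t => circlePoisson r (x - t) * u t) volume]
  refine integral_congr_ae (Eventually.of_forall fun t => ?_)
  simp only
  rw [← circlePoisson_neg r (x - -t)]
  congr 2
  abel

/-- Poisson averaging at height `η`. -/
def heightAvg (η : ℝ) (u : Torus → ℝ) (x : Torus) : ℝ :=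
  poissonAvg (Real.exp (-(2 * Real.pi * η))) u x

lemma heightAvg_heightAvg {η : ℝ} (hη : 0 < η) {u : Torus → ℝ} (hu : Continuous u) (x : Torus) :
    heightAvg η (heightAvg η u) x = heightAvg (2 * η) u x := by
  unfold heightAvg
  rw [poissonAvg_poissonAvg (Real.exp_pos _).le (exp_neg_lt_one hη) hu, ← Real.exp_nat_mul]
  congr 2
  push_cast; ring

lemma continuous_heightAvg {η : ℝ} (hη : 0 < η) {u : Torus → ℝ} (hu : Continuous u) :
    Continuous (heightAvg η u) :=
  continuous_poissonAvg (Real.exp_pos _).le (exp_neg_lt_one hη) hu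

lemma heightAvg_add_const {η : ℝ} (hη : 0 < η) {u : Torus → ℝ} (hu : Continuous u) (c : ℝ)
    (x : Torus) : heightAvg η (fun t => u t + c) x = heightAvg η u x + c := by
  unfold heightAvg
  rw [poissonAvg_add (Real.exp_pos _).le (exp_neg_lt_one hη) hu continuous_const,
    poissonAvg_const (Real.exp_pos _).le (exp_neg_lt_one hη)]

lemma heightAvg_le {η : ℝ} (hη : 0 < η) {u : Torus → ℝ} (hu : Continuous u) {c : ℝ}
    (h : ∀ t, u t ≤ c) (x : Torus) : heightAvg η u x ≤ c := by
  have := poissonAvg_mono (Real.exp_pos _).le (exp_neg_lt_one hη) hu continuous_const h x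
  rwa [poissonAvg_const (Real.exp_pos _).le (exp_neg_lt_one hη)] at this

lemma le_heightAvg {η : ℝ} (hη : 0 < η) {u : Torus → ℝ} (hu : Continuous u) {c : ℝ}
    (h : ∀ t, c ≤ u t) (x : Torus) : c ≤ heightAvg η u x := by
  have := poissonAvg_mono (Real.exp_pos _).le (exp_neg_lt_one hη) continuous_const hu h x
  rwa [poissonAvg_const (Real.exp_pos _).le (exp_neg_lt_one hη)] at this

lemma one_sub_exp_ge {η : ℝ} (hη1 : η ≤ 1) (hη : 0 < η) :
    η / 2 ≤ 1 - Real.exp (-(2 * Real.pi * η)) := by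
  have h1 : Real.exp (-(2 * Real.pi * η)) ≤ (1 + 2 * Real.pi * η)⁻¹ := by
    rw [Real.exp_neg]
    apply inv_anti₀
    · have := Real.pi_pos; positivity
    · have := Real.add_one_le_exp (2 * Real.pi * η); linarith
  have h2 : (1 + 2 * Real.pi * η)⁻¹ ≤ 1 - η / 2 := by
    rw [inv_le_iff_one_le_mul₀ (by have := Real.pi_pos; positivity)]
    have := Real.pi_gt_three
    have := mul_nonneg (mul_nonneg (sub_nonneg.mpr hη1) Real.pi_pos.le) hη.le
    nlinarith [mul_pos hη hη]
  linarith

/-- Pointwise upper bound for the Poisson kernel at height `η`. -/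
lemma circlePoisson_exp_le {η : ℝ} (hη : 0 < η) (hη1 : η ≤ 1) (x : Torus) :
    circlePoisson (Real.exp (-(2 * Real.pi * η))) x ≤ 4 / η := by
  refine (circlePoisson_le (Real.exp_pos _).le (exp_neg_lt_one hη) x).trans ?_
  have := one_sub_exp_ge hη1 hη
  calc _ ≤ 2 / (η / 2) := by gcongr
    _ = 4 / η := by field_simp; norm_num

/-- Pointwise lower bound for the Poisson kernel at height `η` near the origin. -/
lemma le_circlePoisson_exp {η : ℝ} (hη : 0 < η) (hη1 : η ≤ 1) {x : ℝ} (hx : |x| ≤ η) :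
    1 / (320 * η) ≤ circlePoisson (Real.exp (-(2 * Real.pi * η))) (x : Torus) := by
  have hr1 := exp_neg_lt_one hη
  have hlow := one_sub_exp_ge hη1 hη
  have hup : 1 - Real.exp (-(2 * Real.pi * η)) ≤ 2 * Real.pi * η := by
    have := Real.add_one_le_exp (-(2 * Real.pi * η)); linarith
  set r := Real.exp (-(2 * Real.pi * η)) with hr
  have hr0 : 0 < r := Real.exp_pos _
  unfold circlePoisson
  have hpi := Real.pi_pos
  have hpi4 := Real.pi_lt_d2
  have h1 : ‖1 - (r : ℂ) * fourier 1 (x : Torus)‖ ≤ 4 * Real.pi * η := by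
    have e1 : (1 : ℂ) - (r : ℂ) * fourier 1 (x : Torus) =
        (1 - r : ℝ) + (r : ℝ) * (1 - fourier 1 (x : Torus)) := by push_cast; ring
    have e2 : ‖1 - (fourier 1 (x : Torus) : ℂ)‖ ≤ 2 * Real.pi * η := by
      rw [fourier_coe_apply, norm_sub_rev]
      have := Real.norm_exp_I_mul_ofReal_sub_one_le (x := 2 * Real.pi * x)
      have e3 : (2 * Real.pi * I * (1 : ℤ) * x / (1 : ℝ) : ℂ) = I * (2 * Real.pi * x : ℝ) := by
        push_cast; ring
      rw [e3]
      refine this.trans ?_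
      rw [Real.norm_eq_abs, abs_mul, abs_of_pos (by positivity)]
      gcongr
    rw [e1]
    refine (norm_add_le _ _).trans ?_
    rw [norm_mul, norm_real, norm_real, Real.norm_of_nonneg (by linarith),
      Real.norm_of_nonneg hr0.le]
    nlinarith [norm_nonneg (1 - (fourier 1 (x : Torus) : ℂ))]
  have h2 : 0 < ‖1 - (r : ℂ) * fourier 1 (x : Torus)‖ := by
    have := norm_one_sub_mul_fourier_ge hr0.le (x : Torus)
    linarith
  rw [div_le_div_iff₀ (by positivity) (by positivity)]
  have h3 : ‖1 - (r : ℂ) * fourier 1 (x : Torus)‖ ^ 2 ≤ (4 * Real.pi * η) ^ 2 := by gcongr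
  have h4 : η / 2 ≤ 1 - r ^ 2 := by nlinarith
  have h5 : Real.pi ^ 2 ≤ 10 := by nlinarith
  have h6 : (4 * Real.pi * η) ^ 2 ≤ 160 * η * η := by nlinarith [mul_pos hη hη]
  nlinarith

/-- A holomorphic function, periodic data on the real line, with logarithm between bounds. -/
structure IsStripBounded {E : Type*} [NormedAddCommGroup E] [NormedSpace ℂ E] (A : ℂ → E)
    (h b : ℝ) : Prop where
  differentiableAt : ∀ z : ℂ, |z.im| ≤ h → DifferentiableAt ℂ A z
  norm_le : ∀ z : ℂ, |z.im| ≤ h → ‖A z‖ ≤ Real.exp b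

section Strip

variable {E : Type*} [NormedAddCommGroup E] [NormedSpace ℂ E] {A : ℂ → E} {h b : ℝ}

lemma IsStripBounded.comp_neg (hA : IsStripBounded A h b) : IsStripBounded (fun z => A (-z))
    h b where
  differentiableAt z hz := by
    have : DifferentiableAt ℂ A (-z) := hA.differentiableAt _ (by simpa using hz)
    exact this.comp z differentiableAt_id.neg
  norm_le z hz := hA.norm_le _ (by simpa using hz)

/-- Majorisation on the line at signed height. -/
lemma IsStripBounded.norm_le_exp_heightAvg (hA : IsStripBounded A h b) (hb0 : 0 ≤ b) {η : ℝ}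
    (hη : 0 < η) (hηh : η ≤ h) {u : Torus → ℝ} (huc : Continuous u) (hu0 : ∀ t, 0 ≤ u t)
    (hu : ∀ x : ℝ, ‖A x‖ ≤ Real.exp (u x)) (x : ℝ) :
    ‖A (x + η * I)‖ ≤ Real.exp (heightAvg η u x + b * η / h) :=
  _root_.norm_le_exp_poissonAvg hb0 hη hηh
    (fun z h0 h1 => hA.differentiableAt z (by rwa [abs_of_nonneg h0])) huc hu0 hu
    (fun z h0 h1 => hA.norm_le z (by rwa [abs_of_nonneg h0])) x

lemma IsStripBounded.norm_le_exp_heightAvg_neg (hA : IsStripBounded A h b) (hb0 : 0 ≤ b) {η : ℝ}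
    (hη : 0 < η) (hηh : η ≤ h) {u : Torus → ℝ} (huc : Continuous u) (hu0 : ∀ t, 0 ≤ u t)
    (hu : ∀ x : ℝ, ‖A x‖ ≤ Real.exp (u x)) (x : ℝ) :
    ‖A (x - η * I)‖ ≤ Real.exp (heightAvg η u x + b * η / h) := by
  have := hA.comp_neg.norm_le_exp_heightAvg hb0 hη hηh (u := fun t => u (-t)) (by fun_prop)
    (fun t => hu0 _) (fun x => by simpa using hu (-x)) (-x)
  simp only [heightAvg, QuotientAddGroup.mk_neg] at this ⊢
  rw [poissonAvg_comp_neg] at this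
  convert this using 3
  push_cast; ring

/-- Majorisation on the strip above a line of negative height. -/
lemma IsStripBounded.norm_le_exp_of_line (hA : IsStripBounded A h b) (hb0 : 0 ≤ b) {s η : ℝ}
    (hs : 0 ≤ s) (hsh : s ≤ h) (hη : 0 < η) (hηh : η ≤ h) {u : Torus → ℝ} (huc : Continuous u)
    (hu0 : ∀ t, 0 ≤ u t) (hu : ∀ x : ℝ, ‖A (x - s * I)‖ ≤ Real.exp (u x)) (x : ℝ) :
    ‖A (x + (η - s) * I)‖ ≤ Real.exp (heightAvg η u x + b * η / h) := by
  have him : ∀ z : ℂ, (z - s * I).im = z.im - s := fun z => by simp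
  have key := _root_.norm_le_exp_poissonAvg (A := fun z => A (z - s * I)) hb0 hη hηh
    (fun z h0 h1 => by
      have : DifferentiableAt ℂ A (z - s * I) := hA.differentiableAt _ (by
        rw [him, abs_le]; constructor <;> linarith)
      exact this.comp z (differentiableAt_id.sub_const _)) huc hu0 hu
    (fun z h0 h1 => hA.norm_le _ (by rw [him, abs_le]; constructor <;> linarith)) x
  unfold heightAvg
  convert key using 3
  ring

/-- Propagation of a constant bound from one line to a strip. -/
lemma IsStripBounded.norm_le_exp_of_line_const (hA : IsStripBounded A h b) (hb0 : 0 ≤ b) {s K : ℝ}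
    (hs : 0 < s) (hsh : 2 * s ≤ h) (hK : 0 ≤ K) (hu : ∀ x : ℝ, ‖A (x - s * I)‖ ≤ Real.exp K)
    (z : ℂ) (hz : |z.im| ≤ s) : ‖A z‖ ≤ Real.exp (K + b * (2 * s) / h) := by
  have hz' := abs_le.mp hz
  have hh : 0 < h := by linarith
  rcases hz'.1.eq_or_lt with h0 | h0
  · have := hu z.re
    have e : z = z.re - s * I := by apply Complex.ext <;> simp [← h0]
    rw [← e] at this
    refine this.trans (Real.exp_le_exp.mpr ?_)
    have : 0 ≤ b * (2 * s) / h := by positivity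
    linarith
  · have := hA.norm_le_exp_of_line hb0 hs.le (by linarith) (η := z.im + s) (by linarith)
      (by linarith) (u := fun _ => K) continuous_const (fun _ => hK) hu z.re
    have e : z = z.re + (((z.im + s : ℝ) : ℂ) - s) * I := by apply Complex.ext <;> simp
    rw [← e] at this
    refine this.trans (Real.exp_le_exp.mpr ?_)
    have e2 : heightAvg (z.im + s) (fun _ => K) z.re = K :=
      poissonAvg_const (Real.exp_pos _).le (exp_neg_lt_one (by linarith)) K _
    rw [e2]
    have : b * (z.im + s) / h ≤ b * (2 * s) / h := by gcongr; linarith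
    linarith

/-- The logarithm of the norm is almost subharmonic with respect to Poisson averages. -/
lemma IsStripBounded.le_heightAvg (hA : IsStripBounded A h b) (hb0 : 0 ≤ b) {η : ℝ}
    (hη : 0 < η) (hηh : η ≤ h) {u : Torus → ℝ} (huc : Continuous u) (hu0 : ∀ t, 0 ≤ u t)
    (hu : ∀ x : ℝ, ‖A x‖ = Real.exp (u x)) (x : ℝ) :
    u x ≤ heightAvg (2 * η) u x + 2 * (b * η / h) := by
  have hh : 0 < h := hη.trans_le hηh
  have h1 := hA.norm_le_exp_heightAvg_neg hb0 hη hηh huc hu0 (fun x => (hu x).le)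
  have h2 := hA.norm_le_exp_of_line hb0 hη.le hηh hη hηh
    (u := fun t => heightAvg η u t + b * η / h)
    ((continuous_heightAvg hη huc).add continuous_const)
    (fun t => add_nonneg (_root_.le_heightAvg hη huc hu0 t) (by positivity)) h1 x
  rw [sub_self, zero_mul, add_zero, hu, heightAvg_add_const hη (continuous_heightAvg hη huc),
    heightAvg_heightAvg hη huc] at h2
  have := Real.exp_le_exp.mp h2
  linarith

lemma IsStripBounded.integral_abs_heightAvg_sub_le (hA : IsStripBounded A h b) (hb0 : 0 ≤ b)
    (hh : 0 < h) {η : ℝ} (hη : 0 < η) {u : Torus → ℝ} (huc : Continuous u) (hu0 : ∀ t, 0 ≤ u t)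
    (hu : ∀ x : ℝ, ‖A x‖ = Real.exp (u x)) :
    ∫ x, |heightAvg (2 * η) u x - u x| ≤ 4 * b * η / h := by
  have h2η : 0 < 2 * η := by linarith
  have hc := continuous_heightAvg h2η huc
  rcases le_or_gt η h with hηh | hηh
  · have h1 : ∀ x : Torus, |heightAvg (2 * η) u x - u x| ≤
        (heightAvg (2 * η) u x - u x) + 4 * b * η / h := by
      intro x
      induction x using QuotientAddGroup.induction_on with
      | H x =>
        have := hA.le_heightAvg hb0 hη hηh huc hu0 hu x
        have h3 : 4 * b * η / h = 2 * (2 * (b * η / h)) := by ring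
        have h4 : 0 ≤ b * η / h := by positivity
        rw [abs_le]
        constructor <;> [skip; linarith]
        have h5 : u x ≤ heightAvg (2 * η) u x + 2 * (b * η / h) := this
        change -(heightAvg (2 * η) u (x : Torus) - u (x : Torus) + 4 * b * η / h) ≤
          heightAvg (2 * η) u (x : Torus) - u (x : Torus)
        linarith
    calc _ ≤ ∫ x, ((heightAvg (2 * η) u x - u x) + 4 * b * η / h) :=
          integral_mono (integrable_of_continuous_torus (by fun_prop))
            (integrable_of_continuous_torus (by fun_prop)) h1
      _ = 4 * b * η / h := by
        rw [integral_add (integrable_of_continuous_torus (by fun_prop)) (integrable_const _),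
          integral_sub (integrable_of_continuous_torus hc) (integrable_of_continuous_torus huc)]
        have : ∫ x, heightAvg (2 * η) u x = ∫ x, u x :=
          integral_poissonAvg (Real.exp_pos _).le (exp_neg_lt_one h2η) huc
        rw [this]
        simp
  · have hub : ∀ x : Torus, u x ≤ b := by
      intro x
      induction x using QuotientAddGroup.induction_on with
      | H x =>
        have := hA.norm_le x (by simpa using hh.le)
        rw [hu] at this
        exact Real.exp_le_exp.mp this
    have h1 : ∀ x : Torus, |heightAvg (2 * η) u x - u x| ≤ b := by
      intro x
      have := _root_.le_heightAvg h2η huc hu0 x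
      have := heightAvg_le h2η huc hub x
      have := hub x
      have := hu0 x
      rw [abs_le]; constructor <;> linarith
    calc _ ≤ ∫ x : Torus, b := integral_mono (integrable_of_continuous_torus (by fun_prop))
            (integrable_of_continuous_torus (by fun_prop)) h1
      _ = b := by simp
      _ ≤ 4 * b * η / h := by
        rw [le_div_iff₀ hh]; nlinarith

end Strip

lemma exists_real_repr (θ : Torus) : ∃ r : ℝ, (r : Torus) = θ ∧ |r| = ‖θ‖ := by
  induction θ using QuotientAddGroup.induction_on with
  | H x =>
    refine ⟨x - round x, ?_, ?_⟩
    · have : ((round x : ℝ) : Torus) = 0 := by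
        rw [AddCircle.coe_eq_zero_iff]; exact ⟨round x, by simp⟩
      rw [AddCircle.coe_sub, this, sub_zero]
    · have := AddCircle.norm_eq (p := (1 : ℝ)) (x := x)
      simp only [inv_one, one_mul, mul_one] at this
      exact this.symm

lemma norm_coe_torus_le (r : ℝ) : ‖(r : Torus)‖ ≤ |r| := by
  have := AddCircle.norm_eq (p := (1 : ℝ)) (x := r)
  simp only [inv_one, one_mul, mul_one] at this
  rw [this]
  have := round_le r 0
  simpa using this

lemma four_mul_norm_le_norm_toCircle_sub_one (θ : Torus) :
    4 * ‖θ‖ ≤ ‖(AddCircle.toCircle θ : ℂ) - 1‖ := by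
  obtain ⟨r, rfl, hr⟩ := exists_real_repr θ
  have hhalf : ‖(r : Torus)‖ ≤ 1 / 2 := by
    have := AddCircle.norm_le_half_period 1 (x := (r : Torus)) one_ne_zero
    simpa using this
  rw [AddCircle.toCircle_apply_mk, Circle.coe_exp, mul_comm _ I,
    Complex.norm_exp_I_mul_ofReal_sub_one, ← hr, div_one]
  have h1 := Real.mul_abs_le_abs_sin (x := 2 * Real.pi * r / 2) (by
    rw [abs_div, abs_mul, abs_of_pos (by positivity : 0 < 2 * Real.pi), abs_two, hr]
    have := Real.pi_pos; nlinarith)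
  have hpi := Real.pi_pos
  rw [norm_mul, Real.norm_eq_abs, Real.norm_eq_abs, abs_two]
  have h2 : 2 / Real.pi * |2 * Real.pi * r / 2| = 2 * |r| := by
    rw [abs_div, abs_mul, abs_of_pos (by positivity : 0 < 2 * Real.pi), abs_two]
    field_simp
  linarith

/-- Geometric sums of characters. -/
lemma norm_sum_toCircle_le (h θ : Torus) (hθ : 0 < ‖θ‖) (n : ℕ) :
    ‖∑ k ∈ Finset.range n, (AddCircle.toCircle (h + k • θ) : ℂ)‖ ≤ 1 / (2 * ‖θ‖) := by
  set z : ℂ := (AddCircle.toCircle θ : ℂ) with hz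
  have hterm : ∀ k : ℕ, (AddCircle.toCircle (h + k • θ) : ℂ) =
      (AddCircle.toCircle h : ℂ) * z ^ k := by
    intro k
    rw [AddCircle.toCircle_add, AddCircle.toCircle_nsmul]; simp [hz]
  simp only [hterm]
  rw [← Finset.mul_sum, norm_mul, Circle.norm_coe, one_mul]
  have h4 := four_mul_norm_le_norm_toCircle_sub_one θ
  have hne : z ≠ 1 := by
    intro hz1
    rw [← hz, hz1] at h4; simp at h4; linarith
  rw [geom_sum_eq hne, norm_div]
  have hnum : ‖z ^ n - 1‖ ≤ 2 := by
    refine (norm_sub_le _ _).trans ?_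
    rw [norm_pow, hz, Circle.norm_coe]; norm_num
  have hpos : 0 < ‖z - 1‖ := by linarith
  rw [div_le_div_iff₀ hpos (by positivity)]
  nlinarith

/-- Van der Corput's inequality in its simplest form. -/
lemma norm_sum_sq_le_vanDerCorput (a : ℕ → ℂ) (N : ℕ) :
    ‖∑ j ∈ Finset.range N, a j‖ ^ 2 ≤ 2 * ∑ q ∈ Finset.range N,
      ‖∑ k ∈ Finset.range (N - q), a (q + k) * (starRingEnd ℂ) (a k)‖ := by
  have h1 : ∀ N : ℕ, ‖∑ j ∈ Finset.range N, a j‖ ^ 2 ≤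
      2 * (∑ j ∈ Finset.range N, a j * (starRingEnd ℂ) (∑ k ∈ Finset.range (j + 1), a k)).re := by
    intro N
    induction N with
    | zero => simp
    | succ N ih =>
      rw [Finset.sum_range_succ, Finset.sum_range_succ _ N, add_re,
        Finset.sum_range_succ (fun k => a k) N]
      set S := ∑ j ∈ Finset.range N, a j
      have h2 : ‖S + a N‖ ^ 2 = ‖S‖ ^ 2 + ‖a N‖ ^ 2 + 2 * (a N * (starRingEnd ℂ) S).re := by
        rw [← normSq_eq_norm_sq, ← normSq_eq_norm_sq, ← normSq_eq_norm_sq, normSq_add]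
        simp; ring
      have h3 : (a N * (starRingEnd ℂ) (S + a N)).re =
          (a N * (starRingEnd ℂ) S).re + ‖a N‖ ^ 2 := by
        rw [map_add, mul_add, add_re, mul_conj, ofReal_re, normSq_eq_norm_sq]
      rw [h2, h3]
      nlinarith [sq_nonneg ‖a N‖]
  refine (h1 N).trans ?_
  have h2 : ∑ j ∈ Finset.range N, a j * (starRingEnd ℂ) (∑ k ∈ Finset.range (j + 1), a k) =
      ∑ q ∈ Finset.range N, ∑ k ∈ Finset.range (N - q), a (q + k) * (starRingEnd ℂ) (a k) := by
    rw [← Finset.sum_range_diag_flip N (fun q k => a (q + k) * (starRingEnd ℂ) (a k))]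
    refine Finset.sum_congr rfl fun j _ => ?_
    rw [map_sum, Finset.mul_sum, ← Finset.sum_range_reflect]
    refine Finset.sum_congr rfl fun q hq => ?_
    have : q ≤ j := by have := Finset.mem_range.mp hq; omega
    rw [show q + (j - q) = j by omega, show j + 1 - 1 - q = j - q by omega]
  rw [h2]
  have h3 := (re_le_norm (∑ q ∈ Finset.range N, ∑ k ∈ Finset.range (N - q),
    a (q + k) * (starRingEnd ℂ) (a k))).trans (norm_sum_le _ _)
  linarith

/-- The phase of a character along the orbit of the skew-shift. -/
def orbitPhase (ω : Torus) (m l : ℤ) (x y : Torus) (j : ℕ) : Torus :=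
  m • (x + j • y + (j * (j - 1) / 2 : ℤ) • ω) + l • (y + j • ω)

lemma orbitPhase_sub (ω : Torus) (m l : ℤ) (x y : Torus) (q k : ℕ) :
    orbitPhase ω m l x y (q + k) - orbitPhase ω m l x y k =
      (m • (q • y + (q * (q - 1) / 2 : ℤ) • ω) + l • q • ω) + k • ((q * m : ℤ) • ω) := by
  have h : (((q + k : ℕ) : ℤ) * ((q + k : ℕ) - 1) / 2 : ℤ) =
      (q * (q - 1) / 2 : ℤ) + (k * (k - 1) / 2 : ℤ) + q * k := by
    have e : ∀ n : ℤ, 2 * (n * (n - 1) / 2) = n * (n - 1) := fun n =>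
      Int.mul_ediv_cancel' (Int.even_mul_pred_self n).two_dvd
    have e1 := e q
    have e2 := e k
    have e3 := e ((q + k : ℕ) : ℤ)
    push_cast at e3 ⊢
    nlinarith
  unfold orbitPhase
  rw [h]
  simp only [← natCast_zsmul]
  push_cast
  module

/-- Weyl's estimate for quadratic sums along the skew-shift. -/
lemma norm_sum_orbitPhase_sq_le (ω : Torus) {m : ℤ} (hm : m ≠ 0) (l : ℤ) (x y : Torus) (N : ℕ)
    (hω : ∀ q : ℕ, 0 < q → 0 < ‖q • ω‖) :
    ‖∑ j ∈ Finset.range N, (AddCircle.toCircle (orbitPhase ω m l x y j) : ℂ)‖ ^ 2 ≤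
      2 * N + ∑ q ∈ Finset.Icc 1 (m.natAbs * N), 1 / ‖q • ω‖ := by
  refine (norm_sum_sq_le_vanDerCorput _ N).trans ?_
  have hprod : ∀ q k : ℕ, (AddCircle.toCircle (orbitPhase ω m l x y (q + k)) : ℂ) *
      (starRingEnd ℂ) (AddCircle.toCircle (orbitPhase ω m l x y k) : ℂ) =
      (AddCircle.toCircle ((m • (q • y + (q * (q - 1) / 2 : ℤ) • ω) + l • q • ω) +
        k • ((q * m : ℤ) • ω)) : ℂ) := by
    intro q k
    rw [← orbitPhase_sub, sub_eq_add_neg, AddCircle.toCircle_add, AddCircle.toCircle_neg,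
      Circle.coe_mul, Circle.coe_inv_eq_conj]
  simp only [hprod]
  have hnorm : ∀ q : ℕ, ‖(q * m : ℤ) • ω‖ = ‖(m.natAbs * q) • ω‖ := by
    intro q
    rcases Int.natAbs_eq m with h | h
    · conv_lhs => rw [h]
      rw [← natCast_zsmul]; congr 2; push_cast; ring
    · conv_lhs => rw [h]
      rw [← natCast_zsmul, ← norm_neg, ← neg_smul]; congr 2; push_cast; ring
  have hmpos : 0 < m.natAbs := Int.natAbs_pos.mpr hm
  rcases N.eq_zero_or_pos with rfl | hN
  · simp
  have hterm : ∀ q ∈ Finset.Ico 1 N, ‖∑ k ∈ Finset.range (N - q), (AddCircle.toCircle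
      ((m • (q • y + (q * (q - 1) / 2 : ℤ) • ω) + l • q • ω) + k • ((q * m : ℤ) • ω)) : ℂ)‖ ≤
      1 / (2 * ‖(m.natAbs * q) • ω‖) := by
    intro q hq
    have hq1 := (Finset.mem_Ico.mp hq).1
    rw [← hnorm]
    exact norm_sum_toCircle_le _ _ (by rw [hnorm]; exact hω _ (by positivity)) _
  rw [Finset.range_eq_Ico, Finset.sum_eq_sum_Ico_succ_bot hN, mul_add]
  refine add_le_add ?_ ?_
  · refine mul_le_mul_of_nonneg_left ?_ zero_le_two
    refine (norm_sum_le _ _).trans ?_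
    simp
  · refine (mul_le_mul_of_nonneg_left (Finset.sum_le_sum hterm) zero_le_two).trans ?_
    rw [Finset.mul_sum]
    have e : ∀ q ∈ Finset.Ico (0 + 1) N, 2 * (1 / (2 * ‖(m.natAbs * q) • ω‖)) =
        1 / ‖(m.natAbs * q) • ω‖ := fun q _ => by field_simp
    rw [Finset.sum_congr rfl e]
    rw [← Finset.sum_image (g := fun q => m.natAbs * q) (f := fun q : ℕ => 1 / ‖q • ω‖)
      (fun a _ b _ hab => Nat.eq_of_mul_eq_mul_left hmpos hab)]
    refine Finset.sum_le_sum_of_subset_of_nonneg ?_ fun _ _ _ => by positivity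
    intro q hq
    obtain ⟨a, ha, rfl⟩ := Finset.mem_image.mp hq
    have := Finset.mem_Ico.mp ha
    exact Finset.mem_Icc.mpr ⟨by nlinarith, Nat.mul_le_mul_left _ this.2.le⟩

/-- Reciprocal sums over separated points. -/
lemma sum_one_div_le_of_separated {S : Finset ℕ} {t : ℕ → ℝ} {δ κ : ℝ} (hδ : 0 < δ) (hκ : 0 < κ)
    (h1 : ∀ q ∈ S, δ ≤ t q) (h2 : ∀ q ∈ S, t q ≤ 1)
    (h3 : ∀ q ∈ S, ∀ q' ∈ S, q ≠ q' → δ ≤ |t q - t q'|) :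
    ∑ q ∈ S, 1 / t q ≤ δ ^ (-(1 + κ)) * ∑' k : ℕ, (k : ℝ) ^ (-(1 + κ)) := by
  have hsum : Summable fun k : ℕ => (k : ℝ) ^ (-(1 + κ)) :=
    Real.summable_nat_rpow.mpr (by linarith)
  have hterm : ∀ q ∈ S, 1 / t q ≤ δ ^ (-(1 + κ)) * ((⌊t q / δ⌋₊ : ℕ) : ℝ) ^ (-(1 + κ)) := by
    intro q hq
    have htq := h1 q hq
    have ht1 := h2 q hq
    have hfl : ((⌊t q / δ⌋₊ : ℕ) : ℝ) ≤ t q / δ :=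
      Nat.floor_le (div_nonneg (hδ.le.trans htq) hδ.le)
    have hfl1 : 1 ≤ ⌊t q / δ⌋₊ := Nat.one_le_floor_iff _ |>.mpr (by rwa [one_le_div hδ])
    have hk1 : (1 : ℝ) ≤ ((⌊t q / δ⌋₊ : ℕ) : ℝ) := by exact_mod_cast hfl1
    set k : ℝ := ((⌊t q / δ⌋₊ : ℕ) : ℝ)
    have hkδ : δ * k ≤ t q := by rw [le_div_iff₀ hδ] at hfl; linarith
    have hpos : 0 < δ * k := by positivity
    rw [← Real.mul_rpow hδ.le (by linarith)]
    calc 1 / t q ≤ 1 / (δ * k) := by gcongr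
      _ = (δ * k) ^ (-1 : ℝ) := by rw [Real.rpow_neg_one, one_div]
      _ ≤ (δ * k) ^ (-(1 + κ)) :=
        Real.rpow_le_rpow_of_exponent_ge hpos (by linarith) (by linarith)
  refine (Finset.sum_le_sum hterm).trans ?_
  rw [← Finset.mul_sum]
  refine mul_le_mul_of_nonneg_left ?_ (by positivity)
  have hinj : Set.InjOn (fun q => ⌊t q / δ⌋₊) S := by
    intro q hq q' hq' heq
    by_contra hne
    have hsep := h3 q hq q' hq' hne
    have e1 : ((⌊t q / δ⌋₊ : ℕ) : ℝ) ≤ t q / δ := Nat.floor_le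
      (div_nonneg (hδ.le.trans (h1 q hq)) hδ.le)
    have e2 := Nat.lt_floor_add_one (t q / δ)
    have e3 : ((⌊t q' / δ⌋₊ : ℕ) : ℝ) ≤ t q' / δ := Nat.floor_le
      (div_nonneg (hδ.le.trans (h1 q' hq')) hδ.le)
    have e4 := Nat.lt_floor_add_one (t q' / δ)
    simp only at heq
    rw [heq] at e1 e2
    have : |t q / δ - t q' / δ| < 1 := by rw [abs_lt]; constructor <;> linarith
    rw [← sub_div, abs_div, abs_of_pos hδ, div_lt_one hδ] at this
    linarith
  rw [← Finset.sum_image (g := fun q => ⌊t q / δ⌋₊) (f := fun k : ℕ => (k : ℝ) ^ (-(1 + κ))) hinj]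
  exact hsum.sum_le_tsum _ fun _ _ => by positivity

/-- Reciprocal sums over a block for a Diophantine rotation. -/
lemma sum_one_div_norm_le {ω : Torus} {c κ : ℝ} (hc : 0 < c) (hκ : 0 < κ)
    (hω : ∀ q : ℕ, 0 < q → c * (q : ℝ) ^ (-(1 + κ)) ≤ ‖q • ω‖) (Q : ℕ) :
    ∑ q ∈ Finset.Icc 1 Q, 1 / ‖q • ω‖ ≤
      2 * ((c * (Q : ℝ) ^ (-(1 + κ))) ^ (-(1 + κ)) * ∑' k : ℕ, (k : ℝ) ^ (-(1 + κ))) := by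
  rcases Q.eq_zero_or_pos with rfl | hQ
  · simp only [zero_lt_one, Finset.Icc_eq_empty_of_lt, Finset.sum_empty]
    exact mul_nonneg zero_le_two (mul_nonneg (by positivity) (tsum_nonneg fun _ => by positivity))
  set δ := c * (Q : ℝ) ^ (-(1 + κ)) with hδdef
  have hδ : 0 < δ := by positivity
  have hlow : ∀ q : ℕ, 0 < q → q ≤ Q → δ ≤ ‖q • ω‖ := by
    intro q hq hqQ
    refine le_trans ?_ (hω q hq)
    refine mul_le_mul_of_nonneg_left ?_ hc.le
    exact Real.rpow_le_rpow_of_nonpos (by positivity) (by exact_mod_cast hqQ) (by linarith)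
  choose r hr using fun q : ℕ => exists_real_repr (q • ω)
  have hsep : ∀ q ∈ Finset.Icc 1 Q, ∀ q' ∈ Finset.Icc 1 Q, q ≠ q' → δ ≤ |r q - r q'| := by
    have key : ∀ q q' : ℕ, q ≤ Q → q' < q → δ ≤ |r q - r q'| := by
      intro q q' hq hlt
      refine (hlow (q - q') (by omega) (by omega)).trans ?_
      have : (q - q') • ω = ((r q - r q' : ℝ) : Torus) := by
        rw [AddCircle.coe_sub, (hr q).1, (hr q').1, eq_sub_iff_add_eq, ← add_smul]
        congr 1; omega
      rw [this]
      exact norm_coe_torus_le _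
    intro q hq q' hq' hne
    have hq2 := (Finset.mem_Icc.mp hq).2
    have hq2' := (Finset.mem_Icc.mp hq').2
    rcases lt_or_gt_of_ne hne with h | h
    · rw [abs_sub_comm]; exact key q' q hq2' h
    · exact key q q' hq2 h
  have hhalf : ∀ q : ℕ, ‖q • ω‖ ≤ 1 := fun q => by
    have := AddCircle.norm_le_half_period 1 (x := q • ω) one_ne_zero
    rw [abs_one] at this; linarith
  rw [← Finset.sum_filter_add_sum_filter_not (Finset.Icc 1 Q) (fun q => 0 ≤ r q), two_mul]
  have hmem : ∀ q ∈ Finset.Icc 1 Q, δ ≤ ‖q • ω‖ := fun q hq =>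
    hlow q (Finset.mem_Icc.mp hq).1 (Finset.mem_Icc.mp hq).2
  refine add_le_add ?_ ?_
  · refine sum_one_div_le_of_separated hδ hκ (fun q hq => hmem q (Finset.mem_filter.mp hq).1)
      (fun q _ => hhalf q) fun q hq q' hq' hne => ?_
    obtain ⟨hq, h0⟩ := Finset.mem_filter.mp hq
    obtain ⟨hq', h0'⟩ := Finset.mem_filter.mp hq'
    have := hsep q hq q' hq' hne
    rwa [← (hr q).2, ← (hr q').2, abs_of_nonneg h0, abs_of_nonneg h0']
  · refine sum_one_div_le_of_separated hδ hκ (fun q hq => hmem q (Finset.mem_filter.mp hq).1)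
      (fun q _ => hhalf q) fun q hq q' hq' hne => ?_
    obtain ⟨hq, h0⟩ := Finset.mem_filter.mp hq
    obtain ⟨hq', h0'⟩ := Finset.mem_filter.mp hq'
    have := hsep q hq q' hq' hne
    rw [← (hr q).2, ← (hr q').2, abs_of_neg (not_le.mp h0), abs_of_neg (not_le.mp h0')]
    rwa [neg_sub_neg, abs_sub_comm]

/-- Reciprocal sums over a block, in power form. -/
lemma exists_sum_one_div_norm_le {c κ : ℝ} (hc : 0 < c) (hκ : 0 < κ) (hκ1 : κ ≤ 1) :
    ∃ C > 0, ∀ ω : Torus, (∀ q : ℕ, 0 < q → c * (q : ℝ) ^ (-(1 + κ)) ≤ ‖q • ω‖) → ∀ Q : ℕ, 1 ≤ Q →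
      ∑ q ∈ Finset.Icc 1 Q, 1 / ‖q • ω‖ ≤ C * (Q : ℝ) ^ (1 + 3 * κ) := by
  have hsum : Summable fun k : ℕ => (k : ℝ) ^ (-(1 + κ)) :=
    Real.summable_nat_rpow.mpr (by linarith)
  have hZ : 0 < ∑' k : ℕ, (k : ℝ) ^ (-(1 + κ)) :=
    hsum.tsum_pos (fun _ => by positivity) 1 (by simp)
  refine ⟨2 * (c ^ (-(1 + κ)) * ∑' k : ℕ, (k : ℝ) ^ (-(1 + κ))), by positivity, fun ω hω Q hQ => ?_⟩
  refine (sum_one_div_norm_le hc hκ hω Q).trans ?_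
  have hQ0 : (0 : ℝ) < Q := by exact_mod_cast hQ
  rw [Real.mul_rpow hc.le (by positivity), ← Real.rpow_mul hQ0.le]
  have : (Q : ℝ) ^ (-(1 + κ) * -(1 + κ)) ≤ (Q : ℝ) ^ (1 + 3 * κ) :=
    Real.rpow_le_rpow_of_exponent_le (by exact_mod_cast hQ) (by nlinarith)
  calc _ = 2 * (c ^ (-(1 + κ)) * ∑' k : ℕ, (k : ℝ) ^ (-(1 + κ))) *
        (Q : ℝ) ^ (-(1 + κ) * -(1 + κ)) := by ring
    _ ≤ _ := by gcongr

/-- Weighted reciprocal sums for a Diophantine rotation converge. -/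
lemma exists_tsum_rpow_div_norm_le {c κ : ℝ} (hc : 0 < c) (hκ : 0 < κ) (hκ1 : κ ≤ 1) :
    ∃ C > 0, ∀ ω : Torus, (∀ q : ℕ, 0 < q → c * (q : ℝ) ^ (-(1 + κ)) ≤ ‖q • ω‖) →
      ∀ F : Finset ℕ, (∀ q ∈ F, 1 ≤ q) →
      ∑ q ∈ F, (q : ℝ) ^ (-(1 + 4 * κ)) * (1 / ‖q • ω‖) ≤ C := by
  obtain ⟨C, hC, hblock⟩ := exists_sum_one_div_norm_le hc hκ hκ1
  have hρ : (2 : ℝ) ^ (-κ) < 1 := Real.rpow_lt_one_of_one_lt_of_neg one_lt_two (by linarith)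
  have hρ0 : (0 : ℝ) ≤ 2 ^ (-κ) := by positivity
  refine ⟨C * 16 * (1 - 2 ^ (-κ))⁻¹, by
    have : 0 < 1 - (2 : ℝ) ^ (-κ) := by linarith
    positivity, fun ω hω F hF => ?_⟩
  have hblk : ∀ i : ℕ, ∑ q ∈ Finset.Ico ((2 : ℕ) ^ i) (2 ^ (i + 1)),
      (q : ℝ) ^ (-(1 + 4 * κ)) * (1 / ‖q • ω‖) ≤ C * 16 * ((2 : ℝ) ^ (-κ)) ^ i := by
    intro i
    have h1 : ∀ q ∈ Finset.Ico ((2 : ℕ) ^ i) (2 ^ (i + 1)), (q : ℝ) ^ (-(1 + 4 * κ)) *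
        (1 / ‖q • ω‖) ≤
        ((2 : ℝ) ^ i) ^ (-(1 + 4 * κ)) * (1 / ‖q • ω‖) := by
      intro q hq
      refine mul_le_mul_of_nonneg_right ?_ (by positivity)
      exact Real.rpow_le_rpow_of_nonpos (by positivity)
        (by exact_mod_cast (Finset.mem_Ico.mp hq).1) (by linarith)
    refine (Finset.sum_le_sum h1).trans ?_
    rw [← Finset.mul_sum]
    have h2 : ∑ q ∈ Finset.Ico ((2 : ℕ) ^ i) (2 ^ (i + 1)), 1 / ‖q • ω‖ ≤
        C * ((2 : ℝ) ^ (i + 1)) ^ (1 + 3 * κ) := by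
      refine (Finset.sum_le_sum_of_subset_of_nonneg ?_ fun _ _ _ => by positivity).trans
        ((hblock ω hω (2 ^ (i + 1)) Nat.one_le_two_pow).trans_eq (by push_cast; rfl))
      intro q hq
      have h := Finset.mem_Ico.mp hq
      exact Finset.mem_Icc.mpr ⟨Nat.one_le_two_pow.trans h.1, h.2.le⟩
    refine (mul_le_mul_of_nonneg_left h2 (by positivity)).trans ?_
    have e1 : ((2 : ℝ) ^ (i + 1)) ^ (1 + 3 * κ) = ((2 : ℝ) ^ i) ^ (1 + 3 * κ) *
        2 ^ (1 + 3 * κ) := by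
      rw [pow_succ, Real.mul_rpow (by positivity) (by positivity)]
    have e2 : ((2 : ℝ) ^ i) ^ (-(1 + 4 * κ)) * ((2 : ℝ) ^ i) ^ (1 + 3 * κ) =
        ((2 : ℝ) ^ (-κ)) ^ i := by
      rw [← Real.rpow_add (by positivity), ← Real.rpow_natCast, ← Real.rpow_natCast,
        ← Real.rpow_mul zero_le_two, ← Real.rpow_mul zero_le_two]
      congr 1; ring
    have e3 : (2 : ℝ) ^ (1 + 3 * κ) ≤ 16 := by
      calc (2 : ℝ) ^ (1 + 3 * κ) ≤ 2 ^ (4 : ℝ) :=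
            Real.rpow_le_rpow_of_exponent_le one_le_two (by linarith)
        _ = 16 := by norm_num
    rw [e1]
    calc _ = C * 2 ^ (1 + 3 * κ) *
          (((2 : ℝ) ^ i) ^ (-(1 + 4 * κ)) * ((2 : ℝ) ^ i) ^ (1 + 3 * κ)) := by ring
      _ ≤ C * 16 * ((2 : ℝ) ^ (-κ)) ^ i := by rw [e2]; gcongr
  have hind : ∀ J : ℕ, ∑ q ∈ Finset.Ico 1 ((2 : ℕ) ^ J), (q : ℝ) ^ (-(1 + 4 * κ)) * (1 / ‖q • ω‖) ≤
      ∑ i ∈ Finset.range J, C * 16 * ((2 : ℝ) ^ (-κ)) ^ i := by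
    intro J
    induction J with
    | zero => simp
    | succ J ih =>
      rw [Finset.sum_range_succ, ← Finset.sum_Ico_consecutive _ Nat.one_le_two_pow
        (Nat.pow_le_pow_right two_pos J.le_succ)]
      exact add_le_add ih (hblk J)
  obtain ⟨M, hM⟩ := F.exists_nat_subset_range
  have hsub : F ⊆ Finset.Ico 1 (2 ^ M) := fun q hq => Finset.mem_Ico.mpr
    ⟨hF q hq, (Finset.mem_range.mp (hM hq)).trans M.lt_two_pow_self⟩
  refine (Finset.sum_le_sum_of_subset_of_nonneg hsub fun _ _ _ => by positivity).trans
    ((hind M).trans ?_)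
  rw [← Finset.mul_sum]
  refine mul_le_mul_of_nonneg_left ?_ (by positivity)
  exact (Summable.sum_le_tsum _ (fun _ _ => by positivity)
    (summable_geometric_of_lt_one hρ0 hρ)).trans_eq (tsum_geometric_of_lt_one hρ0 hρ)

/-- Diophantine frequencies satisfy a power lower bound. -/
lemma exists_rpow_le_of_mem_diophSet {ε κ : ℝ} (hε : 0 < ε) (hκ : 0 < κ) :
    ∃ c > 0, ∀ ω ∈ DiophSet ε, ∀ q : ℕ, 0 < q → c * (q : ℝ) ^ (-(1 + κ)) ≤ ‖q • ω‖ := by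
  refine ⟨ε * (1 + 2 / κ)⁻¹ ^ 2, by positivity, fun ω hω q hq => ?_⟩
  have hq0 : (0 : ℝ) < q := by exact_mod_cast hq
  have hq1 : (1 : ℝ) ≤ q := by exact_mod_cast hq
  have h := hω q hq
  rw [natCast_zsmul] at h
  refine le_trans ?_ h
  have hlog := Real.log_le_rpow_div hq0.le (half_pos hκ)
  have hlog0 := Real.log_nonneg hq1
  have h1 : 1 + Real.log q ≤ (1 + 2 / κ) * (q : ℝ) ^ (κ / 2) := by
    have : (1 : ℝ) ≤ (q : ℝ) ^ (κ / 2) := Real.one_le_rpow hq1 (by positivity)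
    have e : (q : ℝ) ^ (κ / 2) / (κ / 2) = 2 / κ * (q : ℝ) ^ (κ / 2) := by field_simp
    linarith
  have h2 : (1 + Real.log q) ^ 2 ≤ (1 + 2 / κ) ^ 2 * (q : ℝ) ^ κ := by
    calc _ ≤ ((1 + 2 / κ) * (q : ℝ) ^ (κ / 2)) ^ 2 := by gcongr
      _ = _ := by
        rw [mul_pow, ← Real.rpow_natCast ((q : ℝ) ^ (κ / 2)), ← Real.rpow_mul hq0.le]
        congr 2; push_cast; ring
  calc ε * (1 + 2 / κ)⁻¹ ^ 2 * (q : ℝ) ^ (-(1 + κ))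
      = ε * (q : ℝ)⁻¹ * ((1 + 2 / κ) ^ 2 * (q : ℝ) ^ κ)⁻¹ := by
        rw [show -(1 + κ) = (-1) + (-κ) by ring, Real.rpow_add hq0, Real.rpow_neg_one,
          Real.rpow_neg hq0.le, mul_inv, inv_pow]; ring
    _ ≤ _ := by gcongr

/-- The Hermitian plane. -/
abbrev Plane : Type := EuclideanSpace ℂ (Fin 2)

/-- The area form on the plane. -/
def wedge (a b : Plane) : ℂ := a 0 * b 1 - a 1 * b 0

/-- The operator attached to a matrix. -/
abbrev matOp (M : Matrix (Fin 2) (Fin 2) ℂ) : Plane →L[ℂ] Plane :=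
  Matrix.toEuclideanCLM (𝕜 := ℂ) M

lemma matOp_apply (M : Matrix (Fin 2) (Fin 2) ℂ) (a : Plane) (i : Fin 2) :
    matOp M a i = M i 0 * a 0 + M i 1 * a 1 := by
  have : matOp M a i = (M *ᵥ (WithLp.ofLp a)) i := rfl
  rw [this, mulVec, dotProduct, Fin.sum_univ_two]

lemma matOp_mul (M N : Matrix (Fin 2) (Fin 2) ℂ) : matOp (M * N) = (matOp M).comp (matOp N) := by
  simp only [matOp, map_mul]; rfl

lemma wedge_matOp (M : Matrix (Fin 2) (Fin 2) ℂ) (a b : Plane) :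
    wedge (matOp M a) (matOp M b) = M.det * wedge a b := by
  simp only [wedge, matOp_apply, det_fin_two]
  ring

lemma norm_sq_plane (a : Plane) : ‖a‖ ^ 2 = normSq (a 0) + normSq (a 1) := by
  rw [EuclideanSpace.norm_sq_eq, Fin.sum_univ_two, normSq_eq_norm_sq, normSq_eq_norm_sq]

lemma norm_wedge_sq (a b : Plane) :
    ‖wedge a b‖ ^ 2 = ‖a‖ ^ 2 * ‖b‖ ^ 2 - ‖inner ℂ a b‖ ^ 2 := by
  rw [norm_sq_plane, norm_sq_plane, ← normSq_eq_norm_sq, ← normSq_eq_norm_sq, wedge,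
    PiLp.inner_apply, Fin.sum_univ_two]
  simp only [RCLike.inner_apply, normSq_apply, sub_re, sub_im, add_re, add_im, mul_re, mul_im,
    conj_re, conj_im]
  ring

lemma norm_wedge_le (a b : Plane) : ‖wedge a b‖ ≤ ‖a‖ * ‖b‖ := by
  refine le_of_sq_le_sq ?_ (by positivity)
  rw [mul_pow, norm_wedge_sq]
  linarith [sq_nonneg ‖inner ℂ a b‖]

lemma norm_sub_inner_smul (u w : Plane) (hu : ‖u‖ = 1) :
    ‖w - (inner ℂ u w : ℂ) • u‖ = ‖wedge u w‖ := by
  rw [← sq_eq_sq₀ (norm_nonneg _) (norm_nonneg _), norm_wedge_sq, hu, @norm_sub_sq ℂ,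
    inner_smul_right, norm_smul, hu, ← inner_conj_symm w u]
  have : (inner ℂ u w : ℂ) * (starRingEnd ℂ) (inner ℂ u w) =
      ((‖(inner ℂ u w : ℂ)‖ ^ 2 : ℝ) : ℂ) := by
    rw [mul_conj, normSq_eq_norm_sq]
  rw [this]
  simp only [RCLike.re_to_complex, ofReal_re]
  ring

lemma abs_mul_sub_mul_le {b c a p q f x y w : ℝ} (hb : 0 < b) (hc : 0 ≤ c) (ha : 0 ≤ a)
    (hp : 0 ≤ p) (hq : 0 ≤ q) (hf : 0 ≤ f) (hw : 0 ≤ w) (hpc : p ≤ c) (hfb : f ≤ b)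
    (hqa : q ≤ b * a) (hwa : w ≤ b * a) (h1 : |x - p * q| ≤ c * (2 / b) * a)
    (h2 : |y - p * f| ≤ c * (2 / b)) (h3 : |w - q| ≤ 2 / b * a) (h4 : |b - f| ≤ 2 / b) :
    |x * b - y * w| ≤ 8 * (c * a) := by
  have split : x * b - y * w = (x - p * q) * b + p * q * (b - f) - (y - p * f) * w -
      p * f * (w - q) := by ring
  have t1 : |(x - p * q) * b| ≤ 2 * (c * a) := by
    rw [abs_mul, abs_of_pos hb]
    calc _ ≤ c * (2 / b) * a * b := by gcongr
      _ = _ := by field_simp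
  have t2 : |p * q * (b - f)| ≤ 2 * (c * a) := by
    rw [abs_mul, abs_of_nonneg (by positivity)]
    calc _ ≤ c * (b * a) * (2 / b) := by gcongr
      _ = _ := by field_simp
  have t3 : |(y - p * f) * w| ≤ 2 * (c * a) := by
    rw [abs_mul, abs_of_nonneg hw]
    calc _ ≤ c * (2 / b) * (b * a) := by gcongr
      _ = _ := by field_simp
  have t4 : |p * f * (w - q)| ≤ 2 * (c * a) := by
    rw [abs_mul, abs_of_nonneg (by positivity)]
    calc _ ≤ c * b * (2 / b * a) := by gcongr
      _ = _ := by field_simp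
  rw [split]
  rw [abs_le] at t1 t2 t3 t4 ⊢
  constructor <;> linarith

section Det

variable {M : Matrix (Fin 2) (Fin 2) ℂ} (hM : M.det = 1)
include hM

/-- Unimodular matrices do not contract too much. -/
lemma norm_le_norm_matOp_mul (y : Plane) : ‖y‖ ≤ ‖matOp M‖ * ‖matOp M y‖ := by
  rcases eq_or_ne y 0 with rfl | hy
  · simp
  set w : Plane := !₂[-(starRingEnd ℂ) (y 1), (starRingEnd ℂ) (y 0)]
  have hw0 : w 0 = -(starRingEnd ℂ) (y 1) := rfl
  have hw1 : w 1 = (starRingEnd ℂ) (y 0) := rfl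
  have hwn : ‖w‖ = ‖y‖ := by
    rw [← sq_eq_sq₀ (norm_nonneg _) (norm_nonneg _), norm_sq_plane, norm_sq_plane, hw0, hw1,
      normSq_neg, normSq_conj, normSq_conj, add_comm]
  have hwedge : ‖wedge y w‖ = ‖y‖ ^ 2 := by
    have : wedge y w = ((‖y‖ ^ 2 : ℝ) : ℂ) := by
      rw [norm_sq_plane, wedge, hw0, hw1, mul_neg, mul_conj, sub_neg_eq_add, mul_conj]
      push_cast; rfl
    rw [this, norm_real, Real.norm_of_nonneg (by positivity)]
  have h1 := norm_wedge_le (matOp M y) (matOp M w)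
  rw [wedge_matOp, hM, one_mul, hwedge] at h1
  have h2 : ‖matOp M w‖ ≤ ‖matOp M‖ * ‖y‖ := hwn ▸ (matOp M).le_opNorm w
  have hy0 : 0 < ‖y‖ := norm_pos_iff.mpr hy
  have h3 : ‖y‖ * ‖y‖ ≤ (‖matOp M‖ * ‖matOp M y‖) * ‖y‖ := by
    nlinarith [norm_nonneg (matOp M y)]
  exact le_of_mul_le_mul_right h3 hy0

lemma one_le_norm_matOp : 1 ≤ ‖matOp M‖ := by
  have h := norm_le_norm_matOp_mul hM (EuclideanSpace.single 0 1)
  have h2 := (matOp M).le_opNorm (EuclideanSpace.single 0 1)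
  rw [PiLp.norm_single, norm_one] at h h2
  by_contra hlt
  nlinarith [norm_nonneg (matOp M), norm_nonneg (matOp M (EuclideanSpace.single 0 1))]

lemma norm_le_norm_comp_left (A : Plane →L[ℂ] Plane) : ‖A‖ ≤ ‖matOp M‖ * ‖(matOp M).comp A‖ := by
  refine A.opNorm_le_bound (by positivity) fun x => ?_
  have h1 := norm_le_norm_matOp_mul hM (A x)
  have h2 := ((matOp M).comp A).le_opNorm x
  calc _ ≤ _ := h1
    _ ≤ ‖matOp M‖ * (‖(matOp M).comp A‖ * ‖x‖) := by gcongr; exact h2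
    _ = _ := by ring

lemma norm_le_norm_comp_right (A : Plane →L[ℂ] Plane) :
    ‖A‖ ≤ ‖A.comp (matOp M)‖ * ‖matOp M‖ := by
  refine A.opNorm_le_bound (by positivity) fun x => ?_
  have hinv : matOp M (matOp M⁻¹ x) = x := by
    have : (matOp M).comp (matOp M⁻¹) = ContinuousLinearMap.id ℂ Plane := by
      rw [← matOp_mul, mul_nonsing_inv _ (by rw [hM]; exact isUnit_one), matOp, map_one]; rfl
    exact congrArg (fun L : Plane →L[ℂ] Plane => L x) this
  have h1 := norm_le_norm_matOp_mul hM (matOp M⁻¹ x)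
  rw [hinv] at h1
  have h2 := (A.comp (matOp M)).le_opNorm (matOp M⁻¹ x)
  rw [ContinuousLinearMap.comp_apply, hinv] at h2
  calc _ ≤ _ := h2
    _ ≤ ‖A.comp (matOp M)‖ * (‖matOp M‖ * ‖x‖) := by gcongr
    _ = _ := by ring

/-- A unimodular matrix of large norm is close to a matrix of rank one. -/
lemma exists_rankOne_approx : ∃ (u : Plane) (φ : Plane →L[ℂ] ℂ), ‖u‖ = 1 ∧
    ‖matOp M - φ.smulRight u‖ ≤ 2 / ‖matOp M‖ ∧ ‖φ‖ ≤ ‖matOp M‖ := by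
  have h1 := one_le_norm_matOp hM
  obtain ⟨v, hv1, hv⟩ := (matOp M).exists_lt_apply_of_lt_opNorm
    (show ‖matOp M‖ / 2 < ‖matOp M‖ by linarith)
  have hpos : 0 < ‖matOp M v‖ := by linarith
  set u : Plane := ((‖matOp M v‖⁻¹ : ℝ) : ℂ) • matOp M v
  have hu : ‖u‖ = 1 := by
    rw [norm_smul, norm_real, Real.norm_of_nonneg (by positivity), inv_mul_cancel₀ hpos.ne']
  refine ⟨u, (innerSL ℂ u).comp (matOp M), hu, ?_, ?_⟩
  · refine ContinuousLinearMap.opNorm_le_bound _ (by positivity) fun x => ?_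
    have e : (matOp M - ((innerSL ℂ u).comp (matOp M)).smulRight u) x =
        matOp M x - (inner ℂ u (matOp M x) : ℂ) • u := by simp
    rw [e, norm_sub_inner_smul _ _ hu]
    have e2 : wedge u (matOp M x) = ((‖matOp M v‖⁻¹ : ℝ) : ℂ) * wedge (matOp M v) (matOp M x) := by
      simp only [wedge, u, PiLp.smul_apply, smul_eq_mul]; ring
    rw [e2, wedge_matOp, hM, one_mul, norm_mul, norm_real, Real.norm_of_nonneg (by positivity)]
    have h3 := norm_wedge_le v x
    calc _ ≤ ‖matOp M v‖⁻¹ * (1 * ‖x‖) := by gcongr; exact h3.trans (by gcongr)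
      _ ≤ (‖matOp M‖ / 2)⁻¹ * (1 * ‖x‖) := by gcongr
      _ = _ := by rw [inv_div, one_mul]
  · refine (ContinuousLinearMap.opNorm_comp_le _ _).trans ?_
    rw [innerSL_apply_norm, hu, one_mul]

/-- One step of the avalanche principle. -/
lemma abs_norm_comp_mul_sub_le (C A : Plane →L[ℂ] Plane) :
    |‖C.comp ((matOp M).comp A)‖ * ‖matOp M‖ - ‖C.comp (matOp M)‖ * ‖(matOp M).comp A‖| ≤
      8 * (‖C‖ * ‖A‖) := by
  obtain ⟨u, φ, hu, hR, hφ⟩ := exists_rankOne_approx hM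
  have hB := one_le_norm_matOp hM
  set B := matOp M
  set R := B - φ.smulRight u with hRdef
  have hBdec : B = φ.smulRight u + R := by rw [hRdef]; abel
  have hCu : ‖C u‖ ≤ ‖C‖ := by simpa [hu] using C.le_opNorm u
  have hφA : ‖φ.comp A‖ ≤ ‖φ‖ * ‖A‖ := ContinuousLinearMap.opNorm_comp_le _ _
  have n1 : |‖C.comp (B.comp A)‖ - ‖C u‖ * ‖φ.comp A‖| ≤ ‖C‖ * (2 / ‖B‖) * ‖A‖ := by
    have e : C.comp (B.comp A) - (φ.comp A).smulRight (C u) = (C.comp R).comp A := by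
      ext1 x
      simp [hRdef]
    have := abs_norm_sub_norm_le (C.comp (B.comp A)) ((φ.comp A).smulRight (C u))
    rw [e, ContinuousLinearMap.norm_smulRight_apply, mul_comm ‖φ.comp A‖] at this
    refine this.trans ((ContinuousLinearMap.opNorm_comp_le _ _).trans ?_)
    gcongr
    exact (ContinuousLinearMap.opNorm_comp_le _ _).trans (by gcongr)
  have n2 : |‖C.comp B‖ - ‖C u‖ * ‖φ‖| ≤ ‖C‖ * (2 / ‖B‖) := by
    have e : C.comp B - φ.smulRight (C u) = C.comp R := by
      ext1 x
      simp [hRdef]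
    have := abs_norm_sub_norm_le (C.comp B) (φ.smulRight (C u))
    rw [e, ContinuousLinearMap.norm_smulRight_apply, mul_comm ‖φ‖] at this
    exact this.trans ((ContinuousLinearMap.opNorm_comp_le _ _).trans (by gcongr))
  have n3 : |‖B.comp A‖ - ‖φ.comp A‖| ≤ 2 / ‖B‖ * ‖A‖ := by
    have e : B.comp A - (φ.comp A).smulRight u = R.comp A := by
      ext1 x
      simp [hRdef]
    have := abs_norm_sub_norm_le (B.comp A) ((φ.comp A).smulRight u)
    rw [e, ContinuousLinearMap.norm_smulRight_apply, hu, mul_one] at this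
    exact this.trans ((ContinuousLinearMap.opNorm_comp_le _ _).trans (by gcongr))
  have n4 : |‖B‖ - ‖φ‖| ≤ 2 / ‖B‖ := by
    have := abs_norm_sub_norm_le B (φ.smulRight u)
    rw [ContinuousLinearMap.norm_smulRight_apply, hu, mul_one] at this
    exact this.trans hR
  have hBA : ‖B.comp A‖ ≤ ‖B‖ * ‖A‖ := ContinuousLinearMap.opNorm_comp_le _ _
  exact abs_mul_sub_mul_le (by linarith) (norm_nonneg _) (norm_nonneg _) (norm_nonneg _)
    (norm_nonneg _) (norm_nonneg _) (norm_nonneg _) hCu hφ (hφA.trans (by gcongr)) hBA n1 n2 n3 n4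

end Det

lemma abs_log_sub_log_le {X Y e : ℝ} (hY : 0 < Y) (he : e ≤ 1 / 4)
    (h : |X - Y| ≤ e * Y) : |Real.log X - Real.log Y| ≤ 2 * e := by
  have h' := abs_le.mp h
  have hX : 0 < X := by nlinarith
  have he0 : 0 ≤ e := by
    by_contra hneg
    nlinarith [abs_nonneg (X - Y)]
  rw [abs_le]
  constructor
  · have h1 := Real.log_le_sub_one_of_pos (div_pos hY hX)
    rw [Real.log_div hY.ne' hX.ne'] at h1
    have : Y / X - 1 ≤ 2 * e := by
      rw [div_sub_one hX.ne', div_le_iff₀ hX]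
      nlinarith
    linarith
  · have h1 := Real.log_le_sub_one_of_pos (div_pos hX hY)
    rw [Real.log_div hX.ne' hY.ne'] at h1
    have : X / Y - 1 ≤ 2 * e := by
      rw [div_sub_one hY.ne', div_le_iff₀ hY]
      nlinarith
    linarith

/-- The avalanche principle, in terms of the norms involved. -/
lemma avalanche_norms {b bb a : ℕ → ℝ} {μ : ℝ} {K : ℕ} (hμ : 64 ≤ μ) (ha : ∀ k, 0 < a k)
    (hbb0 : ∀ k, 0 < bb k) (h0 : b 0 * a 0 ≤ 2 * √μ * a 1) (hb : ∀ k < K, μ ≤ b k)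
    (hbb : ∀ k, k + 1 < K → b (k + 1) * b k ≤ √μ * bb k)
    (hstep : ∀ k, k + 1 < K → |a (k + 2) * b k - bb k * a (k + 1)| ≤ 8 * (b (k + 1) * a k)) :
    ∀ k, k + 1 < K →
      |Real.log (a (k + 2)) + Real.log (b k) - Real.log (bb k) - Real.log (a (k + 1))| ≤
        32 / μ := by
  have hμ0 : 0 < μ := by linarith
  have hs0 : 0 < √μ := Real.sqrt_pos.mpr hμ0
  have hss : √μ * √μ = μ := Real.mul_self_sqrt hμ0.le
  have hrel : ∀ k, k + 1 < K → b k * a k ≤ 2 * √μ * a (k + 1) →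
      |a (k + 2) * b k - bb k * a (k + 1)| ≤ 16 / μ * (bb k * a (k + 1)) := by
    intro k hk hI
    refine (hstep k hk).trans ?_
    have h1 := hb k (by omega)
    have h2 := hb (k + 1) hk
    have h3 := hbb k hk
    have hbk : 0 < b k := by linarith
    have hbk1 : 0 < b (k + 1) := by linarith
    have h4 : (b (k + 1) * b k) * (b k * a k) ≤ (√μ * bb k) * (2 * √μ * a (k + 1)) :=
      mul_le_mul h3 hI (mul_pos hbk (ha k)).le (mul_pos hs0 (hbb0 k)).le
    have h5 : (√μ * bb k) * (2 * √μ * a (k + 1)) = 2 * μ * (bb k * a (k + 1)) := by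
      linear_combination (2 * bb k * a (k + 1)) * hss
    have h6 : μ * μ * (b (k + 1) * a k) ≤ (b (k + 1) * b k) * (b k * a k) := by
      have : μ * μ ≤ b k * b k := mul_le_mul h1 h1 hμ0.le hbk.le
      calc _ ≤ b k * b k * (b (k + 1) * a k) :=
            mul_le_mul_of_nonneg_right this (mul_pos hbk1 (ha k)).le
        _ = _ := by ring
    have h7 : μ * (b (k + 1) * a k) ≤ 2 * (bb k * a (k + 1)) := by
      have : μ * (μ * (b (k + 1) * a k)) ≤ μ * (2 * (bb k * a (k + 1))) := by linarith
      exact le_of_mul_le_mul_left this hμ0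
    rw [div_mul_eq_mul_div, le_div_iff₀ hμ0]
    linarith
  have hsmall : 16 / μ ≤ 1 / 4 := by rw [div_le_div_iff₀ hμ0 (by norm_num)]; linarith
  have hI : ∀ k, k < K → b k * a k ≤ 2 * √μ * a (k + 1) := by
    intro k
    induction k with
    | zero => exact fun _ => h0
    | succ k ih =>
      intro hk
      have h1 := abs_le.mp (hrel k hk (ih (by omega)))
      have h3 := hbb k hk
      have hbk : 0 < b k := by have := hb k (by omega); linarith
      have hY : 0 < bb k * a (k + 1) := mul_pos (hbb0 k) (ha _)
      have h4 : 3 / 4 * (bb k * a (k + 1)) ≤ a (k + 2) * b k := by nlinarith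
      have h5 : (b (k + 1) * b k) * a (k + 1) ≤ √μ * bb k * a (k + 1) :=
        mul_le_mul_of_nonneg_right h3 (ha _).le
      have h6 : b k * (b (k + 1) * a (k + 1)) ≤ b k * (2 * √μ * a (k + 2)) := by
        have : √μ * (3 / 4 * (bb k * a (k + 1))) ≤ √μ * (a (k + 2) * b k) :=
          mul_le_mul_of_nonneg_left h4 hs0.le
        have h7 : 0 < √μ * (a (k + 2) * b k) := mul_pos hs0 (mul_pos (ha _) hbk)
        nlinarith
      exact le_of_mul_le_mul_left h6 hbk
  intro k hk
  have hbk : 0 < b k := by have := hb k (by omega); linarith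
  have h1 := abs_log_sub_log_le (mul_pos (hbb0 k) (ha (k + 1))) hsmall
    (hrel k hk (hI k (by omega)))
  rw [Real.log_mul (ha _).ne' hbk.ne', Real.log_mul (hbb0 k).ne' (ha _).ne'] at h1
  convert h1 using 1
  · congr 1; ring
  · ring

/-- A family of transfer matrices over a single orbit. -/
structure IsOrbitCocycle (M : ℕ → ℕ → Matrix (Fin 2) (Fin 2) ℂ) (B : ℝ) : Prop where
  zero : ∀ j, M j 0 = 1
  add : ∀ j a b, M j (a + b) = M (j + a) b * M j a
  det : ∀ j m, (M j m).det = 1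
  log_le : ∀ j, Real.log ‖matOp (M j 1)‖ ≤ B

namespace IsOrbitCocycle

variable {M : ℕ → ℕ → Matrix (Fin 2) (Fin 2) ℂ} {B : ℝ} (hM : IsOrbitCocycle M B)
include hM

lemma norm_pos (j m : ℕ) : 0 < ‖matOp (M j m)‖ :=
  zero_lt_one.trans_le (one_le_norm_matOp (hM.det j m))

lemma log_nonneg (j m : ℕ) : 0 ≤ Real.log ‖matOp (M j m)‖ :=
  Real.log_nonneg (one_le_norm_matOp (hM.det j m))

lemma log_add_le (j a b : ℕ) : Real.log ‖matOp (M j (a + b))‖ ≤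
    Real.log ‖matOp (M j a)‖ + Real.log ‖matOp (M (j + a) b)‖ := by
  rw [← Real.log_mul (hM.norm_pos _ _).ne' (hM.norm_pos _ _).ne']
  refine Real.log_le_log (hM.norm_pos _ _) ?_
  rw [hM.add, matOp_mul, mul_comm]
  exact ContinuousLinearMap.opNorm_comp_le _ _

lemma log_le_add_right (j a b : ℕ) : Real.log ‖matOp (M j a)‖ ≤
    Real.log ‖matOp (M j (a + b))‖ + Real.log ‖matOp (M (j + a) b)‖ := by
  rw [← Real.log_mul (hM.norm_pos _ _).ne' (hM.norm_pos _ _).ne']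
  refine Real.log_le_log (hM.norm_pos _ _) ?_
  rw [hM.add, matOp_mul, mul_comm]
  exact norm_le_norm_comp_left (hM.det _ _) _

lemma log_le_add_left (j a b : ℕ) : Real.log ‖matOp (M (j + a) b)‖ ≤
    Real.log ‖matOp (M j (a + b))‖ + Real.log ‖matOp (M j a)‖ := by
  rw [← Real.log_mul (hM.norm_pos _ _).ne' (hM.norm_pos _ _).ne']
  refine Real.log_le_log (hM.norm_pos _ _) ?_
  rw [hM.add, matOp_mul]
  exact norm_le_norm_comp_right (hM.det _ _) _

lemma log_le_mul (j m : ℕ) : Real.log ‖matOp (M j m)‖ ≤ B * m := by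
  induction m with
  | zero =>
    rw [hM.zero, matOp, map_one]
    simp
  | succ m ih =>
    have := hM.log_add_le j m 1
    have := hM.log_le (j + m)
    push_cast
    linarith

lemma abs_log_add_sub_le (j a b : ℕ) : |Real.log ‖matOp (M j (a + b))‖ -
    Real.log ‖matOp (M j a)‖| ≤ B * b := by
  have h1 := hM.log_add_le j a b
  have h2 := hM.log_le_add_right j a b
  have h3 := hM.log_le_mul (j + a) b
  rw [abs_le]; constructor <;> linarith

lemma abs_log_add_sub_le' (j a b : ℕ) : |Real.log ‖matOp (M j (a + b))‖ -
    Real.log ‖matOp (M (j + a) b)‖| ≤ B * a := by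
  have h1 := hM.log_add_le j a b
  have h2 := hM.log_le_add_left j a b
  have h3 := hM.log_le_mul j a
  rw [abs_le]; constructor <;> linarith

lemma nonneg_of_bound : 0 ≤ B := (hM.log_nonneg 0 1).trans (hM.log_le 0)

/-- Avalanche expansion along the blocks starting at `i`. -/
lemma abs_log_sub_sum_blocks_le {n N : ℕ} {μ : ℝ} (hn : 0 < n) (hnN : n ≤ N) (hN : 32 ≤ N)
    (hμ : 2 * (N : ℝ) ≤ μ) (hlow : ∀ j < N, Real.log μ ≤ Real.log ‖matOp (M j n)‖)
    (hangle : ∀ j, j + n < N → Real.log ‖matOp (M j n)‖ + Real.log ‖matOp (M (j + n) n)‖ -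
      Real.log ‖matOp (M j (2 * n))‖ ≤ Real.log μ / 2) {i : ℕ} (hi : i < n) :
    |Real.log ‖matOp (M 0 N)‖ - ∑ k ∈ Finset.range (N / n),
      (Real.log ‖matOp (M (i + k * n) (2 * n))‖ - Real.log ‖matOp (M (i + k * n) n)‖)| ≤
      16 + 4 * n * B := by
  have hN' : (32 : ℝ) ≤ N := by exact_mod_cast hN
  have hμ0 : 0 < μ := by linarith
  have hB := hM.nonneg_of_bound
  have hdiv := Nat.div_add_mod N n
  have hmod := Nat.mod_lt N hn
  have hK1 : 1 ≤ N / n := (Nat.one_le_div_iff hn).mpr hnN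
  set K := N / n with hK
  have hKn : K * n ≤ N := Nat.div_mul_le_self N n
  have hlt : ∀ k < K, i + k * n < N := by
    intro k hk
    have : (k + 1) * n ≤ K * n := Nat.mul_le_mul_right _ hk
    nlinarith
  have hnext : ∀ k, i + (k + 1) * n = i + k * n + n := fun k => by ring
  have key := avalanche_norms (b := fun k => ‖matOp (M (i + k * n) n)‖)
    (bb := fun k => ‖matOp (M (i + k * n) (2 * n))‖) (a := fun k => ‖matOp (M i (k * n))‖)
    (μ := μ) (K := K) (by linarith) (fun k => hM.norm_pos _ _) (fun k => hM.norm_pos _ _)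
    (by
      simp only [zero_mul, add_zero, one_mul]
      have h1 : ‖matOp (M i 0)‖ = 1 := by rw [hM.zero, matOp, map_one]; exact norm_one
      have h2 : 1 ≤ √μ := Real.one_le_sqrt.mpr (by linarith)
      rw [h1, mul_one]
      nlinarith [hM.norm_pos i n])
    (fun k hk => by
      have := hlow _ (hlt k hk)
      exact (Real.log_le_log_iff hμ0 (hM.norm_pos _ _)).mp this)
    (fun k hk => by
      have h1 := hangle (i + k * n) (by rw [← hnext]; exact hlt _ hk)
      simp only [hnext]
      have hp := hM.norm_pos (i + k * n) n
      have hp' := hM.norm_pos (i + k * n + n) n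
      have hq := hM.norm_pos (i + k * n) (2 * n)
      rw [← Real.log_le_log_iff (mul_pos hp' hp) (mul_pos (Real.sqrt_pos.mpr hμ0) hq),
        Real.log_mul hp'.ne' hp.ne', Real.log_mul (Real.sqrt_pos.mpr hμ0).ne' hq.ne',
        Real.log_sqrt hμ0.le]
      linarith)
    (fun k hk => by
      simp only [hnext]
      have e1 : matOp (M i ((k + 2) * n)) = (matOp (M (i + k * n + n) n)).comp
          ((matOp (M (i + k * n) n)).comp (matOp (M i (k * n)))) := by
        rw [← matOp_mul, ← matOp_mul, ← hM.add, show i + k * n + n = i + (k * n + n) by ring,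
          ← hM.add]
        congr 2; ring
      have e2 : matOp (M (i + k * n) (2 * n)) = (matOp (M (i + k * n + n) n)).comp
          (matOp (M (i + k * n) n)) := by
        rw [← matOp_mul, ← hM.add, two_mul]
      have e3 : matOp (M i ((k + 1) * n)) = (matOp (M (i + k * n) n)).comp
          (matOp (M i (k * n))) := by
        rw [← matOp_mul, ← hM.add, add_mul, one_mul]
      rw [e1, e2, e3]
      exact abs_norm_comp_mul_sub_le (hM.det _ _) _ _)
  set g : ℕ → ℝ := fun k => Real.log ‖matOp (M (i + k * n) (2 * n))‖ -
    Real.log ‖matOp (M (i + k * n) n)‖ with hg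
  have htel : |Real.log ‖matOp (M i (K * n))‖ - Real.log ‖matOp (M i n)‖ -
      ∑ k ∈ Finset.range (K - 1), g k| ≤ 16 := by
    have h1 := Finset.sum_range_sub (fun k => Real.log ‖matOp (M i ((k + 1) * n))‖) (K - 1)
    rw [Nat.sub_add_cancel hK1, zero_add, one_mul] at h1
    rw [← h1, ← Finset.sum_sub_distrib]
    refine (Finset.abs_sum_le_sum_abs _ _).trans ?_
    have h2 : ∀ k ∈ Finset.range (K - 1), |Real.log ‖matOp (M i ((k + 1 + 1) * n))‖ -
        Real.log ‖matOp (M i ((k + 1) * n))‖ - g k| ≤ 32 / μ := by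
      intro k hk
      have hk' := Finset.mem_range.mp hk
      refine le_of_eq_of_le ?_ (key k (by omega))
      congr 1
      simp only [hg]
      ring
    refine (Finset.sum_le_sum h2).trans ?_
    rw [Finset.sum_const, Finset.card_range, nsmul_eq_mul, mul_div_assoc', div_le_iff₀ hμ0]
    have : ((K - 1 : ℕ) : ℝ) ≤ N := by
      have : K - 1 ≤ N := (Nat.sub_le _ _).trans (Nat.div_le_self _ _)
      exact_mod_cast this
    linarith
  have hlast : |g (K - 1)| ≤ B * n := by
    have := hM.abs_log_add_sub_le (i + (K - 1) * n) n n
    rwa [← two_mul] at this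
  have hsumK : ∑ k ∈ Finset.range K, g k = ∑ k ∈ Finset.range (K - 1), g k + g (K - 1) := by
    rw [← Finset.sum_range_succ, Nat.sub_add_cancel hK1]
  have hfirst := hM.log_le_mul i n
  have hfirst0 := hM.log_nonneg i n
  have hshift := hM.abs_log_add_sub_le' 0 i (K * n)
  rw [zero_add] at hshift
  have hend : |Real.log ‖matOp (M 0 (i + K * n))‖ - Real.log ‖matOp (M 0 N)‖| ≤ B * n := by
    rcases le_total (i + K * n) N with h | h
    · have h1 := hM.abs_log_add_sub_le 0 (i + K * n) (N - (i + K * n))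
      rw [Nat.add_sub_cancel' h, abs_sub_comm] at h1
      refine h1.trans (mul_le_mul_of_nonneg_left ?_ hB)
      have : N - (i + K * n) ≤ n := by rw [mul_comm] at hdiv; omega
      exact_mod_cast this
    · have h1 := hM.abs_log_add_sub_le 0 N (i + K * n - N)
      rw [Nat.add_sub_cancel' h] at h1
      refine h1.trans (mul_le_mul_of_nonneg_left ?_ hB)
      have : i + K * n - N ≤ n := by omega
      exact_mod_cast this
  have hin : B * i ≤ B * n := mul_le_mul_of_nonneg_left (by exact_mod_cast hi.le) hB
  rw [hsumK]
  rw [abs_le] at *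
  constructor <;> nlinarith

/-- Averaged avalanche expansion. -/
theorem abs_log_div_sub_average_le {n N : ℕ} {μ : ℝ} (hn : 0 < n) (hnN : n ≤ N) (hN : 32 ≤ N)
    (hμ : 2 * (N : ℝ) ≤ μ) (hlow : ∀ j < N, Real.log μ ≤ Real.log ‖matOp (M j n)‖)
    (hangle : ∀ j, j + n < N → Real.log ‖matOp (M j n)‖ + Real.log ‖matOp (M (j + n) n)‖ -
      Real.log ‖matOp (M j (2 * n))‖ ≤ Real.log μ / 2) :
    |Real.log ‖matOp (M 0 N)‖ / N - (∑ j ∈ Finset.range N,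
      (Real.log ‖matOp (M j (2 * n))‖ - Real.log ‖matOp (M j n)‖) / n) / N| ≤
      (16 + 5 * n * B) / N := by
  have hn0 : (0 : ℝ) < n := by exact_mod_cast hn
  have hN0 : (0 : ℝ) < N := by exact_mod_cast hn.trans_le hnN
  have hB := hM.nonneg_of_bound
  set g : ℕ → ℝ := fun j => Real.log ‖matOp (M j (2 * n))‖ - Real.log ‖matOp (M j n)‖ with hg
  have hgb : ∀ j, |g j| ≤ B * n := by
    intro j
    have := hM.abs_log_add_sub_le j n n
    rwa [← two_mul] at this
  have hblocks : ∀ K : ℕ, ∑ j ∈ Finset.range (K * n), g j =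
      ∑ i ∈ Finset.range n, ∑ k ∈ Finset.range K, g (i + k * n) := by
    intro K
    induction K with
    | zero => simp
    | succ K ih =>
      simp only [Finset.sum_range_succ _ K, Finset.sum_add_distrib]
      rw [add_mul, one_mul, Finset.sum_range_add, ih]
      congr 1
      exact Finset.sum_congr rfl fun i _ => by rw [add_comm]
  have h1 : |n * Real.log ‖matOp (M 0 N)‖ - ∑ j ∈ Finset.range (N / n * n), g j| ≤
      n * (16 + 4 * n * B) := by
    have e1 : ∀ X : ℝ, n * X = ∑ _i ∈ Finset.range n, X := by simp
    rw [hblocks, e1, e1 (16 + _), ← Finset.sum_sub_distrib]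
    refine (Finset.abs_sum_le_sum_abs _ _).trans (Finset.sum_le_sum fun i hi => ?_)
    exact hM.abs_log_sub_sum_blocks_le hn hnN hN hμ hlow hangle (Finset.mem_range.mp hi)
  have h2 : |∑ j ∈ Finset.range N, g j - ∑ j ∈ Finset.range (N / n * n), g j| ≤ n * (B * n) := by
    have e : N = N / n * n + N % n := (Nat.div_add_mod' N n).symm
    conv_lhs => rw [e, Finset.sum_range_add]
    rw [← e, add_sub_cancel_left]
    refine (Finset.abs_sum_le_sum_abs _ _).trans ((Finset.sum_le_sum fun j _ => hgb _).trans ?_)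
    rw [Finset.sum_const, Finset.card_range, nsmul_eq_mul]
    refine mul_le_mul_of_nonneg_right ?_ (by positivity)
    exact_mod_cast (Nat.mod_lt N hn).le
  have h3 : |n * Real.log ‖matOp (M 0 N)‖ - ∑ j ∈ Finset.range N, g j| ≤
      n * (16 + 5 * n * B) := by
    rw [abs_le] at *
    constructor <;> nlinarith
  have e : Real.log ‖matOp (M 0 N)‖ / N - (∑ j ∈ Finset.range N, g j / n) / N =
      (n * Real.log ‖matOp (M 0 N)‖ - ∑ j ∈ Finset.range N, g j) / (n * N) := by
    rw [← Finset.sum_div]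
    field_simp
  rw [e, abs_div, abs_of_pos (mul_pos hn0 hN0), div_le_div_iff₀ (mul_pos hn0 hN0) hN0]
  calc _ ≤ n * (16 + 5 * n * B) * N := by gcongr
    _ = _ := by ring

end IsOrbitCocycle

lemma norm_le_of_hasSum {ι E : Type*} [NormedAddCommGroup E] {f : ι → E} {a : E} {D : ℝ}
    (h : HasSum f a) (hF : ∀ F : Finset ι, ∑ i ∈ F, ‖f i‖ ≤ D) : ‖a‖ ≤ D :=
  le_of_tendsto h.norm (Eventually.of_forall fun F => (norm_sum_le _ _).trans (hF F))

lemma integrable_of_continuous_torus2 {E : Type*} [NormedAddCommGroup E]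
    {f : Torus2 → E} (hf : Continuous f) : Integrable f :=
  hf.integrable_of_hasCompactSupport (HasCompactSupport.of_compactSpace _)

lemma continuous_integral_torus {X E : Type*} [TopologicalSpace X] [FirstCountableTopology X]
    [LocallyCompactSpace X] [NormedAddCommGroup E]
    [NormedSpace ℝ E] {f : X → Torus → E} (hf : Continuous (Function.uncurry f)) :
    Continuous fun x => ∫ t, f x t := by
  refine continuous_parametric_integral_of_continuous (μ := (volume : Measure Torus))
    (f := f) hf (s := Set.univ) isCompact_univ |>.congr fun x => ?_
  rw [Measure.restrict_univ]

/-- Bessel's inequality for continuous functions on the circle. -/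
lemma sum_sq_norm_fourierCoeff_le {f : Torus → ℂ} (hf : Continuous f) (F : Finset ℤ) :
    ∑ l ∈ F, ‖fourierCoeff f l‖ ^ 2 ≤ ∫ x, ‖f x‖ ^ 2 := by
  set g : C(Torus, ℂ) := ⟨f, hf⟩
  have h := hasSum_sq_fourierCoeff (ContinuousMap.toLp (E := ℂ) 2 AddCircle.haarAddCircle ℂ g)
  simp_rw [fourierCoeff_toLp] at h
  have h2 := sum_le_hasSum F (fun _ _ => by positivity) h
  refine h2.trans (le_of_eq ?_)
  rw [volume_torus_eq_haar]
  refine integral_congr_ae ?_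
  filter_upwards [ContinuousMap.coeFn_toLp (p := 2) (𝕜 := ℂ) AddCircle.haarAddCircle g] with x hx
  rw [hx]; rfl

/-- The `m`-th Fourier coefficient in the first variable. -/
def partialCoeff (W : Torus2 → ℂ) (m : ℤ) (y : Torus) : ℂ := ∫ x, fourier (-m) x * W (x, y)

lemma continuous_partialCoeff {W : Torus2 → ℂ} (hW : Continuous W) (m : ℤ) :
    Continuous (partialCoeff W m) :=
  continuous_integral_torus (f := fun y x => fourier (-m) x * W (x, y)) (by fun_prop)

lemma fourierCoeff_partialCoeff {W : Torus2 → ℂ} (hW : Continuous W) (m l : ℤ) :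
    fourierCoeff (partialCoeff W m) l =
      ∫ x, fourier (-m) x * fourierCoeff (fun y => W (x, y)) l := by
  simp only [fourierCoeff_eq_integral_torus, partialCoeff, ← integral_const_mul]
  rw [integral_integral_swap (integrable_of_continuous_torus2 (by
    simp only [Function.uncurry_def]; fun_prop))]
  refine integral_congr_ae (Eventually.of_forall fun x => ?_)
  refine integral_congr_ae (Eventually.of_forall fun y => ?_)
  dsimp only
  ring

/-- Poisson averaging at height `η` in the second variable. -/
def smoothSnd (η : ℝ) (w : Torus2 → ℝ) (p : Torus2) : ℝ := heightAvg η (fun y => w (p.1, y)) p.2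

/-- Poisson averaging at height `η` in the first variable. -/
def smoothFst (η : ℝ) (w : Torus2 → ℝ) (p : Torus2) : ℝ := heightAvg η (fun x => w (x, p.2)) p.1

lemma continuous_smoothSnd {η : ℝ} (hη : 0 < η) {w : Torus2 → ℝ} (hw : Continuous w) :
    Continuous (smoothSnd η w) := by
  have := continuous_circlePoisson (Real.exp_pos _).le (exp_neg_lt_one hη)
  exact continuous_integral_torus (f := fun (p : Torus2) t =>
    circlePoisson (Real.exp (-(2 * Real.pi * η))) (p.2 - t) * w (p.1, t)) (by fun_prop)

lemma continuous_smoothFst {η : ℝ} (hη : 0 < η) {w : Torus2 → ℝ} (hw : Continuous w) :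
    Continuous (smoothFst η w) := by
  have := continuous_circlePoisson (Real.exp_pos _).le (exp_neg_lt_one hη)
  exact continuous_integral_torus (f := fun (p : Torus2) t =>
    circlePoisson (Real.exp (-(2 * Real.pi * η))) (p.1 - t) * w (t, p.2)) (by fun_prop)

lemma fourierCoeff_partialCoeff_smoothSnd {η : ℝ} (hη : 0 < η) {w : Torus2 → ℝ}
    (hw : Continuous w) (m l : ℤ) :
    fourierCoeff (partialCoeff (fun p => (smoothSnd η w p : ℂ)) m) l =
      (Real.exp (-(2 * Real.pi * η)) ^ l.natAbs : ℝ) *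
        fourierCoeff (partialCoeff (fun p => (w p : ℂ)) m) l := by
  have hc := continuous_smoothSnd hη hw
  rw [fourierCoeff_partialCoeff (by fun_prop), fourierCoeff_partialCoeff (by fun_prop),
    ← integral_const_mul]
  refine integral_congr_ae (Eventually.of_forall fun x => ?_)
  have h := fourierCoeff_poissonAvg (Real.exp_pos _).le (exp_neg_lt_one hη)
    (u := fun y => w (x, y)) (by fun_prop) l
  simp only [smoothSnd, heightAvg, h]
  ring

lemma norm_partialCoeff_le {W : Torus2 → ℂ} {b : Torus2 → ℝ} (hb : Continuous b)
    (h : ∀ p, ‖W p‖ ≤ b p) (m : ℤ) (y : Torus) : ‖partialCoeff W m y‖ ≤ ∫ x, b (x, y) := by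
  refine (norm_integral_le_of_norm_le (g := fun x => b (x, y))
    (integrable_of_continuous_torus (by fun_prop)) (Eventually.of_forall fun x => ?_))
  rw [norm_mul, norm_fourier_apply, one_mul]
  exact h _

lemma smoothSnd_mem_Icc {η B : ℝ} (hη : 0 < η) {w : Torus2 → ℝ} (hw : Continuous w)
    (hw0 : ∀ p, 0 ≤ w p) (hwB : ∀ p, w p ≤ B) (p : Torus2) :
    0 ≤ smoothSnd η w p ∧ smoothSnd η w p ≤ B :=
  ⟨le_heightAvg hη (by fun_prop) (fun _ => hw0 _) _, heightAvg_le hη (by fun_prop)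
    (fun _ => hwB _) _⟩

/-- A continuous function on the torus with values in `[0, B]` whose Poisson averages at small
height in the second variable are close to it. -/
structure IsSmoothableSnd (w : Torus2 → ℝ) (B K : ℝ) : Prop where
  continuous : Continuous w
  nonneg : ∀ p, 0 ≤ w p
  le : ∀ p, w p ≤ B
  integral_abs_le : ∀ η : ℝ, 0 < η → ∀ x, ∫ y, |smoothSnd (2 * η) w (x, y) - w (x, y)| ≤ K * η

namespace IsSmoothableSnd

variable {w : Torus2 → ℝ} {B K : ℝ}

lemma integral_abs_prod_le (hw : IsSmoothableSnd w B K) {η : ℝ} (hη : 0 < η) :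
    ∫ p, |smoothSnd (2 * η) w p - w p| ≤ K * η := by
  have hc := continuous_smoothSnd (η := 2 * η) (by positivity) hw.continuous
  have hwc := hw.continuous
  rw [Measure.volume_eq_prod, integral_prod _ (integrable_of_continuous_torus2 (by fun_prop))]
  calc _ ≤ ∫ _x : Torus, K * η := by
        refine integral_mono (integrable_of_continuous_torus (continuous_integral_torus
          (by simp only [Function.uncurry_def]; fun_prop))) (integrable_const _) fun x => ?_
        exact hw.integral_abs_le η hη x
    _ = K * η := by simp

lemma energy_le (hw : IsSmoothableSnd w B K) {η : ℝ} (hη : 0 < η) (m : ℤ) (F : Finset ℤ) :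
    ∑ l ∈ F, ((1 - Real.exp (-(2 * Real.pi * (2 * η))) ^ l.natAbs) *
      ‖fourierCoeff (partialCoeff (fun p => (w p : ℂ)) m) l‖) ^ 2 ≤ B * (K * η) := by
  have h2η : 0 < 2 * η := by positivity
  have hc := continuous_smoothSnd h2η hw.continuous
  have hwc := hw.continuous
  set D : Torus → ℂ := fun y => partialCoeff (fun p => (w p : ℂ)) m y -
    partialCoeff (fun p => (smoothSnd (2 * η) w p : ℂ)) m y with hD
  have hDc : Continuous D :=
    (continuous_partialCoeff (by fun_prop) m).sub (continuous_partialCoeff (by fun_prop) m)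
  have hDW : ∀ y, D y = partialCoeff (fun p => ((w p - smoothSnd (2 * η) w p : ℝ) : ℂ)) m y := by
    intro y
    simp only [hD, partialCoeff, ofReal_sub, mul_sub]
    exact (integral_sub (integrable_of_continuous_torus (by fun_prop))
      (integrable_of_continuous_torus (by fun_prop))).symm
  have hcoef : ∀ l, fourierCoeff D l =
      ((1 - Real.exp (-(2 * Real.pi * (2 * η))) ^ l.natAbs : ℝ) : ℂ) *
      fourierCoeff (partialCoeff (fun p => (w p : ℂ)) m) l := by
    intro l
    have h1 : fourierCoeff D l = fourierCoeff (partialCoeff (fun p => (w p : ℂ)) m) l -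
        fourierCoeff (partialCoeff (fun p => (smoothSnd (2 * η) w p : ℂ)) m) l := by
      simp only [fourierCoeff_eq_integral_torus, hD, mul_sub]
      have a1 := continuous_partialCoeff (W := fun p => (w p : ℂ)) (by fun_prop) m
      have a2 := continuous_partialCoeff (W := fun p => (smoothSnd (2 * η) w p : ℂ)) (by fun_prop) m
      exact integral_sub (integrable_of_continuous_torus (by fun_prop))
        (integrable_of_continuous_torus (by fun_prop))
    rw [h1, fourierCoeff_partialCoeff_smoothSnd h2η hw.continuous]
    push_cast
    ring
  have hd : ∀ p, |w p - smoothSnd (2 * η) w p| ≤ B := by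
    intro p
    have h1 := smoothSnd_mem_Icc h2η hw.continuous hw.nonneg hw.le p
    have h2 := hw.nonneg p
    have h3 := hw.le p
    rw [abs_le]; constructor <;> linarith
  have hDle : ∀ y, ‖D y‖ ≤ ∫ x, |w (x, y) - smoothSnd (2 * η) w (x, y)| := by
    intro y
    rw [hDW]
    exact norm_partialCoeff_le (b := fun p => |w p - smoothSnd (2 * η) w p|) (by fun_prop)
      (fun p => by rw [norm_real, Real.norm_eq_abs]) m y
  have hDB : ∀ y, ‖D y‖ ≤ B := by
    intro y
    refine (hDle y).trans ?_
    calc _ ≤ ∫ _x : Torus, B := integral_mono (integrable_of_continuous_torus (by fun_prop))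
          (integrable_const _) fun x => hd _
      _ = B := by simp
  have hI : Continuous fun y => ∫ x, |w (x, y) - smoothSnd (2 * η) w (x, y)| :=
    continuous_integral_torus (f := fun y x => |w (x, y) - smoothSnd (2 * η) w (x, y)|)
      (by fun_prop)
  calc _ = ∑ l ∈ F, ‖fourierCoeff D l‖ ^ 2 := by
        refine Finset.sum_congr rfl fun l _ => ?_
        rw [hcoef, norm_mul, norm_real, mul_pow, mul_pow, Real.norm_eq_abs, sq_abs]
    _ ≤ ∫ y, ‖D y‖ ^ 2 := sum_sq_norm_fourierCoeff_le hDc F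
    _ ≤ ∫ y, B * ∫ x, |w (x, y) - smoothSnd (2 * η) w (x, y)| := by
        refine integral_mono (integrable_of_continuous_torus (by fun_prop))
          (integrable_of_continuous_torus (by fun_prop)) fun y => ?_
        dsimp only
        rw [sq]
        exact mul_le_mul (hDB y) (hDle y) (norm_nonneg _) ((norm_nonneg _).trans (hDB y))
    _ = B * ∫ p, |smoothSnd (2 * η) w p - w p| := by
        rw [integral_const_mul, Measure.volume_eq_prod,
          integral_prod_symm _ (integrable_of_continuous_torus2 (by fun_prop))]
        simp only [abs_sub_comm]
    _ ≤ B * (K * η) := by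
        have hB : 0 ≤ B := (hw.nonneg 0).trans (hw.le 0)
        exact mul_le_mul_of_nonneg_left (hw.integral_abs_prod_le hη) hB

end IsSmoothableSnd

lemma exp_neg_four_pi_le : Real.exp (-(4 * Real.pi)) ≤ 1 / 4 := by
  have h1 : Real.exp (-(4 * Real.pi)) ≤ Real.exp (-2) := by
    apply Real.exp_le_exp.mpr; have := Real.pi_gt_three; linarith
  have h2 : (4 : ℝ) ≤ Real.exp 2 := by
    have h := Real.add_one_le_exp (1 : ℝ)
    have e : Real.exp 2 = Real.exp 1 * Real.exp 1 := by rw [← Real.exp_add]; norm_num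
    nlinarith
  refine h1.trans ?_
  rw [Real.exp_neg, ← one_div]
  exact one_div_le_one_div_of_le (by norm_num) h2

/-- A dyadic sum dominating the truncated weight `min |l| 2 ^ J`. -/
lemma min_div_four_le_sum (l : ℕ) (J : ℕ) :
    min (l : ℝ) (2 ^ J) / 4 ≤ ∑ k ∈ Finset.range (J + 1), 2 ^ k *
      (1 - Real.exp (-(2 * Real.pi * (2 * (2 ^ k)⁻¹))) ^ l) ^ 2 := by
  rcases Nat.eq_zero_or_pos l with rfl | hl
  · rw [Nat.cast_zero, min_eq_left (by positivity), zero_div]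
    positivity
  set k := min J (Nat.log 2 l) with hk
  have hkJ : k ≤ J := min_le_left _ _
  have hkl : 2 ^ k ≤ l := (Nat.pow_le_pow_right two_pos (min_le_right _ _)).trans
    (Nat.pow_log_le_self 2 hl.ne')
  have hlow : min (l : ℝ) (2 ^ J) ≤ 2 * 2 ^ k := by
    rcases le_total J (Nat.log 2 l) with h | h
    · rw [hk, min_eq_left h]
      refine (min_le_right _ _).trans ?_
      have : (0 : ℝ) < 2 ^ J := by positivity
      linarith
    · rw [hk, min_eq_right h]
      refine (min_le_left _ _).trans ?_
      have : (l : ℝ) < 2 ^ (Nat.log 2 l + 1) := by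
        exact_mod_cast Nat.lt_pow_succ_log_self one_lt_two l
      rw [pow_succ'] at this
      exact this.le
  refine le_trans ?_ (Finset.single_le_sum (f := fun k : ℕ => (2 : ℝ) ^ k *
      (1 - Real.exp (-(2 * Real.pi * (2 * (2 ^ k)⁻¹))) ^ l) ^ 2) (fun i _ => by positivity)
      (Finset.mem_range.mpr (Nat.lt_succ_of_le hkJ)))
  have hexp : Real.exp (-(2 * Real.pi * (2 * (2 ^ k)⁻¹))) ^ l ≤ 1 / 4 := by
    rw [← Real.exp_nat_mul]
    refine le_trans (Real.exp_le_exp.mpr ?_) exp_neg_four_pi_le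
    have h1 : (2 : ℝ) ^ k ≤ l := by exact_mod_cast hkl
    have h2 : 1 ≤ (l : ℝ) * (2 ^ k)⁻¹ := by
      rw [← div_eq_mul_inv]; exact (one_le_div (by positivity)).mpr h1
    have := Real.pi_pos
    nlinarith
  have h2 : (1 / 2 : ℝ) ≤ (1 - Real.exp (-(2 * Real.pi * (2 * (2 ^ k)⁻¹))) ^ l) ^ 2 := by
    nlinarith
  have h3 : (0 : ℝ) < 2 ^ k := by positivity
  nlinarith

lemma exp_pow_sq_le {κ : ℝ} (hκ : 0 < κ) (hκ1 : κ ≤ 1) {l : ℕ} (hl : 0 < l) (J : ℕ) :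
    (Real.exp (-(2 * Real.pi * (2 * (2 ^ J)⁻¹))) ^ l) ^ 2 ≤
      ((2 : ℝ) ^ J) ^ κ * (l : ℝ) ^ (-(1 + κ)) * min (l : ℝ) (2 ^ J) := by
  have hl0 : (0 : ℝ) < l := by exact_mod_cast hl
  have hJ : (0 : ℝ) < 2 ^ J := by positivity
  set X : ℝ := 2 ^ J with hX
  have e1 : (Real.exp (-(2 * Real.pi * (2 * X⁻¹))) ^ l) ^ 2 =
      Real.exp (-(8 * Real.pi * (l / X))) := by
    rw [← pow_mul, ← Real.exp_nat_mul]
    congr 1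
    push_cast
    field_simp
    ring
  have e2 : X ^ κ * (l : ℝ) ^ (-(1 + κ)) = (l / X) ^ (-κ) * (l : ℝ)⁻¹ := by
    rw [Real.div_rpow hl0.le hJ.le, neg_add, Real.rpow_add hl0, Real.rpow_neg_one,
      Real.rpow_neg hJ.le κ]
    field_simp
  rw [e1, e2]
  set v := (l : ℝ) / X with hv
  have hv0 : 0 < v := by positivity
  have hpi := Real.pi_gt_three
  rcases le_total (l : ℝ) X with h | h
  · have hv1 : v ≤ 1 := (div_le_one hJ).mpr h
    rw [min_eq_left h, inv_mul_cancel_right₀ hl0.ne']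
    have h1 : Real.exp (-(8 * Real.pi * v)) ≤ 1 := Real.exp_le_one_iff.mpr (by
      have : 0 < Real.pi * v := by positivity
      linarith)
    exact h1.trans (Real.one_le_rpow_of_pos_of_le_one_of_nonpos hv0 hv1 (by linarith))
  · have hv1 : 1 ≤ v := (one_le_div hJ).mpr h
    rw [min_eq_right h]
    have e3 : v ^ (-κ) * (l : ℝ)⁻¹ * X = v ^ (-κ) * v⁻¹ := by rw [hv]; field_simp
    rw [e3]
    have h1 : v⁻¹ ≤ v ^ (-κ) := by
      rw [← Real.rpow_neg_one]
      exact Real.rpow_le_rpow_of_exponent_le hv1 (by linarith)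
    have h2 : Real.exp (-(8 * Real.pi * v)) ≤ v⁻¹ * v⁻¹ := by
      have h3 : v ≤ Real.exp v := by have := Real.add_one_le_exp v; linarith
      have h4 : Real.exp (-v) ≤ v⁻¹ := by
        rw [Real.exp_neg]; exact inv_anti₀ hv0 h3
      calc _ ≤ Real.exp (-v + -v) := Real.exp_le_exp.mpr (by nlinarith)
        _ = Real.exp (-v) * Real.exp (-v) := Real.exp_add _ _
        _ ≤ _ := by gcongr
    refine h2.trans ?_
    gcongr

namespace IsSmoothableSnd

variable {w : Torus2 → ℝ} {B K : ℝ}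

lemma sum_min_mul_sq_le (hw : IsSmoothableSnd w B K) (m : ℤ) (J : ℕ) (F : Finset ℤ) :
    ∑ l ∈ F, min (l.natAbs : ℝ) (2 ^ J) / 4 *
      ‖fourierCoeff (partialCoeff (fun p => (w p : ℂ)) m) l‖ ^ 2 ≤ B * K * (J + 1) := by
  set c := fun l => ‖fourierCoeff (partialCoeff (fun p => (w p : ℂ)) m) l‖ with hc
  calc ∑ l ∈ F, min (l.natAbs : ℝ) (2 ^ J) / 4 * c l ^ 2
      ≤ ∑ l ∈ F, ∑ k ∈ Finset.range (J + 1), 2 ^ k *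
          ((1 - Real.exp (-(2 * Real.pi * (2 * (2 ^ k)⁻¹))) ^ l.natAbs) * c l) ^ 2 := by
        refine Finset.sum_le_sum fun l _ => ?_
        refine (mul_le_mul_of_nonneg_right (min_div_four_le_sum l.natAbs J)
          (sq_nonneg (c l))).trans (le_of_eq ?_)
        rw [Finset.sum_mul]
        exact Finset.sum_congr rfl fun k _ => by ring
    _ = ∑ k ∈ Finset.range (J + 1), 2 ^ k * ∑ l ∈ F,
          ((1 - Real.exp (-(2 * Real.pi * (2 * (2 ^ k)⁻¹))) ^ l.natAbs) * c l) ^ 2 := by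
        rw [Finset.sum_comm]
        simp only [Finset.mul_sum]
    _ ≤ ∑ _k ∈ Finset.range (J + 1), B * K := by
        refine Finset.sum_le_sum fun k _ => ?_
        have h := hw.energy_le (η := (2 ^ k)⁻¹) (by positivity) m F
        calc _ ≤ (2 : ℝ) ^ k * (B * (K * (2 ^ k)⁻¹)) :=
              mul_le_mul_of_nonneg_left h (by positivity)
          _ = B * K := by field_simp
    _ = _ := by simp; ring

lemma sum_mul_le (hw : IsSmoothableSnd w B K) (m : ℤ) (J : ℕ) {κ : ℝ} (hκ : 0 < κ) (hκ1 : κ ≤ 1)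
    {F : Finset ℤ} (hF : ∀ l ∈ F, l ≠ 0) {b : ℤ → ℝ} {S : ℝ}
    (hS : ∑ l ∈ F, b l ^ 2 * (l.natAbs : ℝ) ^ (-(1 + κ)) ≤ S) :
    ∑ l ∈ F, Real.exp (-(2 * Real.pi * (2 * (2 ^ J)⁻¹))) ^ l.natAbs *
      ‖fourierCoeff (partialCoeff (fun p => (w p : ℂ)) m) l‖ * b l ≤
      √(4 * ((2 : ℝ) ^ J) ^ κ * S * (B * K * (J + 1))) := by
  apply Real.le_sqrt_of_sq_le
  set c := fun l => ‖fourierCoeff (partialCoeff (fun p => (w p : ℂ)) m) l‖ with hc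
  have h1 := Finset.sum_sq_le_sum_mul_sum_of_sq_le_mul F
    (r := fun l => Real.exp (-(2 * Real.pi * (2 * (2 ^ J)⁻¹))) ^ l.natAbs * c l * b l)
    (f := fun l => 4 * ((2 : ℝ) ^ J) ^ κ * (b l ^ 2 * (l.natAbs : ℝ) ^ (-(1 + κ))))
    (g := fun l => min (l.natAbs : ℝ) (2 ^ J) / 4 * c l ^ 2)
    (fun l _ => by positivity) (fun l _ => by positivity) (fun l hl => by
      have h := exp_pow_sq_le hκ hκ1 (Int.natAbs_pos.mpr (hF l hl)) J
      calc _ = (Real.exp (-(2 * Real.pi * (2 * (2 ^ J)⁻¹))) ^ l.natAbs) ^ 2 *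
            (c l ^ 2 * b l ^ 2) := by ring
        _ ≤ _ * (c l ^ 2 * b l ^ 2) := mul_le_mul_of_nonneg_right h (by positivity)
        _ = _ := by ring)
  refine h1.trans ?_
  rw [← Finset.mul_sum]
  have hS0 : 0 ≤ ∑ l ∈ F, b l ^ 2 * (l.natAbs : ℝ) ^ (-(1 + κ)) :=
    Finset.sum_nonneg fun l _ => by positivity
  refine mul_le_mul (mul_le_mul_of_nonneg_left hS (by positivity)) (hw.sum_min_mul_sq_le m J F)
    (Finset.sum_nonneg fun l _ => by positivity) ?_
  have := hS0.trans hS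
  positivity

end IsSmoothableSnd

lemma norm_sub_le_of_hasSum {ι E : Type*} [NormedAddCommGroup E] [DecidableEq ι] {f : ι → E}
    {a : E} {D : ℝ} (h : HasSum f a) (i₀ : ι)
    (hF : ∀ F : Finset ι, i₀ ∉ F → ∑ i ∈ F, ‖f i‖ ≤ D) : ‖a - f i₀‖ ≤ D := by
  refine norm_le_of_hasSum (hasSum_ite_sub_hasSum h i₀) fun F => ?_
  refine le_trans (le_of_eq ?_) (hF (F.erase i₀) (Finset.notMem_erase _ _))
  rw [← Finset.sum_erase F (a := i₀) (by simp)]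
  exact Finset.sum_congr rfl fun i hi => by rw [if_neg (Finset.ne_of_mem_erase hi)]

lemma skewShift_iterate (ω : Torus) (j : ℕ) (p : Torus2) :
    (skewShift ω)^[j] p = (p.1 + j • p.2 + (j * (j - 1) / 2 : ℤ) • ω, p.2 + j • ω) := by
  induction j with
  | zero => simp
  | succ j ih =>
    rw [Function.iterate_succ_apply', ih]
    have e : (((j + 1 : ℕ) : ℤ) * ((j + 1 : ℕ) - 1) / 2 : ℤ) = (j * (j - 1) / 2 : ℤ) + j := by
      have e : ∀ n : ℤ, 2 * (n * (n - 1) / 2) = n * (n - 1) := fun n =>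
        Int.mul_ediv_cancel' (Int.even_mul_pred_self n).two_dvd
      have e1 := e j
      have e2 := e ((j + 1 : ℕ) : ℤ)
      push_cast at *
      nlinarith
    rw [e]
    simp only [skewShift, add_smul, natCast_zsmul, one_smul, Prod.mk.injEq]
    constructor <;> abel

lemma fourier_iterate (ω : Torus) (m l : ℤ) (j : ℕ) (p : Torus2) :
    (fourier m ((skewShift ω)^[j] p).1 : ℂ) * fourier l ((skewShift ω)^[j] p).2 =
      (AddCircle.toCircle (orbitPhase ω m l p.1 p.2 j) : ℂ) := by
  rw [skewShift_iterate, fourier_apply, fourier_apply, ← Circle.coe_mul, ← AddCircle.toCircle_add]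
  rfl

lemma exists_norm_sum_orbitPhase_le {c κ : ℝ} (hc : 0 < c) (hκ : 0 < κ) (hκ1 : 3 * κ ≤ 1) :
    ∃ C > 0, ∀ ω : Torus, (∀ q : ℕ, 0 < q → c * (q : ℝ) ^ (-(1 + κ)) ≤ ‖q • ω‖) →
      ∀ (m : ℤ), m ≠ 0 → ∀ (l : ℤ) (x y : Torus) (N : ℕ), 1 ≤ N →
      ‖∑ j ∈ Finset.range N, (AddCircle.toCircle (orbitPhase ω m l x y j) : ℂ)‖ ≤
        C * m.natAbs * (N : ℝ) ^ ((1 + 3 * κ) / 2) := by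
  obtain ⟨C, hC, h⟩ := exists_sum_one_div_norm_le hc hκ (by linarith)
  refine ⟨√(2 + C), by positivity, fun ω hω m hm l x y N hN => ?_⟩
  have hm1 : 1 ≤ m.natAbs := Int.natAbs_pos.mpr hm
  have hm1' : (1 : ℝ) ≤ m.natAbs := by exact_mod_cast hm1
  have hN1 : (1 : ℝ) ≤ N := by exact_mod_cast hN
  have h1 := norm_sum_orbitPhase_sq_le ω hm l x y N fun q hq =>
    lt_of_lt_of_le (by have : (0 : ℝ) < q := by exact_mod_cast hq
                       positivity) (hω q hq)
  have h2 := h ω hω (m.natAbs * N) (Nat.mul_pos hm1 hN)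
  refine (sq_le_sq₀ (norm_nonneg _) (by positivity)).mp ?_
  rw [mul_pow, mul_pow, Real.sq_sqrt (by positivity), ← Real.rpow_mul_natCast (by positivity)]
  push_cast at h2
  rw [Real.mul_rpow (by positivity) (by positivity)] at h2
  have h3 : (m.natAbs : ℝ) ^ (1 + 3 * κ) ≤ (m.natAbs : ℝ) ^ 2 := by
    rw [← Real.rpow_two]
    exact Real.rpow_le_rpow_of_exponent_le hm1' (by linarith)
  have h4 : (N : ℝ) ≤ (N : ℝ) ^ (1 + 3 * κ) := by
    nth_rewrite 1 [← Real.rpow_one (N : ℝ)]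
    exact Real.rpow_le_rpow_of_exponent_le hN1 (by linarith)
  have e : (1 + 3 * κ) / 2 * ((2 : ℕ) : ℝ) = 1 + 3 * κ := by push_cast; ring
  rw [e]
  have h5 : C * ((m.natAbs : ℝ) ^ (1 + 3 * κ) * (N : ℝ) ^ (1 + 3 * κ)) ≤
      C * ((m.natAbs : ℝ) ^ 2 * (N : ℝ) ^ (1 + 3 * κ)) := by gcongr
  have h6 : (N : ℝ) ≤ (m.natAbs : ℝ) ^ 2 * (N : ℝ) ^ (1 + 3 * κ) := by
    have : (1 : ℝ) ≤ (m.natAbs : ℝ) ^ 2 := one_le_pow₀ hm1'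
    have h7 : (0 : ℝ) ≤ (N : ℝ) ^ (1 + 3 * κ) := by positivity
    nlinarith
  linarith

lemma sum_le_add_sum_erase {f : ℤ → ℝ} (hf : 0 ≤ f 0) (F : Finset ℤ) :
    ∑ l ∈ F, f l ≤ f 0 + ∑ l ∈ F.erase 0, f l := by
  by_cases h : (0 : ℤ) ∈ F
  · rw [Finset.add_sum_erase _ _ h]
  · rw [Finset.erase_eq_of_notMem h]; linarith

lemma sum_natAbs_mul_exp_le {s : ℝ} (hs : 0 < s) (hs1 : s ≤ 1) (F : Finset ℤ) :
    ∑ m ∈ F, (m.natAbs : ℝ) * Real.exp (-(2 * Real.pi * s)) ^ m.natAbs ≤ 8 / s ^ 2 := by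
  set r := Real.exp (-(2 * Real.pi * s)) with hr
  have hr0 : 0 ≤ r := (Real.exp_pos _).le
  have hr1 : r < 1 := exp_neg_lt_one hs
  have h1 : HasSum (fun n : ℕ => (n : ℝ) * r ^ n) (r / (1 - r) ^ 2) :=
    hasSum_coe_mul_geometric_of_norm_lt_one (by rwa [Real.norm_of_nonneg hr0])
  have h2 := HasSum.of_nat_of_neg (f := fun m : ℤ => (m.natAbs : ℝ) * r ^ m.natAbs)
    (by simpa using h1) (by simpa using h1)
  have h3 := sum_le_hasSum F (fun _ _ => by positivity) h2
  refine h3.trans ?_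
  have h4 := one_sub_exp_ge hs1 hs
  rw [← hr] at h4
  have h5 : r / (1 - r) ^ 2 ≤ 1 / (s / 2) ^ 2 := by gcongr
  have e : 1 / (s / 2) ^ 2 = 4 / s ^ 2 := by field_simp; norm_num
  rw [e] at h5
  simp only [Int.natAbs_zero, Nat.cast_zero, zero_mul, sub_zero]
  calc _ ≤ 4 / s ^ 2 + 4 / s ^ 2 := add_le_add h5 h5
    _ = 8 / s ^ 2 := by ring

namespace IsSmoothableSnd

variable {w : Torus2 → ℝ} {B K : ℝ}

lemma norm_fourierCoeff_partialCoeff_le (hw : IsSmoothableSnd w B K) (m l : ℤ) :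
    ‖fourierCoeff (partialCoeff (fun p => (w p : ℂ)) m) l‖ ≤ B := by
  refine norm_fourierCoeff_le_of_bound (fun y => ?_) l
  refine (norm_partialCoeff_le (b := fun _ => B) continuous_const (fun p => ?_) m y).trans (by simp)
  rw [norm_real, Real.norm_of_nonneg (hw.nonneg p)]
  exact hw.le p

lemma hasSum_partialCoeff_smoothSnd (hw : IsSmoothableSnd w B K) {η : ℝ} (hη : 0 < η) (m : ℤ)
    (y : Torus) : HasSum (fun l : ℤ => (Real.exp (-(2 * Real.pi * η)) ^ l.natAbs : ℝ) *
        fourierCoeff (partialCoeff (fun p => (w p : ℂ)) m) l * fourier l y)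
      (partialCoeff (fun p => (smoothSnd η w p : ℂ)) m y) := by
  have hc := continuous_smoothSnd hη hw.continuous
  have hB : 0 ≤ B := (hw.nonneg 0).trans (hw.le 0)
  set f : C(Torus, ℂ) := ⟨partialCoeff (fun p => (smoothSnd η w p : ℂ)) m,
    continuous_partialCoeff (by fun_prop) m⟩
  have hf : ∀ l, fourierCoeff f l = (Real.exp (-(2 * Real.pi * η)) ^ l.natAbs : ℝ) *
        fourierCoeff (partialCoeff (fun p => (w p : ℂ)) m) l :=
    fun l => fourierCoeff_partialCoeff_smoothSnd hη hw.continuous m l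
  have hs : Summable (fourierCoeff f) := by
    refine Summable.of_norm_bounded
      (g := fun l : ℤ => Real.exp (-(2 * Real.pi * η)) ^ l.natAbs * B)
      ((summable_pow_natAbs (Real.exp_pos _).le (exp_neg_lt_one hη)).mul_right B) fun l => ?_
    rw [hf, norm_mul, norm_real, Real.norm_of_nonneg (by positivity)]
    exact mul_le_mul_of_nonneg_left (hw.norm_fourierCoeff_partialCoeff_le m l) (by positivity)
  have := has_pointwise_sum_fourier_series_of_summable hs y
  simp only [hf, smul_eq_mul] at this
  exact this

lemma hasSum_orbit_partialCoeff (hw : IsSmoothableSnd w B K) {η : ℝ} (hη : 0 < η) (m : ℤ)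
    (ω : Torus) (p : Torus2) (N : ℕ) :
    HasSum (fun l : ℤ => (Real.exp (-(2 * Real.pi * η)) ^ l.natAbs : ℝ) *
        fourierCoeff (partialCoeff (fun p => (w p : ℂ)) m) l *
        ∑ j ∈ Finset.range N, (AddCircle.toCircle (orbitPhase ω m l p.1 p.2 j) : ℂ))
      (∑ j ∈ Finset.range N, fourier m ((skewShift ω)^[j] p).1 *
        partialCoeff (fun p => (smoothSnd η w p : ℂ)) m ((skewShift ω)^[j] p).2) := by
  have h := hasSum_sum (s := Finset.range N) fun j _ =>
    (hw.hasSum_partialCoeff_smoothSnd hη m ((skewShift ω)^[j] p).2).mul_left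
      (fourier m ((skewShift ω)^[j] p).1 : ℂ)
  have e : ∀ l : ℤ, ∑ j ∈ Finset.range N, (fourier m ((skewShift ω)^[j] p).1 : ℂ) *
      ((Real.exp (-(2 * Real.pi * η)) ^ l.natAbs : ℝ) *
        fourierCoeff (partialCoeff (fun p => (w p : ℂ)) m) l * fourier l ((skewShift ω)^[j] p).2) =
      (Real.exp (-(2 * Real.pi * η)) ^ l.natAbs : ℝ) *
        fourierCoeff (partialCoeff (fun p => (w p : ℂ)) m) l *
        ∑ j ∈ Finset.range N, (AddCircle.toCircle (orbitPhase ω m l p.1 p.2 j) : ℂ) := by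
    intro l
    rw [Finset.mul_sum]
    refine Finset.sum_congr rfl fun j _ => ?_
    rw [← fourier_iterate]
    ring
  exact (funext e) ▸ h

lemma norm_sum_partialCoeff_le (hw : IsSmoothableSnd w B K) (J : ℕ) {κ : ℝ} (hκ : 0 < κ)
    (hκ1 : κ ≤ 1) {S D : ℝ} (hS : ∀ F : Finset ℤ, ∑ l ∈ F, (l.natAbs : ℝ) ^ (-(1 + κ)) ≤ S)
    {m : ℤ} {ω : Torus} {p : Torus2} {N : ℕ}
    (hD : ∀ l, ‖∑ j ∈ Finset.range N, (AddCircle.toCircle (orbitPhase ω m l p.1 p.2 j) : ℂ)‖ ≤ D) :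
    ‖∑ j ∈ Finset.range N, fourier m ((skewShift ω)^[j] p).1 *
        partialCoeff (fun p => (smoothSnd (2 * (2 ^ J)⁻¹) w p : ℂ)) m ((skewShift ω)^[j] p).2‖ ≤
      (B + √(4 * ((2 : ℝ) ^ J) ^ κ * S * (B * K * (J + 1)))) * D := by
  have hD0 : 0 ≤ D := (norm_nonneg _).trans (hD 0)
  refine norm_le_of_hasSum (hw.hasSum_orbit_partialCoeff (by positivity) m ω p N) fun F => ?_
  calc _ ≤ ∑ l ∈ F, (Real.exp (-(2 * Real.pi * (2 * (2 ^ J)⁻¹))) ^ l.natAbs *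
        ‖fourierCoeff (partialCoeff (fun p => (w p : ℂ)) m) l‖ * 1) * D := by
        refine Finset.sum_le_sum fun l _ => ?_
        rw [norm_mul, norm_mul, norm_real, Real.norm_of_nonneg (by positivity), mul_one]
        exact mul_le_mul_of_nonneg_left (hD l) (by positivity)
    _ ≤ _ := by
        rw [← Finset.sum_mul]
        refine mul_le_mul_of_nonneg_right ?_ hD0
        refine (sum_le_add_sum_erase (by positivity) F).trans (add_le_add ?_ ?_)
        · simpa using hw.norm_fourierCoeff_partialCoeff_le m 0
        · exact hw.sum_mul_le m J hκ hκ1 (fun l hl => Finset.ne_of_mem_erase hl)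
            (b := fun _ => 1) (by simpa using hS _)

lemma norm_sum_partialCoeff_zero_le (hw : IsSmoothableSnd w B K) (J : ℕ) {κ : ℝ} (hκ : 0 < κ)
    (hκ1 : κ ≤ 1) {S : ℝ} {ω : Torus} {p : Torus2} {N : ℕ}
    (hω : ∀ l : ℤ, l ≠ 0 → 0 < ‖l • ω‖)
    (hS : ∀ F : Finset ℤ, (∀ l ∈ F, l ≠ 0) →
      ∑ l ∈ F, (l.natAbs : ℝ) ^ (-(1 + κ)) * (1 / ‖l • ω‖) ≤ S) :
    ‖∑ j ∈ Finset.range N, fourier 0 ((skewShift ω)^[j] p).1 *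
        partialCoeff (fun p => (smoothSnd (2 * (2 ^ J)⁻¹) w p : ℂ)) 0 ((skewShift ω)^[j] p).2 -
      N * ((∫ q, w q : ℝ) : ℂ)‖ ≤
      √(4 * ((2 : ℝ) ^ J) ^ κ * (S * N) * (B * K * (J + 1))) := by
  have hwc := hw.continuous
  have hη : (0 : ℝ) < 2 * (2 ^ J)⁻¹ := by positivity
  have h0 : fourierCoeff (partialCoeff (fun p => (w p : ℂ)) 0) 0 = ((∫ q, w q : ℝ) : ℂ) := by
    simp only [fourierCoeff_eq_integral_torus, partialCoeff, neg_zero, fourier_zero, one_mul]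
    rw [← integral_complex_ofReal, Measure.volume_eq_prod, integral_prod_symm _
      (integrable_of_continuous_torus2 (by fun_prop))]
  have hphase : ∀ l : ℤ, ∀ j : ℕ, orbitPhase ω 0 l p.1 p.2 j = l • p.2 + j • (l • ω) := by
    intro l j
    rw [orbitPhase, zero_smul, zero_add, smul_add, smul_comm]
  have h1 := norm_sub_le_of_hasSum (hw.hasSum_orbit_partialCoeff hη 0 ω p N) 0
    (D := √(4 * ((2 : ℝ) ^ J) ^ κ * (S * N) * (B * K * (J + 1)))) fun F hF => ?_
  · simpa [h0, hphase, mul_comm] using h1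
  · have hF' : ∀ l ∈ F, l ≠ 0 := fun l hl h => hF (h ▸ hl)
    simp only [norm_mul, norm_real]
    refine le_trans (Finset.sum_le_sum fun l _ => ?_) (hw.sum_mul_le 0 J hκ hκ1 hF'
      (b := fun l => ‖∑ j ∈ Finset.range N, (AddCircle.toCircle (orbitPhase ω 0 l p.1 p.2 j) : ℂ)‖)
      (S := S * N) ?_)
    · rw [Real.norm_of_nonneg (by positivity)]
    · refine le_trans ?_ (mul_le_mul_of_nonneg_right (hS F hF') (Nat.cast_nonneg N))
      rw [Finset.sum_mul]
      refine Finset.sum_le_sum fun l hl => ?_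
      have hl0 := hω l (hF' l hl)
      have a1 := norm_sum_toCircle_le (l • p.2) (l • ω) hl0 N
      have a2 : ‖∑ j ∈ Finset.range N, (AddCircle.toCircle (l • p.2 + j • (l • ω)) : ℂ)‖ ≤ N := by
        refine (norm_sum_le _ _).trans ((Finset.sum_le_sum fun j _ =>
          (Circle.norm_coe _).le).trans ?_)
        simp
      simp only [← hphase] at a1 a2
      have a3 : 1 / (2 * ‖l • ω‖) ≤ 1 / ‖l • ω‖ :=
        one_div_le_one_div_of_le hl0 (by linarith)
      rw [sq, mul_comm, mul_assoc]
      exact mul_le_mul_of_nonneg_left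
        (mul_le_mul (a1.trans a3) a2 (norm_nonneg _) (by positivity)) (by positivity)

end IsSmoothableSnd

lemma continuous_skewShift (ω : Torus) : Continuous (skewShift ω) := by
  unfold skewShift; fun_prop

lemma measurePreserving_skewShift (ω : Torus) :
    MeasurePreserving (skewShift ω) (volume : Measure Torus2) volume := by
  have h1 : MeasurePreserving (fun p : Torus × Torus => (p.1, p.1 + p.2))
      (volume.prod volume) (volume.prod volume) := measurePreserving_prod_add volume volume
  have h2 : MeasurePreserving (fun p : Torus × Torus => (p.1 + ω, p.2))
      (volume.prod volume) (volume.prod volume) :=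
    (measurePreserving_add_right volume ω).prod (MeasurePreserving.id volume)
  have h3 : MeasurePreserving (Prod.swap : Torus × Torus → Torus × Torus)
      (volume.prod volume) (volume.prod volume) := Measure.measurePreserving_swap
  have h := h3.comp (h2.comp (h1.comp h3))
  refine (funext fun p => ?_ : _ = skewShift ω) ▸ h
  simp [skewShift, add_comm]

/-- The product of Poisson kernels at heights `s` and `t`. -/
def boxKernel (s t : ℝ) (q : Torus2) : ℝ :=
  circlePoisson (Real.exp (-(2 * Real.pi * s))) q.1 *
    circlePoisson (Real.exp (-(2 * Real.pi * t))) q.2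

/-- Poisson averaging in both variables. -/
def boxAvg (s t : ℝ) (W : Torus2 → ℝ) (p : Torus2) : ℝ := ∫ q, boxKernel s t (p - q) * W q

lemma continuous_boxKernel {s t : ℝ} (hs : 0 < s) (ht : 0 < t) : Continuous (boxKernel s t) := by
  have h1 := continuous_circlePoisson (Real.exp_pos _).le (exp_neg_lt_one hs)
  have h2 := continuous_circlePoisson (Real.exp_pos _).le (exp_neg_lt_one ht)
  unfold boxKernel
  fun_prop

lemma boxKernel_nonneg {s t : ℝ} (hs : 0 < s) (ht : 0 < t) (q : Torus2) : 0 ≤ boxKernel s t q :=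
  mul_nonneg (circlePoisson_nonneg (Real.exp_pos _).le (exp_neg_lt_one hs) _)
    (circlePoisson_nonneg (Real.exp_pos _).le (exp_neg_lt_one ht) _)

lemma boxKernel_le {s t : ℝ} (hs : 0 < s) (hs1 : s ≤ 1) (ht : 0 < t) (ht1 : t ≤ 1) (q : Torus2) :
    boxKernel s t q ≤ 16 / (s * t) := by
  calc _ ≤ 4 / s * (4 / t) := mul_le_mul (circlePoisson_exp_le hs hs1 _)
        (circlePoisson_exp_le ht ht1 _)
        (circlePoisson_nonneg (Real.exp_pos _).le (exp_neg_lt_one ht) _) (by positivity)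
    _ = _ := by field_simp; norm_num

lemma integrable_boxKernel_mul {s t : ℝ} (hs : 0 < s) (ht : 0 < t) {W : Torus2 → ℝ}
    (hW : Continuous W) (p : Torus2) : Integrable fun q => boxKernel s t (p - q) * W q := by
  have := continuous_boxKernel hs ht
  exact integrable_of_continuous_torus2 (by fun_prop)

lemma boxAvg_eq_smooth {s t : ℝ} (hs : 0 < s) (ht : 0 < t) {W : Torus2 → ℝ} (hW : Continuous W)
    (p : Torus2) : boxAvg s t W p = smoothSnd t (smoothFst s W) p := by
  have h := integrable_boxKernel_mul hs ht hW p
  unfold boxAvg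
  rw [Measure.volume_eq_prod] at h ⊢
  rw [integral_prod_symm _ h]
  simp only [smoothSnd, smoothFst, heightAvg, poissonAvg]
  refine integral_congr_ae (Eventually.of_forall fun y => ?_)
  dsimp only
  rw [← integral_const_mul]
  refine integral_congr_ae (Eventually.of_forall fun x => ?_)
  simp only [boxKernel, Prod.fst_sub, Prod.snd_sub]
  ring

lemma boxAvg_mono {s t : ℝ} (hs : 0 < s) (ht : 0 < t) {V W : Torus2 → ℝ} (hV : Continuous V)
    (hW : Continuous W) (h : ∀ q, V q ≤ W q) (p : Torus2) : boxAvg s t V p ≤ boxAvg s t W p :=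
  integral_mono (integrable_boxKernel_mul hs ht hV p) (integrable_boxKernel_mul hs ht hW p)
    fun q => mul_le_mul_of_nonneg_left (h q) (boxKernel_nonneg hs ht _)

lemma boxAvg_add {s t : ℝ} (hs : 0 < s) (ht : 0 < t) {V W : Torus2 → ℝ} (hV : Continuous V)
    (hW : Continuous W) (p : Torus2) :
    boxAvg s t (fun q => V q + W q) p = boxAvg s t V p + boxAvg s t W p := by
  unfold boxAvg
  simp only [mul_add]
  exact integral_add (integrable_boxKernel_mul hs ht hV p) (integrable_boxKernel_mul hs ht hW p)

lemma boxAvg_sub {s t : ℝ} (hs : 0 < s) (ht : 0 < t) {V W : Torus2 → ℝ} (hV : Continuous V)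
    (hW : Continuous W) (p : Torus2) :
    boxAvg s t (fun q => V q - W q) p = boxAvg s t V p - boxAvg s t W p := by
  unfold boxAvg
  simp only [mul_sub]
  exact integral_sub (integrable_boxKernel_mul hs ht hV p) (integrable_boxKernel_mul hs ht hW p)

lemma boxAvg_const {s t : ℝ} (hs : 0 < s) (ht : 0 < t) (c : ℝ) (p : Torus2) :
    boxAvg s t (fun _ => c) p = c := by
  rw [boxAvg_eq_smooth hs ht continuous_const]
  simp only [smoothSnd, smoothFst, heightAvg]
  rw [poissonAvg_const (Real.exp_pos _).le (exp_neg_lt_one hs),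
    poissonAvg_const (Real.exp_pos _).le (exp_neg_lt_one ht)]

lemma boxAvg_le_integral {s t : ℝ} (hs : 0 < s) (hs1 : s ≤ 1) (ht : 0 < t) (ht1 : t ≤ 1)
    {W : Torus2 → ℝ} (hW : Continuous W) (hW0 : ∀ q, 0 ≤ W q) (p : Torus2) :
    boxAvg s t W p ≤ 16 / (s * t) * ∫ q, W q := by
  rw [← integral_const_mul]
  exact integral_mono (integrable_boxKernel_mul hs ht hW p)
    ((integrable_of_continuous_torus2 hW).const_mul _)
    fun q => mul_le_mul_of_nonneg_right (boxKernel_le hs hs1 ht ht1 _) (hW0 q)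

/-- The average of `w` along the first `N` points of an orbit of the skew-shift. -/
def orbitAvg (ω : Torus) (N : ℕ) (w : Torus2 → ℝ) (p : Torus2) : ℝ :=
  (∑ j ∈ Finset.range N, w ((skewShift ω)^[j] p)) / N

lemma continuous_orbitAvg (ω : Torus) (N : ℕ) {w : Torus2 → ℝ} (hw : Continuous w) :
    Continuous (orbitAvg ω N w) := by
  unfold orbitAvg
  have := fun j => (continuous_skewShift ω).iterate j
  exact (continuous_finsetSum _ fun j _ => hw.comp (this j)).div_const _

lemma integral_orbitAvg (ω : Torus) {N : ℕ} (hN : 1 ≤ N) {w : Torus2 → ℝ} (hw : Continuous w) :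
    ∫ p, orbitAvg ω N w p = ∫ p, w p := by
  unfold orbitAvg
  have hi := fun j => (continuous_skewShift ω).iterate j
  rw [integral_div, integral_finsetSum (f := fun j p => w ((skewShift ω)^[j] p)) _ fun j _ =>
    integrable_of_continuous_torus2 (hw.comp (hi j))]
  have h : ∀ j, ∫ p, w ((skewShift ω)^[j] p) = ∫ p, w p := by
    intro j
    have hm := (measurePreserving_skewShift ω).iterate j
    have h2 := integral_map (μ := (volume : Measure Torus2)) hm.measurable.aemeasurable
      (f := w) (by rw [hm.map_eq]; exact hw.aestronglyMeasurable)
    rw [hm.map_eq] at h2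
    exact h2.symm
  have hN0 : (N : ℝ) ≠ 0 := by positivity
  simp only [h, Finset.sum_const, Finset.card_range, nsmul_eq_mul]
  field_simp

lemma smoothFst_iterate (ω : Torus) (s : ℝ) (w : Torus2 → ℝ) (j : ℕ) (p : Torus2) :
    smoothFst s (fun q => w ((skewShift ω)^[j] q)) p = smoothFst s w ((skewShift ω)^[j] p) := by
  simp only [smoothFst, heightAvg, poissonAvg, skewShift_iterate, add_assoc]
  set a : Torus := j • p.2 + (j * (j - 1) / 2 : ℤ) • ω
  refine Eq.trans ?_ (integral_add_right_eq_self (fun x : Torus =>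
    circlePoisson (Real.exp (-(2 * Real.pi * s))) (p.1 + a - x) * w (x, p.2 + j • ω)) a)
  refine integral_congr_ae (Eventually.of_forall fun x => ?_)
  dsimp only
  congr 2
  · abel

lemma smoothFst_orbitAvg (ω : Torus) (N : ℕ) {s : ℝ} (hs : 0 < s) {w : Torus2 → ℝ}
    (hw : Continuous w) (p : Torus2) :
    smoothFst s (orbitAvg ω N w) p = orbitAvg ω N (smoothFst s w) p := by
  simp only [orbitAvg, ← smoothFst_iterate]
  simp only [smoothFst, heightAvg, poissonAvg]
  have h : ∀ j, Continuous fun x => w ((skewShift ω)^[j] (x, p.2)) := by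
    intro j
    have := (continuous_skewShift ω).iterate j
    fun_prop
  rw [← integral_finsetSum _ fun j _ => integrable_circlePoisson_mul (Real.exp_pos _).le
    (exp_neg_lt_one hs) (h j) p.1, ← integral_div]
  refine integral_congr_ae (Eventually.of_forall fun x => ?_)
  dsimp only
  rw [← Finset.mul_sum, orbitAvg]
  ring

namespace IsSmoothableSnd

variable {w : Torus2 → ℝ} {B K : ℝ}

lemma abs_boxAvg_sub_smooth_le (hw : IsSmoothableSnd w B K) {η s t : ℝ} (hη : 0 < η) (hs : 0 < s)
    (hs1 : s ≤ 1) (ht : 0 < t) (ht1 : t ≤ 1) (ω : Torus) {N : ℕ} (hN : 1 ≤ N) (p : Torus2) :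
    |boxAvg s t (orbitAvg ω N w) p - boxAvg s t (orbitAvg ω N (smoothSnd (2 * η) w)) p| ≤
      16 / (s * t) * (K * η) := by
  have hwc := hw.continuous
  have hc := continuous_smoothSnd (η := 2 * η) (by positivity) hwc
  set D : Torus2 → ℝ := fun q => |smoothSnd (2 * η) w q - w q| with hD
  have hDc : Continuous D := by fun_prop
  have c1 := continuous_orbitAvg ω N hwc
  have c2 := continuous_orbitAvg ω N hc
  have c3 := continuous_orbitAvg ω N hDc
  have hle : ∀ q, |orbitAvg ω N w q - orbitAvg ω N (smoothSnd (2 * η) w) q| ≤ orbitAvg ω N D q := by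
    intro q
    simp only [orbitAvg]
    rw [← sub_div, ← Finset.sum_sub_distrib, abs_div, Nat.abs_cast]
    gcongr
    refine (Finset.abs_sum_le_sum_abs _ _).trans (Finset.sum_le_sum fun j _ => ?_)
    rw [hD, abs_sub_comm]
  have h3 : boxAvg s t (orbitAvg ω N D) p ≤ 16 / (s * t) * (K * η) := by
    refine (boxAvg_le_integral hs hs1 ht ht1 c3 (fun q => ?_) p).trans ?_
    · exact (abs_nonneg _).trans (hle q)
    · rw [integral_orbitAvg ω hN hDc]
      exact mul_le_mul_of_nonneg_left (hw.integral_abs_prod_le hη) (by positivity)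
  rw [abs_le]
  constructor
  · have := boxAvg_mono hs ht c2 (c1.add c3) (fun q => by
      have := (abs_le.mp (hle q)).1; simp only [Pi.add_apply]; linarith) p
    have e := boxAvg_add hs ht c1 c3 p
    simp only [Pi.add_def] at this
    linarith
  · have := boxAvg_mono hs ht c1 (c2.add c3) (fun q => by
      have := (abs_le.mp (hle q)).2; simp only [Pi.add_apply]; linarith) p
    have e := boxAvg_add hs ht c2 c3 p
    simp only [Pi.add_def] at this
    linarith

lemma hasSum_smoothFst_smoothSnd (hw : IsSmoothableSnd w B K) {η s : ℝ} (hη : 0 < η) (hs : 0 < s)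
    (q : Torus2) : HasSum (fun m : ℤ => (Real.exp (-(2 * Real.pi * s)) ^ m.natAbs : ℝ) *
      partialCoeff (fun p => (smoothSnd η w p : ℂ)) m q.2 * fourier m q.1)
      (smoothFst s (smoothSnd η w) q : ℂ) := by
  have hc := continuous_smoothSnd hη hw.continuous
  have h := hasSum_poissonAvg (Real.exp_pos _).le (exp_neg_lt_one hs)
    (u := fun x => smoothSnd η w (x, q.2)) (by fun_prop) q.1
  simp only [fourierCoeff_eq_integral_torus] at h
  exact h

lemma hasSum_orbit_smoothFst (hw : IsSmoothableSnd w B K) {η s : ℝ} (hη : 0 < η) (hs : 0 < s)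
    (ω : Torus) (N : ℕ) (p : Torus2) :
    HasSum (fun m : ℤ => (Real.exp (-(2 * Real.pi * s)) ^ m.natAbs : ℝ) *
      ∑ j ∈ Finset.range N, fourier m ((skewShift ω)^[j] p).1 *
        partialCoeff (fun p => (smoothSnd η w p : ℂ)) m ((skewShift ω)^[j] p).2)
      (∑ j ∈ Finset.range N, (smoothFst s (smoothSnd η w) ((skewShift ω)^[j] p) : ℂ)) := by
  have h := hasSum_sum (s := Finset.range N) fun j _ =>
    hw.hasSum_smoothFst_smoothSnd hη hs ((skewShift ω)^[j] p)
  have e : ∀ m : ℤ, ∑ j ∈ Finset.range N, (Real.exp (-(2 * Real.pi * s)) ^ m.natAbs : ℝ) *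
      partialCoeff (fun p => (smoothSnd η w p : ℂ)) m ((skewShift ω)^[j] p).2 *
        (fourier m ((skewShift ω)^[j] p).1 : ℂ) =
      (Real.exp (-(2 * Real.pi * s)) ^ m.natAbs : ℝ) *
      ∑ j ∈ Finset.range N, fourier m ((skewShift ω)^[j] p).1 *
        partialCoeff (fun p => (smoothSnd η w p : ℂ)) m ((skewShift ω)^[j] p).2 := by
    intro m
    rw [Finset.mul_sum]
    exact Finset.sum_congr rfl fun j _ => by ring
  exact (funext e) ▸ h

lemma abs_sum_smooth_sub_le (hw : IsSmoothableSnd w B K) (J : ℕ) {s : ℝ} (hs : 0 < s) (hs1 : s ≤ 1)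
    (ω : Torus) {N : ℕ} {p : Torus2} {D E : ℝ} (hD0 : 0 ≤ D)
    (hD : ∀ m : ℤ, m ≠ 0 → ‖∑ j ∈ Finset.range N, fourier m ((skewShift ω)^[j] p).1 *
        partialCoeff (fun p => (smoothSnd (2 * (2 ^ J)⁻¹) w p : ℂ)) m ((skewShift ω)^[j] p).2‖ ≤
      D * m.natAbs)
    (hE : ‖∑ j ∈ Finset.range N, fourier 0 ((skewShift ω)^[j] p).1 *
        partialCoeff (fun p => (smoothSnd (2 * (2 ^ J)⁻¹) w p : ℂ)) 0 ((skewShift ω)^[j] p).2 -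
      N * ((∫ q, w q : ℝ) : ℂ)‖ ≤ E) :
    |∑ j ∈ Finset.range N, smoothFst s (smoothSnd (2 * (2 ^ J)⁻¹) w) ((skewShift ω)^[j] p) -
      N * ∫ q, w q| ≤ D * (8 / s ^ 2) + E := by
  have h := norm_sub_le_of_hasSum
    (hw.hasSum_orbit_smoothFst (η := 2 * (2 ^ J)⁻¹) (by positivity) hs ω N p) 0
    (D := D * (8 / s ^ 2)) fun F hF => by
      refine le_trans ?_ (mul_le_mul_of_nonneg_left (sum_natAbs_mul_exp_le hs hs1 F) hD0)
      rw [Finset.mul_sum]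
      refine Finset.sum_le_sum fun m hm => ?_
      rw [norm_mul, norm_real, Real.norm_of_nonneg (by positivity)]
      have := hD m (fun h => hF (h ▸ hm))
      calc _ ≤ Real.exp (-(2 * Real.pi * s)) ^ m.natAbs * (D * m.natAbs) := by gcongr
        _ = _ := by ring
  rw [Int.natAbs_zero, pow_zero, ofReal_one, one_mul] at h
  have h2 := (norm_sub_le_norm_sub_add_norm_sub _ _ _).trans (add_le_add h hE)
  rw [← Real.norm_eq_abs, ← norm_real]
  push_cast at h2 ⊢
  exact h2

end IsSmoothableSnd

lemma exists_sum_natAbs_rpow_le {κ : ℝ} (hκ : 0 < κ) :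
    ∃ S > 0, ∀ F : Finset ℤ, ∑ l ∈ F, (l.natAbs : ℝ) ^ (-(1 + κ)) ≤ S := by
  have h : Summable fun l : ℤ => |(l : ℝ)| ^ (-(1 + κ)) :=
    Real.summable_abs_int_rpow (by linarith)
  refine ⟨1 + ∑' l : ℤ, |(l : ℝ)| ^ (-(1 + κ)), ?_, fun F => ?_⟩
  · have : 0 ≤ ∑' l : ℤ, |(l : ℝ)| ^ (-(1 + κ)) := tsum_nonneg fun l => by positivity
    linarith
  · have := h.sum_le_tsum F fun l _ => by positivity
    simp only [Nat.cast_natAbs, Int.cast_abs]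
    linarith

lemma sum_natAbs_rpow_div_norm_le {a S : ℝ} {ω : Torus}
    (hS : ∀ F : Finset ℕ, (∀ q ∈ F, 1 ≤ q) → ∑ q ∈ F, (q : ℝ) ^ a * (1 / ‖q • ω‖) ≤ S)
    (F : Finset ℤ) (hF : ∀ l ∈ F, l ≠ 0) :
    ∑ l ∈ F, (l.natAbs : ℝ) ^ a * (1 / ‖l • ω‖) ≤ 2 * S := by
  have e : ∀ l : ℤ, ‖l • ω‖ = ‖l.natAbs • ω‖ := by
    intro l
    obtain h | h := Int.natAbs_eq l
    · conv_lhs => rw [h]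
      rw [natCast_zsmul]
    · conv_lhs => rw [h]
      rw [neg_smul, norm_neg, natCast_zsmul]
  have key : ∀ G : Finset ℤ, (∀ l ∈ G, l ≠ 0) → Set.InjOn Int.natAbs (G : Set ℤ) →
      ∑ l ∈ G, (l.natAbs : ℝ) ^ a * (1 / ‖l • ω‖) ≤ S := by
    intro G hG hinj
    have h := hS (G.image Int.natAbs) (by
      simp only [Finset.mem_image]
      rintro q ⟨l, hl, rfl⟩
      exact Int.natAbs_pos.mpr (hG l hl))
    rw [Finset.sum_image hinj] at h
    simpa only [e] using h
  rw [← Finset.sum_filter_add_sum_filter_not F (fun l => 0 ≤ l)]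
  have h1 := key (F.filter fun l => 0 ≤ l) (fun l hl => hF l (Finset.mem_filter.mp hl).1) (by
    intro x hx y hy hxy
    have := (Finset.mem_filter.mp hx).2
    have := (Finset.mem_filter.mp hy).2
    omega)
  have h2 := key (F.filter fun l => ¬ 0 ≤ l) (fun l hl => hF l (Finset.mem_filter.mp hl).1) (by
    intro x hx y hy hxy
    have := (Finset.mem_filter.mp hx).2
    have := (Finset.mem_filter.mp hy).2
    omega)
  linarith

/-- A dyadic scale comparable with `N²`, with the size of its logarithm. -/
lemma exists_dyadic_scale {κ : ℝ} (hκ : 0 < κ) {N : ℕ} (hN : 1 ≤ N) :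
    ∃ J : ℕ, (N : ℝ) ^ 2 ≤ 2 ^ J ∧ ((2 : ℝ) ^ J) ≤ 2 * (N : ℝ) ^ 2 ∧
      (J + 1 : ℝ) ≤ (2 + 3 / κ) * (N : ℝ) ^ κ := by
  have hN0 : (1 : ℝ) ≤ N := by exact_mod_cast hN
  have h1 : N ^ 2 < 2 ^ (Nat.log 2 (N ^ 2) + 1) := Nat.lt_pow_succ_log_self one_lt_two _
  have h2 : 2 ^ Nat.log 2 (N ^ 2) ≤ N ^ 2 := Nat.pow_log_le_self 2 (by positivity)
  refine ⟨Nat.log 2 (N ^ 2) + 1, by exact_mod_cast h1.le, ?_, ?_⟩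
  · rw [pow_succ, mul_comm]
    have : (2 : ℝ) ^ Nat.log 2 (N ^ 2) ≤ (N : ℝ) ^ 2 := by exact_mod_cast h2
    linarith
  · have h3 : (2 : ℝ) ^ Nat.log 2 (N ^ 2) ≤ (N : ℝ) ^ 2 := by exact_mod_cast h2
    have h4 := Real.log_le_log (by positivity) h3
    rw [Real.log_pow, Real.log_pow] at h4
    have h5 : Real.log N ≤ (N : ℝ) ^ κ / κ := Real.log_le_rpow_div (by positivity) hκ
    have hX : 1 ≤ (N : ℝ) ^ κ := Real.one_le_rpow hN0 hκ.le
    have h6 := Real.log_two_gt_d9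
    have h7 : 0 ≤ Real.log N := Real.log_nonneg hN0
    have h0 : (0 : ℝ) ≤ (Nat.log 2 (N ^ 2) : ℝ) := by positivity
    have h8 : (Nat.log 2 (N ^ 2) : ℝ) ≤ 3 * Real.log N := by
      push_cast at h4
      nlinarith
    push_cast
    calc _ ≤ 3 * Real.log N + 2 := by linarith
      _ ≤ 3 * ((N : ℝ) ^ κ / κ) + 2 * (N : ℝ) ^ κ := by linarith
      _ = _ := by ring

lemma sqrt_mul_le_of_le {a A b B : ℝ} (hA : 0 ≤ A) (hB : 0 ≤ B) (ha : a ≤ A * b) (hb : b ≤ B ^ 2) :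
    √a ≤ √A * B := by
  rw [Real.sqrt_le_iff]
  refine ⟨by positivity, ?_⟩
  rw [mul_pow, Real.sq_sqrt hA]
  exact ha.trans (mul_le_mul_of_nonneg_left hb hA)

set_option maxHeartbeats 1000000 in
/-- Orbit averages of a smoothable function, smoothed in both variables, are uniformly close to the
mean. -/
lemma exists_abs_boxAvg_orbitAvg_sub_le {c κ : ℝ} (hc : 0 < c) (hκ : 0 < κ) (hκ1 : 4 * κ ≤ 1) :
    ∃ C > 0, ∀ ω : Torus, (∀ q : ℕ, 0 < q → c * (q : ℝ) ^ (-(1 + κ)) ≤ ‖q • ω‖) →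
      ∀ (w : Torus2 → ℝ) (B K : ℝ), IsSmoothableSnd w B K → 1 ≤ B → 1 ≤ K →
      ∀ (N : ℕ) (s t : ℝ), 1 ≤ N → 0 < s → s ≤ 1 → 0 < t → t ≤ 1 → ∀ p : Torus2,
      |boxAvg s t (orbitAvg ω N w) p - ∫ q, w q| ≤
        16 / (s * t) * (K / N ^ 2) + C * (B * √K) * ((N : ℝ) ^ κ) ^ 5 / (s ^ 2 * √N) := by
  obtain ⟨C₁, hC₁, hphase⟩ := exists_norm_sum_orbitPhase_le hc hκ (by linarith)
  obtain ⟨C₂, hC₂, hdiv⟩ := exists_tsum_rpow_div_norm_le hc hκ (by linarith)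
  obtain ⟨S, hS0, hS⟩ := exists_sum_natAbs_rpow_le hκ
  set L : ℝ := 2 + 3 / κ with hL
  have hL0 : 0 < L := by positivity
  refine ⟨8 * (C₁ * (1 + √(8 * S * L))) + √(128 * C₂ * L), by positivity, ?_⟩
  intro ω hω w B K hw hB hK N s t hN hs hs1 ht ht1 p
  have hN1 : (1 : ℝ) ≤ N := by exact_mod_cast hN
  have hN0 : (0 : ℝ) < N := by linarith
  obtain ⟨J, hJ1, hJ2, hJ3⟩ := exists_dyadic_scale hκ hN
  set X : ℝ := (N : ℝ) ^ κ with hX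
  have hX1 : 1 ≤ X := Real.one_le_rpow hN1 hκ.le
  have hK1 : 1 ≤ √K := Real.one_le_sqrt.mpr hK
  have hKs : √K ^ 2 = K := Real.sq_sqrt (by linarith)
  have hNs : √(N : ℝ) ^ 2 = N := Real.sq_sqrt hN0.le
  have hNs0 : 0 < √(N : ℝ) := Real.sqrt_pos.mpr hN0
  have hJκ : ((2 : ℝ) ^ J) ^ κ ≤ 2 * X ^ 2 := by
    calc ((2 : ℝ) ^ J) ^ κ ≤ (2 * (N : ℝ) ^ 2) ^ κ :=
          Real.rpow_le_rpow (by positivity) hJ2 hκ.le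
      _ = 2 ^ κ * X ^ 2 := by
          rw [Real.mul_rpow (by norm_num) (by positivity), ← Real.rpow_natCast, ← Real.rpow_natCast,
            ← Real.rpow_mul hN0.le, ← Real.rpow_mul hN0.le]
          congr 2
          push_cast
          ring
      _ ≤ 2 * X ^ 2 := by
          have : (2 : ℝ) ^ κ ≤ 2 ^ (1 : ℝ) :=
            Real.rpow_le_rpow_of_exponent_le one_le_two (by linarith)
          rw [Real.rpow_one] at this
          gcongr
  have hJ4κ : ((2 : ℝ) ^ J) ^ (4 * κ) ≤ 16 * X ^ 8 := by
    have e : ((2 : ℝ) ^ J) ^ (4 * κ) = (((2 : ℝ) ^ J) ^ κ) ^ 4 := by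
      rw [← Real.rpow_natCast (((2 : ℝ) ^ J) ^ κ), ← Real.rpow_mul (by positivity)]
      push_cast
      ring_nf
    rw [e]
    calc _ ≤ (2 * X ^ 2) ^ 4 := by gcongr
      _ = _ := by ring
  have hpow : (N : ℝ) ^ ((1 + 3 * κ) / 2) ≤ √N * X ^ 2 := by
    rw [hX, ← Real.rpow_natCast, ← Real.rpow_mul hN0.le, Real.sqrt_eq_rpow, ← Real.rpow_add hN0]
    refine Real.rpow_le_rpow_of_exponent_le hN1 ?_
    push_cast
    linarith
  have hQ1 : √(4 * ((2 : ℝ) ^ J) ^ κ * S * (B * K * (J + 1))) ≤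
      √(8 * S * L) * (X ^ 2 * B * √K) := by
    refine sqrt_mul_le_of_le (b := X ^ 3 * (B * K)) (by positivity) (by positivity) ?_ ?_
    · calc _ ≤ 4 * (2 * X ^ 2) * S * (B * K * (L * X)) := by gcongr
        _ = _ := by ring
    · calc _ ≤ X ^ 4 * (B ^ 2 * K) := by
            have : X ^ 3 ≤ X ^ 4 := pow_le_pow_right₀ hX1 (by norm_num)
            have : B ≤ B ^ 2 := by nlinarith
            gcongr
        _ = _ := by rw [mul_pow, mul_pow, hKs]; ring
  have hQ2 : √(4 * ((2 : ℝ) ^ J) ^ (4 * κ) * (2 * C₂ * N) * (B * K * (J + 1))) ≤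
      √(128 * C₂ * L) * (√N * X ^ 5 * B * √K) := by
    refine sqrt_mul_le_of_le (b := N * X ^ 9 * (B * K)) (by positivity) (by positivity) ?_ ?_
    · calc _ ≤ 4 * (16 * X ^ 8) * (2 * C₂ * N) * (B * K * (L * X)) := by gcongr
        _ = _ := by ring
    · calc _ ≤ N * X ^ 10 * (B ^ 2 * K) := by
            have : X ^ 9 ≤ X ^ 10 := pow_le_pow_right₀ hX1 (by norm_num)
            have : B ≤ B ^ 2 := by nlinarith
            gcongr
        _ = _ := by rw [mul_pow, mul_pow, mul_pow, hKs, hNs]; ring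
  have hωpos : ∀ l : ℤ, l ≠ 0 → 0 < ‖l • ω‖ := by
    intro l hl
    have h := hω l.natAbs (Int.natAbs_pos.mpr hl)
    have h0 : 0 < c * (l.natAbs : ℝ) ^ (-(1 + κ)) := by
      have : (0 : ℝ) < l.natAbs := by exact_mod_cast Int.natAbs_pos.mpr hl
      positivity
    have h1 := h0.trans_le h
    rw [norm_pos_iff] at h1 ⊢
    intro h2
    apply h1
    obtain h | h := Int.natAbs_eq l
    · rw [h, natCast_zsmul] at h2
      exact h2
    · rw [h, neg_smul, natCast_zsmul, neg_eq_zero] at h2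
      exact h2
  set D : ℝ := C₁ * (1 + √(8 * S * L)) * (√N * X ^ 4 * (B * √K)) with hD
  set E : ℝ := √(128 * C₂ * L) * (√N * X ^ 5 * B * √K) with hE
  have hmain : ∀ q : Torus2,
      |∑ j ∈ Finset.range N, smoothFst s (smoothSnd (2 * (2 ^ J)⁻¹) w) ((skewShift ω)^[j] q) -
        N * ∫ q, w q| ≤ D * (8 / s ^ 2) + E := by
    intro q
    refine hw.abs_sum_smooth_sub_le J hs hs1 ω (by positivity) (fun m hm => ?_) ?_
    · refine (hw.norm_sum_partialCoeff_le J hκ (by linarith) hS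
        fun l => hphase ω hω m hm l q.1 q.2 N hN).trans ?_
      calc _ ≤ (X ^ 2 * B * √K + √(8 * S * L) * (X ^ 2 * B * √K)) *
            (C₁ * m.natAbs * (√N * X ^ 2)) := by
            have : B ≤ X ^ 2 * B * √K := by
              have h1 : 1 ≤ X ^ 2 := one_le_pow₀ hX1
              nlinarith [mul_nonneg (by linarith : 0 ≤ B) (sub_nonneg.2 h1),
                mul_nonneg (mul_nonneg (by linarith : 0 ≤ X ^ 2) (by linarith : 0 ≤ B))
                  (sub_nonneg.2 hK1)]
            gcongr
        _ = _ := by rw [hD]; ring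
    · refine (hw.norm_sum_partialCoeff_zero_le J (by positivity) (by linarith) hωpos
        (sum_natAbs_rpow_div_norm_le fun F hF => hdiv ω hω F hF)).trans hQ2
  have hη : (0 : ℝ) < (2 ^ J)⁻¹ := by positivity
  have hwc := hw.continuous
  have hsm := continuous_smoothSnd (η := 2 * (2 ^ J)⁻¹) (by positivity) hwc
  have hsf := continuous_smoothFst hs hsm
  have hoa := continuous_orbitAvg ω N hsf
  have h1 := hw.abs_boxAvg_sub_smooth_le hη hs hs1 ht ht1 ω hN p
  have h2 : 16 / (s * t) * (K * (2 ^ J)⁻¹) ≤ 16 / (s * t) * (K / N ^ 2) := by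
    rw [div_eq_mul_inv K]
    gcongr
  have hδ : (D * (8 / s ^ 2) + E) / N ≤
      (8 * (C₁ * (1 + √(8 * S * L))) + √(128 * C₂ * L)) * (B * √K) * X ^ 5 / (s ^ 2 * √N) := by
    have hs2 : 1 ≤ 1 / s ^ 2 := one_le_one_div (by positivity) (pow_le_one₀ hs.le hs1)
    have hX45 : X ^ 4 ≤ X ^ 5 := pow_le_pow_right₀ hX1 (by norm_num)
    have e1 : √(N : ℝ) / N = 1 / √N := by
      rw [div_eq_div_iff hN0.ne' hNs0.ne', one_mul, ← sq, hNs]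
    calc _ = (C₁ * (1 + √(8 * S * L)) * 8 * X ^ 4 * (1 / s ^ 2) + √(128 * C₂ * L) * X ^ 5 * 1) *
            (B * √K) * (√N / N) := by rw [hD, hE]; ring
      _ ≤ (C₁ * (1 + √(8 * S * L)) * 8 * X ^ 5 * (1 / s ^ 2) +
            √(128 * C₂ * L) * X ^ 5 * (1 / s ^ 2)) * (B * √K) * (√N / N) := by gcongr
      _ = _ := by rw [e1]; field_simp
  have hpt : ∀ q, |orbitAvg ω N (smoothFst s (smoothSnd (2 * (2 ^ J)⁻¹) w)) q - ∫ q, w q| ≤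
      (D * (8 / s ^ 2) + E) / N := by
    intro q
    have e : orbitAvg ω N (smoothFst s (smoothSnd (2 * (2 ^ J)⁻¹) w)) q - ∫ q, w q =
        (∑ j ∈ Finset.range N, smoothFst s (smoothSnd (2 * (2 ^ J)⁻¹) w) ((skewShift ω)^[j] q) -
        N * ∫ q, w q) / N := by
      rw [orbitAvg]
      field_simp
    rw [e, abs_div, Nat.abs_cast]
    exact div_le_div_of_nonneg_right (hmain q) hN0.le
  have h3 : |boxAvg s t (orbitAvg ω N (smoothSnd (2 * (2 ^ J)⁻¹) w)) p - ∫ q, w q| ≤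
      (D * (8 / s ^ 2) + E) / N := by
    have e : boxAvg s t (orbitAvg ω N (smoothSnd (2 * (2 ^ J)⁻¹) w)) p =
        heightAvg t (fun y => orbitAvg ω N (smoothFst s (smoothSnd (2 * (2 ^ J)⁻¹) w)) (p.1, y))
          p.2 := by
      rw [boxAvg_eq_smooth hs ht (continuous_orbitAvg ω N hsm)]
      simp only [smoothSnd, smoothFst_orbitAvg ω N hs hsm]
    rw [e, abs_le]
    have hc : Continuous fun y =>
        orbitAvg ω N (smoothFst s (smoothSnd (2 * (2 ^ J)⁻¹) w)) (p.1, y) := by fun_prop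
    have a1 := heightAvg_le ht hc (c := (∫ q, w q) + (D * (8 / s ^ 2) + E) / N)
      (fun y => by have := (abs_le.mp (hpt (p.1, y))).2; linarith) p.2
    have a2 := le_heightAvg ht hc (c := (∫ q, w q) - (D * (8 / s ^ 2) + E) / N)
      (fun y => by have := (abs_le.mp (hpt (p.1, y))).1; linarith) p.2
    constructor <;> linarith
  exact (abs_sub_le _ _ _).trans (add_le_add (h1.trans h2) (h3.trans hδ))

/-- A function of two variables on the polydisc of radius `r` about a point of `ℝ²`, bounded by `M`,
extending `f`, and holomorphic along pairs of entire functions. -/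
structure IsPolydiscExtension (f : ℝ × ℝ → ℂ) (q : ℝ × ℝ) (r M : ℝ) (g : ℂ → ℂ → ℂ) : Prop where
  differentiableAt_comp : ∀ u₁ u₂ : ℂ → ℂ, Differentiable ℂ u₁ → Differentiable ℂ u₂ → ∀ v,
    ‖u₁ v - q.1‖ < r → ‖u₂ v - q.2‖ < r → DifferentiableAt ℂ (fun v => g (u₁ v) (u₂ v)) v
  norm_le : ∀ z w : ℂ, ‖z - q.1‖ < r → ‖w - q.2‖ < r → ‖g z w‖ ≤ M
  eq_real : ∀ x y : ℝ, |x - q.1| < r → |y - q.2| < r → g x y = f (x, y)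

/-- The complexification of a homogeneous polynomial on `ℝ²`. -/
def polyExt {n : ℕ} (p : ContinuousMultilinearMap ℝ (fun _ : Fin n => ℝ × ℝ) ℂ) (z w : ℂ) : ℂ :=
  ∑ s : Finset (Fin n), z ^ s.card * w ^ (n - s.card) *
    p (s.piecewise (fun _ => (1, 0)) (fun _ => (0, 1)))

lemma norm_polyExt_le {n : ℕ} (p : ContinuousMultilinearMap ℝ (fun _ : Fin n => ℝ × ℝ) ℂ)
    (z w : ℂ) : ‖polyExt p z w‖ ≤ ‖p‖ * (‖z‖ + ‖w‖) ^ n := by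
  have h : ∀ s : Finset (Fin n),
      ‖p (s.piecewise (fun _ => ((1 : ℝ), (0 : ℝ))) (fun _ => ((0 : ℝ), (1 : ℝ))))‖ ≤ ‖p‖ := by
    intro s
    refine (p.le_opNorm _).trans (mul_le_of_le_one_right (norm_nonneg _) ?_)
    refine Finset.prod_le_one (fun _ _ => norm_nonneg _) fun i _ => ?_
    by_cases hi : i ∈ s <;> simp [hi, Prod.norm_def]
  refine (norm_sum_le _ _).trans ?_
  rw [← Fin.sum_pow_mul_eq_add_pow, Finset.mul_sum]
  refine Finset.sum_le_sum fun s _ => ?_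
  rw [norm_mul, norm_mul, norm_pow, norm_pow, mul_comm]
  exact mul_le_mul_of_nonneg_right (h s) (by positivity)

lemma polyExt_real {n : ℕ} (p : ContinuousMultilinearMap ℝ (fun _ : Fin n => ℝ × ℝ) ℂ)
    (x y : ℝ) : polyExt p x y = p fun _ => (x, y) := by
  have e : (fun _ : Fin n => (x, y)) =
      (fun _ => x • ((1 : ℝ), (0 : ℝ))) + fun _ => y • ((0 : ℝ), (1 : ℝ)) := by
    funext i; simp
  rw [e, p.map_add_univ, polyExt]
  refine Finset.sum_congr rfl fun s _ => ?_
  have e2 : s.piecewise (fun _ => x • ((1 : ℝ), (0 : ℝ))) (fun _ => y • ((0 : ℝ), (1 : ℝ))) =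
      fun i => (s.piecewise (fun _ => x) (fun _ => y) i) •
        (s.piecewise (fun _ => ((1 : ℝ), (0 : ℝ))) (fun _ => ((0 : ℝ), (1 : ℝ))) i) := by
    funext i
    by_cases hi : i ∈ s <;> simp [hi]
  rw [e2, p.map_smul_univ, Finset.prod_piecewise, Finset.prod_const, Finset.prod_const]
  simp [Finset.card_sdiff]

lemma AnalyticAt.exists_isPolydiscExtension {f : ℝ × ℝ → ℂ} {q : ℝ × ℝ} (hf : AnalyticAt ℝ f q) :
    ∃ r > 0, ∃ M, ∃ g, IsPolydiscExtension f q r M g := by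
  obtain ⟨p, R, hp⟩ := hf
  obtain ⟨ρ, hρ0, hρR⟩ := ENNReal.lt_iff_exists_nnreal_btwn.mp hp.r_pos
  have hρ : 0 < (ρ : ℝ) := by exact_mod_cast hρ0
  obtain ⟨C, hC, hpC⟩ := p.norm_mul_pow_le_of_lt_radius (hρR.trans_le hp.r_le)
  have hb : ∀ (n : ℕ) (z w : ℂ), ‖z‖ < ρ / 4 → ‖w‖ < ρ / 4 →
      ‖polyExt (p n) z w‖ ≤ C * (1 / 2) ^ n := by
    intro n z w hz hw
    calc _ ≤ ‖p n‖ * (‖z‖ + ‖w‖) ^ n := norm_polyExt_le _ _ _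
      _ ≤ ‖p n‖ * (ρ * (1 / 2)) ^ n := by gcongr; linarith
      _ = ‖p n‖ * ρ ^ n * (1 / 2) ^ n := by rw [mul_pow]; ring
      _ ≤ _ := by gcongr; exact hpC n
  have hsum : Summable fun n : ℕ => C * (1 / 2 : ℝ) ^ n := summable_geometric_two.mul_left C
  refine ⟨ρ / 4, by positivity, C * 2, fun z w => ∑' n, polyExt (p n) (z - q.1) (w - q.2),
    ⟨fun u₁ u₂ h₁ h₂ v hv₁ hv₂ => ?_, fun z w hz hw => ?_, fun x y hx hy => ?_⟩⟩
  · have hU : IsOpen {v | ‖u₁ v - q.1‖ < ρ / 4 ∧ ‖u₂ v - q.2‖ < ρ / 4} :=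
      (isOpen_lt (h₁.continuous.sub continuous_const).norm continuous_const).inter
        (isOpen_lt (h₂.continuous.sub continuous_const).norm continuous_const)
    refine (differentiableOn_tsum_of_summable_norm hsum (fun n => ?_) hU
      fun n v hv => hb n _ _ hv.1 hv.2).differentiableAt (hU.mem_nhds ⟨hv₁, hv₂⟩)
    unfold polyExt
    fun_prop
  · exact tsum_of_norm_bounded (hasSum_geometric_two.mul_left C) fun n => hb n _ _ hz hw
  · have hmem : ((x, y) - q : ℝ × ℝ) ∈ Metric.eball (0 : ℝ × ℝ) R := by
      rw [mem_eball_zero_iff]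
      refine lt_of_le_of_lt ?_ hρR
      rw [← ofReal_norm]
      refine ENNReal.ofReal_le_of_le_toReal ?_
      simp only [ENNReal.coe_toReal, Prod.norm_def, Prod.fst_sub, Prod.snd_sub, Real.norm_eq_abs]
      exact max_le (by linarith) (by linarith)
    have h := (hp.hasSum hmem).tsum_eq
    rw [add_sub_cancel] at h
    rw [← h]
    refine tsum_congr fun n => ?_
    rw [← ofReal_sub, ← ofReal_sub, polyExt_real]
    rfl

namespace IsPolydiscExtension

variable {f : ℝ × ℝ → ℂ} {q q' : ℝ × ℝ} {r r' M M' : ℝ} {g g' : ℂ → ℂ → ℂ}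

lemma differentiableAt_fst (hg : IsPolydiscExtension f q r M g) (z w : ℂ) (hz : ‖z - q.1‖ < r)
    (hw : ‖w - q.2‖ < r) : DifferentiableAt ℂ (fun z => g z w) z :=
  hg.1 id (fun _ => w) differentiable_id (differentiable_const _) z hz hw

lemma differentiableAt_snd (hg : IsPolydiscExtension f q r M g) (z w : ℂ) (hz : ‖z - q.1‖ < r)
    (hw : ‖w - q.2‖ < r) : DifferentiableAt ℂ (g z) w :=
  hg.1 (fun _ => z) id (differentiable_const _) differentiable_id w hz hw

lemma mono (hg : IsPolydiscExtension f q r M g) {s L : ℝ}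
    (h : max |q'.1 - q.1| |q'.2 - q.2| + s ≤ r)
    (hL : M ≤ L) : IsPolydiscExtension f q' s L g := by
  have h1 := le_max_left |q'.1 - q.1| |q'.2 - q.2|
  have h2 := le_max_right |q'.1 - q.1| |q'.2 - q.2|
  have a1 : ∀ z : ℂ, ‖z - q'.1‖ < s → ‖z - q.1‖ < r := by
    intro z hz
    have := norm_sub_le_norm_sub_add_norm_sub z (q'.1 : ℂ) (q.1 : ℂ)
    rw [← ofReal_sub, norm_real, Real.norm_eq_abs] at this
    linarith
  have a2 : ∀ z : ℂ, ‖z - q'.2‖ < s → ‖z - q.2‖ < r := by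
    intro z hz
    have := norm_sub_le_norm_sub_add_norm_sub z (q'.2 : ℂ) (q.2 : ℂ)
    rw [← ofReal_sub, norm_real, Real.norm_eq_abs] at this
    linarith
  refine ⟨fun u₁ u₂ h₁ h₂ v hv₁ hv₂ => hg.1 u₁ u₂ h₁ h₂ v (a1 _ hv₁) (a2 _ hv₂),
    fun z w hz hw => (hg.2 z w (a1 z hz) (a2 w hw)).trans hL, fun x y hx hy => hg.3 x y ?_ ?_⟩
  · have := abs_sub_le x q'.1 q.1
    linarith
  · have := abs_sub_le y q'.2 q.2
    linarith

lemma translate (hg : IsPolydiscExtension f q r M g) {a b : ℝ}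
    (hf : ∀ x y, f (x + a, y + b) = f (x, y)) :
    IsPolydiscExtension f (q.1 + a, q.2 + b) r M fun z w => g (z - a) (w - b) := by
  have e1 : ∀ z : ℂ, z - ((q.1 + a : ℝ) : ℂ) = z - a - q.1 := fun z => by push_cast; ring
  have e2 : ∀ z : ℂ, z - ((q.2 + b : ℝ) : ℂ) = z - b - q.2 := fun z => by push_cast; ring
  refine ⟨fun u₁ u₂ h₁ h₂ v hv₁ hv₂ => ?_, fun z w hz hw => ?_, fun x y hx hy => ?_⟩
  · rw [e1] at hv₁
    rw [e2] at hv₂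
    exact hg.1 (fun v => u₁ v - a) (fun v => u₂ v - b) (h₁.sub_const _) (h₂.sub_const _) v hv₁ hv₂
  · rw [e1] at hz
    rw [e2] at hw
    exact hg.2 _ _ hz hw
  · have h := hg.3 (x - a) (y - b) (by rw [sub_sub, add_comm a]; exact hx)
      (by rw [sub_sub, add_comm b]; exact hy)
    push_cast at h
    rw [h, ← hf, sub_add_cancel, sub_add_cancel]

end IsPolydiscExtension

/-- Two functions holomorphic near a point and equal on a real interval coincide on balls. -/
lemma eqOn_inter_ball_of_real {φ ψ : ℂ → ℂ} {a b r s : ℝ}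
    (hφ : ∀ z : ℂ, ‖z - a‖ < r → DifferentiableAt ℂ φ z)
    (hψ : ∀ z : ℂ, ‖z - b‖ < s → DifferentiableAt ℂ ψ z)
    (h : ∀ x : ℝ, |x - a| < r → |x - b| < s → φ x = ψ x) {z : ℂ} (hz : ‖z - a‖ < r)
    (hz' : ‖z - b‖ < s) : φ z = ψ z := by
  have hre : ∀ c : ℝ, |z.re - c| ≤ ‖z - c‖ := fun c => by
    have := abs_re_le_norm (z - c)
    simpa using this
  set U : Set ℂ := Metric.ball (a : ℂ) r ∩ Metric.ball (b : ℂ) s with hU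
  have hUo : IsOpen U := Metric.isOpen_ball.inter Metric.isOpen_ball
  have hUc : IsPreconnected U := ((convex_ball _ _).inter (convex_ball _ _)).isPreconnected
  have hmem : ∀ v : ℂ, v ∈ U ↔ ‖v - a‖ < r ∧ ‖v - b‖ < s := fun v => by
    rw [hU, Set.mem_inter_iff, mem_ball_iff_norm, mem_ball_iff_norm]
  have hx0 : (z.re : ℂ) ∈ U := by
    rw [hmem, ← ofReal_sub, ← ofReal_sub, norm_real, norm_real]
    exact ⟨(hre a).trans_lt hz, (hre b).trans_lt hz'⟩
  have d1 : AnalyticOnNhd ℂ φ U := DifferentiableOn.analyticOnNhd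
    (fun v hv => (hφ v ((hmem v).mp hv).1).differentiableWithinAt) hUo
  have d2 : AnalyticOnNhd ℂ ψ U := DifferentiableOn.analyticOnNhd
    (fun v hv => (hψ v ((hmem v).mp hv).2).differentiableWithinAt) hUo
  refine d1.eqOn_of_preconnected_of_frequently_eq d2 hUc hx0 ?_ ((hmem z).mpr ⟨hz, hz'⟩)
  have ht : Tendsto (fun x : ℝ => (x : ℂ)) (nhdsWithin z.re {z.re}ᶜ)
      (nhdsWithin (z.re : ℂ) {(z.re : ℂ)}ᶜ) := by
    refine tendsto_nhdsWithin_of_tendsto_nhds_of_eventually_within _ ?_ ?_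
    · exact (continuous_ofReal.tendsto _).mono_left nhdsWithin_le_nhds
    · filter_upwards [self_mem_nhdsWithin] with x hx
      simpa using hx
  have hev : ∀ᶠ x : ℝ in nhdsWithin z.re {z.re}ᶜ, φ x = ψ x := by
    refine eventually_nhdsWithin_of_eventually_nhds ?_
    filter_upwards [continuous_ofReal.continuousAt.preimage_mem_nhds (hUo.mem_nhds hx0)] with x hx
    have := (hmem _).mp hx
    rw [← ofReal_sub, ← ofReal_sub, norm_real, norm_real] at this
    exact h x this.1 this.2
  exact ht.frequently hev.frequently

lemma exists_uniform_isPolydiscExtension {f : ℝ × ℝ → ℂ} (hf : ∀ q, AnalyticAt ℝ f q)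
    (hper : ∀ (x y : ℝ) (a b : ℤ), f (x + a, y + b) = f (x, y)) :
    ∃ r > 0, ∃ M, ∀ q, ∃ g, IsPolydiscExtension f q r M g := by
  have h : ∃ r > 0, ∃ M, ∀ q ∈ Set.Icc (0 : ℝ) 1 ×ˢ Set.Icc (0 : ℝ) 1,
      ∃ g, IsPolydiscExtension f q r M g := by
    refine IsCompact.induction_on (p := fun s => ∃ r > 0, ∃ M, ∀ q ∈ s,
      ∃ g, IsPolydiscExtension f q r M g) (isCompact_Icc.prod isCompact_Icc) ?_ ?_ ?_ ?_
    · exact ⟨1, one_pos, 0, by simp⟩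
    · rintro s t hst ⟨r, hr, M, h⟩
      exact ⟨r, hr, M, fun q hq => h q (hst hq)⟩
    · rintro s t ⟨r, hr, M, h⟩ ⟨r', hr', M', h'⟩
      refine ⟨min r r', lt_min hr hr', max M M', fun q hq => ?_⟩
      obtain hq | hq := hq
      · obtain ⟨g, hg⟩ := h q hq
        exact ⟨g, hg.mono (by simp) (le_max_left _ _)⟩
      · obtain ⟨g, hg⟩ := h' q hq
        exact ⟨g, hg.mono (by simp) (le_max_right _ _)⟩
    · intro q _
      obtain ⟨r, hr, M, g, hg⟩ := (hf q).exists_isPolydiscExtension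
      refine ⟨Metric.ball q (r / 2), mem_nhdsWithin_of_mem_nhds (Metric.ball_mem_nhds q
        (by linarith)),
        r / 2, by linarith, M, fun q' hq' => ⟨g, hg.mono ?_ le_rfl⟩⟩
      rw [mem_ball_iff_norm, Prod.norm_def] at hq'
      simp only [Prod.fst_sub, Prod.snd_sub, Real.norm_eq_abs] at hq'
      linarith
  obtain ⟨r, hr, M, h⟩ := h
  refine ⟨r, hr, M, fun q => ?_⟩
  obtain ⟨g, hg⟩ := h (Int.fract q.1, Int.fract q.2)
    ⟨⟨Int.fract_nonneg _, (Int.fract_lt_one _).le⟩, ⟨Int.fract_nonneg _, (Int.fract_lt_one _).le⟩⟩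
  have := hg.translate (a := ⌊q.1⌋) (b := ⌊q.2⌋) fun x y => hper x y _ _
  simp only [Int.fract_add_floor] at this
  exact ⟨_, this⟩

/-- A function on the product of two strips of half-width `r`, bounded by `M`, extending `f`, and
holomorphic along pairs of entire functions. -/
structure IsStripExtension (f : ℝ × ℝ → ℂ) (r M : ℝ) (F : ℂ → ℂ → ℂ) : Prop where
  differentiableAt_comp : ∀ u₁ u₂ : ℂ → ℂ, Differentiable ℂ u₁ → Differentiable ℂ u₂ → ∀ v,
    |(u₁ v).im| < r → |(u₂ v).im| < r → DifferentiableAt ℂ (fun v => F (u₁ v) (u₂ v)) v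
  norm_le : ∀ z w : ℂ, |z.im| < r → |w.im| < r → ‖F z w‖ ≤ M
  eq_real : ∀ x y : ℝ, F x y = f (x, y)

lemma norm_sub_re (z : ℂ) : ‖z - (z.re : ℂ)‖ = |z.im| := by
  have : z - (z.re : ℂ) = z.im * I := by apply Complex.ext <;> simp
  rw [this, norm_mul, norm_I, mul_one, norm_real, Real.norm_eq_abs]

lemma IsPolydiscExtension.eq_of_mem {f : ℝ × ℝ → ℂ} {q q' : ℝ × ℝ} {r M : ℝ} {g g' : ℂ → ℂ → ℂ}
    (hg : IsPolydiscExtension f q r M g) (hg' : IsPolydiscExtension f q' r M g') {z w : ℂ}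
    (hz : ‖z - q.1‖ < r) (hz' : ‖z - q'.1‖ < r) (hw : ‖w - q.2‖ < r) (hw' : ‖w - q'.2‖ < r) :
    g z w = g' z w := by
  have aux : ∀ y c : ℝ, |y - c| < r → ‖(y : ℂ) - c‖ < r := fun y c h => by
    rwa [← ofReal_sub, norm_real]
  refine eqOn_inter_ball_of_real (fun v hv => hg.differentiableAt_snd z v hz hv)
    (fun v hv => hg'.differentiableAt_snd z v hz' hv)
    (fun y hy hy' => ?_) hw hw'
  refine eqOn_inter_ball_of_real (φ := fun v => g v y) (ψ := fun v => g' v y)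
    (fun v hv => hg.differentiableAt_fst v y hv (aux _ _ hy))
    (fun v hv => hg'.differentiableAt_fst v y hv (aux _ _ hy'))
    (fun x hx hx' => ?_) hz hz'
  simp only [hg.3 x y hx hy, hg'.3 x y hx' hy']

lemma exists_isStripExtension {f : ℝ × ℝ → ℂ} (hf : ∀ q, AnalyticAt ℝ f q)
    (hper : ∀ (x y : ℝ) (a b : ℤ), f (x + a, y + b) = f (x, y)) :
    ∃ r > 0, ∃ M, ∃ F, IsStripExtension f r M F := by
  obtain ⟨r, hr, M, h⟩ := exists_uniform_isPolydiscExtension hf hper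
  choose g hg using h
  have hcont : ∀ {u : ℂ → ℂ}, Differentiable ℂ u → ∀ {c : ℝ} {z : ℂ}, ‖u z - c‖ < r →
      ∀ᶠ v : ℂ in nhds z, ‖u v - c‖ < r ∧ |(u v).im| < r := by
    intro u hu c z hz
    have hc : Continuous fun v : ℂ => ‖u v - c‖ := (hu.continuous.sub continuous_const).norm
    filter_upwards [hc.continuousAt.eventually_lt continuousAt_const hz] with v hv
    refine ⟨hv, lt_of_le_of_lt ?_ hv⟩
    have := abs_im_le_norm (u v - c)
    simpa using this
  have hself : ∀ {z : ℂ}, |z.im| < r → ‖z - (z.re : ℂ)‖ < r := fun h => by rwa [norm_sub_re]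
  refine ⟨r, hr, M, fun z w => g (z.re, w.re) z w, ⟨fun u₁ u₂ h₁ h₂ v hv₁ hv₂ => ?_,
    fun z w hz hw => ?_, fun x y => ?_⟩⟩
  · refine ((hg ((u₁ v).re, (u₂ v).re)).1 u₁ u₂ h₁ h₂ v (hself hv₁)
    (hself hv₂)).congr_of_eventuallyEq
      ?_
    filter_upwards [hcont h₁ (hself hv₁), hcont h₂ (hself hv₂)] with v' hv₁' hv₂'
    exact (hg _).eq_of_mem (hg _) (hself hv₁'.2) hv₁'.1 (hself hv₂'.2) hv₂'.1
  · exact (hg _).2 z w (hself hz) (hself hw)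
  · exact (hg _).3 x y (by simpa using hr) (by simpa using hr)

lemma dist_re_le_of_differentiableOn {φ : ℂ → ℂ} {r M : ℝ} (hM : ∀ z : ℂ, |z.im| < r → ‖φ z‖ ≤ M)
    (hd : ∀ z : ℂ, |z.im| < r → DifferentiableAt ℂ φ z) {z : ℂ} (hz : |z.im| < r) :
    ‖φ z - φ z.re‖ ≤ (2 * M + 1) / r * |z.im| := by
  have him : ∀ v ∈ Metric.ball (z.re : ℂ) r, |v.im| < r := by
    intro v hv
    rw [mem_ball_iff_norm] at hv
    refine lt_of_le_of_lt ?_ hv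
    have := abs_im_le_norm (v - z.re)
    simpa using this
  have hre : ‖φ z.re‖ ≤ M := hM _ (by simpa using (abs_nonneg _).trans_lt hz)
  have h := Complex.dist_le_div_mul_dist_of_mapsTo_ball (f := φ) (c := (z.re : ℂ)) (z := z)
    (R₁ := r) (R₂ := 2 * M + 1) (fun v hv => (hd v (him v hv)).differentiableWithinAt)
    (fun v hv => by
      rw [mem_closedBall_iff_norm]
      have := norm_sub_le (φ v) (φ z.re)
      have := hM v (him v hv)
      linarith) (by rwa [mem_ball_iff_norm, norm_sub_re])
  rwa [dist_eq_norm, dist_eq_norm, norm_sub_re] at h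

namespace IsStripExtension

variable {f : ℝ × ℝ → ℂ} {r M : ℝ} {F : ℂ → ℂ → ℂ}

lemma differentiableAt_fst (hF : IsStripExtension f r M F) (z w : ℂ) (hz : |z.im| < r)
    (hw : |w.im| < r) : DifferentiableAt ℂ (fun z => F z w) z :=
  hF.1 id (fun _ => w) differentiable_id (differentiable_const _) z hz hw

lemma differentiableAt_snd (hF : IsStripExtension f r M F) (z w : ℂ) (hz : |z.im| < r)
    (hw : |w.im| < r) : DifferentiableAt ℂ (F z) w :=
  hF.1 (fun _ => z) id (differentiable_const _) differentiable_id w hz hw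

lemma conj (hF : IsStripExtension f r M F) :
    IsStripExtension (fun q => (starRingEnd ℂ) (f q)) r M
      fun z w => (starRingEnd ℂ) (F ((starRingEnd ℂ) z) ((starRingEnd ℂ) w)) := by
  have him : ∀ {z : ℂ}, |z.im| < r → |((starRingEnd ℂ) z).im| < r := fun h => by
    rwa [conj_im, abs_neg]
  have hconj : ∀ {u : ℂ → ℂ}, Differentiable ℂ u →
      Differentiable ℂ fun v => (starRingEnd ℂ) (u ((starRingEnd ℂ) v)) := fun hu v => by
    have := (hu ((starRingEnd ℂ) v)).conj_conj
    rwa [conj_conj] at this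
  refine ⟨fun u₁ u₂ h₁ h₂ v hv₁ hv₂ => ?_, fun z w hz hw => ?_, fun x y => ?_⟩
  · have := (hF.1 _ _ (hconj h₁) (hconj h₂) ((starRingEnd ℂ) v) (by simpa using hv₁)
      (by simpa using hv₂)).conj_conj
    simp only [conj_conj, Function.comp_def] at this
    exact this
  · rw [RCLike.norm_conj]
    exact hF.2 _ _ (him hz) (him hw)
  · simp only [conj_ofReal, hF.3]

lemma norm_sub_le (hF : IsStripExtension f r M F) {z w : ℂ} (hz : |z.im| < r) (hw : |w.im| < r) :
    ‖F z w - f (z.re, w.re)‖ ≤ (2 * M + 1) / r * (|z.im| + |w.im|) := by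
  have h0 : |(z.re : ℂ).im| < r := by simpa using (abs_nonneg _).trans_lt hz
  have h1 := dist_re_le_of_differentiableOn (φ := fun v => F v w) (fun v hv => hF.2 v w hv hw)
    (fun v hv => hF.differentiableAt_fst v w hv hw) hz
  have h2 := dist_re_le_of_differentiableOn (φ := F z.re) (fun v hv => hF.2 _ v h0 hv)
    (fun v hv => hF.differentiableAt_snd _ v h0 hv) hw
  rw [← hF.3]
  calc _ ≤ _ := norm_sub_le_norm_sub_add_norm_sub _ (F z.re w) _
    _ ≤ _ := add_le_add h1 h2
    _ = _ := by ring

/-- A strip extension of a bounded function has nearly the same bound on thin strips. -/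
lemma exists_shrink (hF : IsStripExtension f r M F) (hr : 0 < r) {k k' : ℝ} (hf : ∀ q, ‖f q‖ ≤ k)
    (hk : k < k') : ∃ h > 0, IsStripExtension f h k' F := by
  have hM : 0 ≤ M := (norm_nonneg _).trans (hF.2 0 0 (by simpa) (by simpa))
  set L := (2 * M + 1) / r with hL
  have hL0 : 0 < L := by positivity
  refine ⟨min r ((k' - k) / (2 * L)), lt_min hr (div_pos (by linarith) (by linarith)), ?_⟩
  refine ⟨fun u₁ u₂ h₁ h₂ v hv₁ hv₂ => hF.1 u₁ u₂ h₁ h₂ v (hv₁.trans_le (min_le_left _ _))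
    (hv₂.trans_le (min_le_left _ _)), fun z w hz hw => ?_, hF.3⟩
  have h := hF.norm_sub_le (hz.trans_le (min_le_left _ _)) (hw.trans_le (min_le_left _ _))
  have h1 := hz.trans_le (min_le_right _ _)
  have h2 := hw.trans_le (min_le_right _ _)
  rw [lt_div_iff₀ (by positivity)] at h1 h2
  have h3 := norm_sub_norm_le (F z w) (f (z.re, w.re))
  have h4 := hf (z.re, w.re)
  rw [← hL] at h
  linarith

end IsStripExtension

lemma matOp_eq_sum (M : Matrix (Fin 2) (Fin 2) ℂ) :
    matOp M = ∑ i, ∑ j, M i j • matOp (Matrix.single i j 1) := by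
  conv_lhs => rw [Matrix.matrix_eq_sum_single M]
  simp only [map_sum]
  refine Finset.sum_congr rfl fun i _ => Finset.sum_congr rfl fun j _ => ?_
  rw [← map_smul, Matrix.smul_single, smul_eq_mul, mul_one]

lemma exists_norm_matOp_le : ∃ C ≥ (1 : ℝ), ∀ (M : Matrix (Fin 2) (Fin 2) ℂ) (K : ℝ),
    (∀ i j, ‖M i j‖ ≤ K) → ‖matOp M‖ ≤ C * K := by
  refine ⟨1 + ∑ i, ∑ j, ‖matOp (Matrix.single i j 1)‖, ?_, fun M K h => ?_⟩
  · have : 0 ≤ ∑ i : Fin 2, ∑ j : Fin 2, ‖matOp (Matrix.single i j 1)‖ := by positivity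
    linarith
  · have hK : 0 ≤ K := (norm_nonneg _).trans (h 0 0)
    rw [matOp_eq_sum, add_mul, one_mul, Finset.sum_mul]
    refine le_add_of_nonneg_of_le hK ((norm_sum_le _ _).trans (Finset.sum_le_sum fun i _ => ?_))
    rw [Finset.sum_mul]
    refine (norm_sum_le _ _).trans (Finset.sum_le_sum fun j _ => ?_)
    rw [norm_smul, mul_comm]
    exact mul_le_mul_of_nonneg_left (h i j) (norm_nonneg _)

lemma differentiableAt_matOp {E : Type*} [NormedAddCommGroup E] [NormedSpace ℂ E]
    {M : E → Matrix (Fin 2) (Fin 2) ℂ} {x : E} (h : ∀ i j, DifferentiableAt ℂ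
      (fun y => M y i j) x) :
    DifferentiableAt ℂ (fun y => matOp (M y)) x := by
  simp only [fun y => matOp_eq_sum (M y)]
  refine DifferentiableAt.fun_sum fun i _ => DifferentiableAt.fun_sum fun j _ => ?_
  exact (h i j).smul_const _

lemma continuous_matOp {X : Type*} [TopologicalSpace X] {M : X → Matrix (Fin 2) (Fin 2) ℂ}
    (h : ∀ i j, Continuous fun y => M y i j) : Continuous fun y => matOp (M y) := by
  simp only [fun y => matOp_eq_sum (M y)]
  exact continuous_finsetSum _ fun i _ => continuous_finsetSum _ fun j _ =>
    (h i j).smul continuous_const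

/-- The complexified Szegő matrix, with `a` and `b` in place of `α₀` and its conjugate. -/
def szegoExt (sz a b : ℂ) : Matrix (Fin 2) (Fin 2) ℂ :=
  exp (-(log (1 - a * b) / 2)) • !![sz, -b / sz; -a * sz, 1 / sz]

section szegoExt

variable {sz a b : ℂ} {k : ℝ}

lemma one_sub_mem_slitPlane {c : ℂ} (hc : ‖c‖ < 1) : 1 - c ∈ slitPlane := by
  refine mem_slitPlane_of_norm_lt_one (z := -c) ?_ |> fun h => by
    rwa [← sub_eq_add_neg] at h
  rwa [norm_neg]

lemma det_szegoExt (hsz : sz ≠ 0) (h : ‖a * b‖ < 1) : (szegoExt sz a b).det = 1 := by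
  have h0 := slitPlane_ne_zero (one_sub_mem_slitPlane h)
  rw [szegoExt, det_smul, det_fin_two_of, Fintype.card_fin, ← exp_nat_mul]
  have e : ((2 : ℕ) : ℂ) * (-(log (1 - a * b) / 2)) = -log (1 - a * b) := by push_cast; ring
  rw [e, exp_neg, exp_log h0]
  field_simp

lemma norm_szegoExt_apply_le (hsz : ‖sz‖ = 1) (hk : k < 1) (ha : ‖a‖ ≤ k) (hb : ‖b‖ ≤ k)
    (i j : Fin 2) : ‖szegoExt sz a b i j‖ ≤ (1 - k)⁻¹ := by
  have hk0 : 0 ≤ k := (norm_nonneg a).trans ha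
  have hab : ‖a * b‖ ≤ k := by
    rw [norm_mul]
    nlinarith [norm_nonneg a, norm_nonneg b]
  have h0 := slitPlane_ne_zero (one_sub_mem_slitPlane (hab.trans_lt hk))
  have hlow : 1 - k ≤ ‖1 - a * b‖ := by
    have := norm_sub_norm_le (1 : ℂ) (a * b)
    rw [norm_one] at this
    linarith
  have hc : ‖exp (-(log (1 - a * b) / 2))‖ ≤ (1 - k)⁻¹ := by
    have hsq : ‖exp (-(log (1 - a * b) / 2))‖ ^ 2 = ‖1 - a * b‖⁻¹ := by
      rw [← norm_pow, ← exp_nat_mul]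
      have e : ((2 : ℕ) : ℂ) * (-(log (1 - a * b) / 2)) = -log (1 - a * b) := by push_cast; ring
      rw [e, exp_neg, exp_log h0, norm_inv]
    have h1 : ‖1 - a * b‖⁻¹ ≤ (1 - k)⁻¹ := inv_anti₀ (by linarith) hlow
    have h2 : 1 ≤ (1 - k)⁻¹ := (one_le_inv₀ (by linarith)).mpr (by linarith)
    refine le_of_sq_le_sq ?_ (by linarith)
    nlinarith
  have hent : ‖(!![sz, -b / sz; -a * sz, 1 / sz] : Matrix (Fin 2) (Fin 2) ℂ) i j‖ ≤ 1 := by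
    fin_cases i <;> fin_cases j <;> simp [hsz] <;> linarith
  rw [szegoExt, Matrix.smul_apply, smul_eq_mul, norm_mul]
  exact (mul_le_of_le_one_right (norm_nonneg _) hent).trans hc

lemma differentiableAt_szegoExt {F G : ℂ → ℂ} {z : ℂ} (hF : DifferentiableAt ℂ F z)
    (hG : DifferentiableAt ℂ G z) (h : ‖F z * G z‖ < 1) :
    DifferentiableAt ℂ (fun z => matOp (szegoExt sz (F z) (G z))) z := by
  have hs : 1 - F z * G z ∈ slitPlane := one_sub_mem_slitPlane h
  have hl : DifferentiableAt ℂ (fun z => log (1 - F z * G z)) z :=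
    ((differentiableAt_const _).sub (hF.mul hG)).clog hs
  refine differentiableAt_matOp fun i j => ?_
  simp only [szegoExt, Matrix.smul_apply, smul_eq_mul]
  refine (hl.div_const _).neg.cexp.mul ?_
  fin_cases i <;> fin_cases j <;> simp <;> fun_prop

lemma szegoExt_conj (h : ‖a‖ < 1) : szegoExt sz a ((starRingEnd ℂ) a) =
    ((Real.sqrt (1 - ‖a‖ ^ 2) : ℂ))⁻¹ • !![sz, -(starRingEnd ℂ) a / sz; -a * sz, 1 / sz] := by
  have hpos : 0 < 1 - ‖a‖ ^ 2 := by nlinarith [norm_nonneg a]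
  rw [szegoExt, mul_conj, normSq_eq_norm_sq]
  congr 1
  have e : (1 : ℂ) - ((‖a‖ ^ 2 : ℝ) : ℂ) = ((1 - ‖a‖ ^ 2 : ℝ) : ℂ) := by push_cast; rfl
  rw [e, ← ofReal_log hpos.le, ← ofReal_inv, Real.sqrt_eq_rpow, Real.rpow_def_of_pos hpos,
    ← Real.exp_neg, ofReal_exp]
  congr 1
  push_cast
  ring

end szegoExt

lemma continuous_torus2_of_lift {E : Type*} [TopologicalSpace E] {f : Torus2 → E}
    (h : Continuous fun q : ℝ × ℝ => f ((q.1 : Torus), (q.2 : Torus))) : Continuous f := by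
  have hq : IsOpenQuotientMap (fun x : ℝ => (x : Torus)) := QuotientAddGroup.isOpenQuotientMap_mk
  exact (hq.prodMap hq).isQuotientMap.continuous_iff.mpr h

namespace IsRealAnalyticT2

variable {α : Torus2 → ℂ}

lemma continuous (h : IsRealAnalyticT2 α) : Continuous α := by
  obtain ⟨f, hf, hfα⟩ := h
  refine continuous_torus2_of_lift ?_
  simp only [← hfα]
  exact continuous_iff_continuousAt.mpr fun q => (hf q).continuousAt

lemma exists_norm_le (h : IsRealAnalyticT2 α) (h1 : ∀ p, ‖α p‖ < 1) :
    ∃ k < 1, 0 < k ∧ ∀ p, ‖α p‖ ≤ k := by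
  obtain ⟨p₀, -, hp₀⟩ := isCompact_univ.exists_isMaxOn (Set.univ_nonempty (α := Torus2))
    h.continuous.norm.continuousOn
  refine ⟨(1 + ‖α p₀‖) / 2, by linarith [h1 p₀], by positivity, fun p => ?_⟩
  have := hp₀ (Set.mem_univ p)
  simp only [Set.mem_ofPred_eq] at this
  linarith [h1 p₀]

lemma exists_isStripExtension (h : IsRealAnalyticT2 α) (h1 : ∀ p, ‖α p‖ < 1) :
    ∃ r > 0, ∃ k < 1, 0 < k ∧ (∀ p, ‖α p‖ ≤ k) ∧
      ∃ F, IsStripExtension (fun q => α ((q.1 : Torus), (q.2 : Torus))) r k F := by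
  obtain ⟨k, hk, hk0, hαk⟩ := h.exists_norm_le h1
  obtain ⟨f, hf, hfα⟩ := h
  have e : (fun q : ℝ × ℝ => α ((q.1 : Torus), (q.2 : Torus))) = f := by
    funext q
    rw [← hfα]
  have hper : ∀ (x y : ℝ) (a b : ℤ), f (x + a, y + b) = f (x, y) := by
    intro x y a b
    have e : ∀ (x : ℝ) (a : ℤ), ((x + a : ℝ) : Torus) = x := fun x a => by
      rw [AddCircle.coe_add, add_eq_left, AddCircle.coe_eq_zero_iff]
      exact ⟨a, by simp⟩
    rw [hfα, hfα, e, e]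
  obtain ⟨r, hr, M, F, hF⟩ := _root_.exists_isStripExtension hf hper
  obtain ⟨h, hh, hF'⟩ := hF.exists_shrink hr (k := k) (k' := (1 + k) / 2)
    (fun q => by rw [← e]; exact hαk _) (by linarith)
  exact ⟨h, hh, (1 + k) / 2, by linarith, by linarith, fun p => (hαk p).trans (by linarith),
    F, e ▸ hF'⟩

end IsRealAnalyticT2

/-- The complexified transfer matrix built from a matrix function `A` and a lift `a` of the
frequency. -/
def transferExt (A : ℂ → ℂ → Matrix (Fin 2) (Fin 2) ℂ) (a : ℝ) :
    ℕ → ℂ → ℂ → Matrix (Fin 2) (Fin 2) ℂ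
  | 0, _, _ => 1
  | n + 1, z, w =>
    A (z + n * w + (((n * (n - 1) / 2 : ℤ) * a : ℝ) : ℂ)) (w + (n * a : ℝ)) * transferExt A a n z w

/-- A separately holomorphic extension of the matrix functions `T m` to
`|Im z| ≤ h`, `m|Im w| ≤ h`, of norm at most `exp (B m)`. -/
structure IsTransferExtension (T : ℕ → Torus2 → Matrix (Fin 2) (Fin 2) ℂ) (h B : ℝ)
    (A : ℕ → ℂ → ℂ → (Plane →L[ℂ] Plane)) : Prop where
  differentiableAt_fst : ∀ (m : ℕ) (z w : ℂ), |z.im| ≤ h → (m : ℝ) * |w.im| ≤ h →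
    DifferentiableAt ℂ (fun z => A m z w) z
  differentiableAt_snd : ∀ (m : ℕ) (z w : ℂ), |z.im| ≤ h → (m : ℝ) * |w.im| ≤ h →
    DifferentiableAt ℂ (A m z) w
  norm_le : ∀ (m : ℕ) (z w : ℂ), |z.im| ≤ h → (m : ℝ) * |w.im| ≤ h →
    ‖A m z w‖ ≤ Real.exp (B * m)
  eq_real : ∀ m, ∀ x y : ℝ, A m x y = matOp (T m ((x : Torus), (y : Torus)))

section

variable {A : ℂ → ℂ → Matrix (Fin 2) (Fin 2) ℂ} {a r h B : ℝ}

lemma im_orbit_lt (hh : 0 < h) (hr : 2 * h < r) {n : ℕ} {z w : ℂ} (hz : |z.im| ≤ h)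
    (hw : ((n + 1 : ℕ) : ℝ) * |w.im| ≤ h) (c d : ℝ) :
    |(z + n * w + (c : ℂ)).im| < r ∧ |(w + (d : ℂ)).im| < r := by
  have e1 : (z + n * w + (c : ℂ)).im = z.im + n * w.im := by simp
  have e2 : (w + (d : ℂ)).im = w.im := by simp
  have h1 := abs_add_le z.im (n * w.im)
  rw [abs_mul, Nat.abs_cast] at h1
  push_cast at hw
  have h2 : 0 ≤ (n : ℝ) * |w.im| := by positivity
  have h3 : 0 ≤ |w.im| := abs_nonneg _
  rw [e1, e2]
  constructor <;> linarith

lemma mul_abs_im_le {n : ℕ} {w : ℂ} (hw : ((n + 1 : ℕ) : ℝ) * |w.im| ≤ h) : n * |w.im| ≤ h := by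
  push_cast at hw
  linarith [abs_nonneg w.im]

lemma differentiableAt_transferExt (hh : 0 < h) (hr : 2 * h < r)
    (hA : ∀ u₁ u₂ : ℂ → ℂ, Differentiable ℂ u₁ → Differentiable ℂ u₂ → ∀ v, |(u₁ v).im| < r →
      |(u₂ v).im| < r → DifferentiableAt ℂ (fun v => matOp (A (u₁ v) (u₂ v))) v)
    {u₁ u₂ : ℂ → ℂ} (h₁ : Differentiable ℂ u₁) (h₂ : Differentiable ℂ u₂) (n : ℕ) (v : ℂ)
    (hz : |(u₁ v).im| ≤ h) (hw : n * |(u₂ v).im| ≤ h) :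
    DifferentiableAt ℂ (fun v => matOp (transferExt A a n (u₁ v) (u₂ v))) v := by
  induction n with
  | zero =>
    simp only [transferExt]
    exact differentiableAt_const _
  | succ n ih =>
    obtain ⟨h3, h4⟩ := im_orbit_lt hh hr hz hw ((n * (n - 1) / 2 : ℤ) * a) (n * a)
    simp only [transferExt, matOp_mul]
    refine DifferentiableAt.clm_comp ?_ (ih (mul_abs_im_le hw))
    exact hA (fun v => u₁ v + n * u₂ v + (((n * (n - 1) / 2 : ℤ) * a : ℝ) : ℂ))
      (fun v => u₂ v + (n * a : ℝ)) ((h₁.add (h₂.const_mul _)).add_const _) (h₂.add_const _) v h3 h4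

lemma norm_transferExt_le (hh : 0 < h) (hr : 2 * h < r)
    (hA : ∀ z w : ℂ, |z.im| < r → |w.im| < r → ‖matOp (A z w)‖ ≤ Real.exp B)
    (n : ℕ) (z w : ℂ) (hz : |z.im| ≤ h) (hw : n * |w.im| ≤ h) :
    ‖matOp (transferExt A a n z w)‖ ≤ Real.exp (B * n) := by
  induction n with
  | zero =>
    simp only [transferExt, CharP.cast_eq_zero, mul_zero, Real.exp_zero, matOp, map_one]
    exact ContinuousLinearMap.norm_id_le
  | succ n ih =>
    obtain ⟨h1, h2⟩ := im_orbit_lt hh hr hz hw ((n * (n - 1) / 2 : ℤ) * a) (n * a)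
    have e : B * ((n + 1 : ℕ) : ℝ) = B + B * n := by push_cast; ring
    rw [e, Real.exp_add]
    simp only [transferExt, matOp_mul]
    exact (ContinuousLinearMap.opNorm_comp_le _ _).trans
      (mul_le_mul (hA _ _ h1 h2) (ih (mul_abs_im_le hw)) (norm_nonneg _) (Real.exp_pos _).le)

lemma isTransferExtension_transferExt {T : ℕ → Torus2 → Matrix (Fin 2) (Fin 2) ℂ} (hh : 0 < h)
    (hr : 2 * h < r)
    (hd : ∀ u₁ u₂ : ℂ → ℂ, Differentiable ℂ u₁ → Differentiable ℂ u₂ → ∀ v, |(u₁ v).im| < r →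
      |(u₂ v).im| < r → DifferentiableAt ℂ (fun v => matOp (A (u₁ v) (u₂ v))) v)
    (hn : ∀ z w : ℂ, |z.im| < r → |w.im| < r → ‖matOp (A z w)‖ ≤ Real.exp B)
    (hT : ∀ (n : ℕ) (x y : ℝ), transferExt A a n x y = T n ((x : Torus), (y : Torus))) :
    IsTransferExtension T h B fun n z w => matOp (transferExt A a n z w) where
  differentiableAt_fst n z w hz hw :=
    differentiableAt_transferExt hh hr hd differentiable_id (differentiable_const w) n z hz hw
  differentiableAt_snd n z w hz hw :=
    differentiableAt_transferExt hh hr hd (differentiable_const z) differentiable_id n w hz hw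
  norm_le n z w hz hw := norm_transferExt_le hh hr hn n z w hz hw
  eq_real n x y := congrArg matOp (hT n x y)

end

section transfer

variable {α : Torus2 → ℂ} {lam : ℝ} {sz : ℂ}

lemma szegoCocycle_eq_szegoExt (hl0 : 0 ≤ lam) (hl1 : lam ≤ 1) (h1 : ∀ p, ‖α p‖ < 1)
    (p : Torus2) : szegoCocycle α lam sz p =
      szegoExt sz (lam * α p) (lam * (starRingEnd ℂ) (α p)) := by
  have h : ‖(lam : ℂ) * α p‖ < 1 := by
    rw [norm_mul, norm_real, Real.norm_of_nonneg hl0]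
    exact mul_lt_one_of_nonneg_of_lt_one_right hl1 (norm_nonneg _) (h1 p)
  rw [szegoCocycle, ← szegoExt_conj h, map_mul, conj_ofReal]

lemma transferExt_real (hl0 : 0 ≤ lam) (hl1 : lam ≤ 1) (h1 : ∀ p, ‖α p‖ < 1)
    {F G : ℂ → ℂ → ℂ} (hF : ∀ x y : ℝ, F x y = α ((x : Torus), (y : Torus)))
    (hG : ∀ x y : ℝ, G x y = (starRingEnd ℂ) (α ((x : Torus), (y : Torus)))) (a : ℝ) (n : ℕ)
    (x y : ℝ) : transferExt (fun z w => szegoExt sz (lam * F z w) (lam * G z w)) a n x y =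
      transfer α lam (a : Torus) sz n ((x : Torus), (y : Torus)) := by
  induction n with
  | zero => rfl
  | succ n ih =>
    have e1 : (x : ℂ) + n * y + (((n * (n - 1) / 2 : ℤ) * a : ℝ) : ℂ) =
        ((x + n * y + (n * (n - 1) / 2 : ℤ) * a : ℝ) : ℂ) := by push_cast; rfl
    have e2 : (y : ℂ) + (n * a : ℝ) = ((y + n * a : ℝ) : ℂ) := by push_cast; rfl
    have e3 : (((x + n * y + (n * (n - 1) / 2 : ℤ) * a : ℝ) : Torus), ((y + n * a : ℝ) : Torus)) =
        (skewShift (a : Torus))^[n] ((x : Torus), (y : Torus)) := by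
      rw [skewShift_iterate]
      simp only [AddCircle.coe_add, ← AddCircle.coe_zsmul, ← AddCircle.coe_nsmul, nsmul_eq_mul,
        zsmul_eq_mul]
    rw [transferExt, transfer, ih, e1, e2, hF, hG, e3, ← szegoCocycle_eq_szegoExt hl0 hl1 h1]

lemma det_transfer (hl0 : 0 ≤ lam) (hl1 : lam ≤ 1) (h1 : ∀ p, ‖α p‖ < 1) (hsz : ‖sz‖ = 1)
    (ω : Torus) (n : ℕ) (p : Torus2) : (transfer α lam ω sz n p).det = 1 := by
  induction n with
  | zero => simp [transfer]
  | succ n ih =>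
    rw [transfer, det_mul, ih, mul_one, szegoCocycle_eq_szegoExt hl0 hl1 h1]
    refine det_szegoExt (norm_pos_iff.mp (by rw [hsz]; exact one_pos)) ?_
    have e : ‖(lam : ℂ) * α ((skewShift ω)^[n] p) *
        (lam * (starRingEnd ℂ) (α ((skewShift ω)^[n] p)))‖ =
        lam * lam * (‖α ((skewShift ω)^[n] p)‖ * ‖α ((skewShift ω)^[n] p)‖) := by
      rw [norm_mul, norm_mul, norm_mul, norm_real, RCLike.norm_conj, Real.norm_of_nonneg hl0]
      ring
    have h2 := h1 ((skewShift ω)^[n] p)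
    have h3 := norm_nonneg (α ((skewShift ω)^[n] p))
    rw [e]
    exact mul_lt_one_of_nonneg_of_lt_one_right (by nlinarith) (by positivity) (by nlinarith)

lemma transfer_add (ω : Torus) (a b : ℕ) (p : Torus2) : transfer α lam ω sz (a + b) p =
    transfer α lam ω sz b ((skewShift ω)^[a] p) * transfer α lam ω sz a p := by
  induction b with
  | zero => simp [transfer]
  | succ b ih =>
    rw [← add_assoc, transfer, ih, transfer, Matrix.mul_assoc, ← Function.iterate_add_apply,
      add_comm b a]

/-- The transfer matrices of an analytic Szegő cocycle have uniform analytic extensions. -/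
theorem exists_isTransferExtension (hα : IsRealAnalyticT2 α) (h1 : ∀ p, ‖α p‖ < 1) :
    ∃ h > 0, h ≤ 1 ∧ ∃ B ≥ (1 : ℝ), ∀ lam, 0 ≤ lam → lam ≤ 1 → ∀ sz : ℂ, ‖sz‖ = 1 → ∀ ω,
      ∃ A, IsTransferExtension (transfer α lam ω sz) h B A := by
  obtain ⟨r, hr, k, hk, hk0, -, F, hF⟩ := hα.exists_isStripExtension h1
  obtain ⟨C, hC, hCM⟩ := exists_norm_matOp_le
  have h2 : 1 ≤ (1 - k)⁻¹ := (one_le_inv₀ (by linarith)).mpr (by linarith)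
  obtain ⟨h, hh, hh1, hr3⟩ : ∃ h > 0, h ≤ 1 ∧ 2 * h < r :=
    ⟨min (r / 3) 1, by positivity, min_le_right _ _, by linarith [min_le_left (r / 3) 1]⟩
  obtain ⟨B, hB, hBC⟩ : ∃ B ≥ (1 : ℝ), C * (1 - k)⁻¹ ≤ Real.exp B := by
    refine ⟨1 + Real.log (C * (1 - k)⁻¹),
      le_add_of_nonneg_right (Real.log_nonneg (one_le_mul_of_one_le_of_one_le hC h2)), ?_⟩
    rw [Real.exp_add, Real.exp_log (by positivity)]
    exact le_mul_of_one_le_left (by positivity) (Real.one_le_exp zero_le_one)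
  refine ⟨h, hh, hh1, B, hB, fun lam hl0 hl1 sz hsz ω => ?_⟩
  obtain ⟨a, rfl⟩ : ∃ a : ℝ, (a : Torus) = ω := QuotientAddGroup.mk_surjective ω
  obtain ⟨G, hG⟩ : ∃ G, IsStripExtension (fun q => (starRingEnd ℂ)
      (α ((q.1 : Torus), (q.2 : Torus))))
      r k G := ⟨_, hF.conj⟩
  have hle : ∀ {E : ℂ → ℂ → ℂ}, (∀ z w : ℂ, |z.im| < r → |w.im| < r → ‖E z w‖ ≤ k) →
      ∀ z w : ℂ, |z.im| < r → |w.im| < r → ‖(lam : ℂ) * E z w‖ ≤ k := by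
    intro E hE z w hz hw
    rw [norm_mul, norm_real, Real.norm_of_nonneg hl0]
    exact (mul_le_of_le_one_left (norm_nonneg _) hl1).trans (hE z w hz hw)
  have hd : ∀ u₁ u₂ : ℂ → ℂ, Differentiable ℂ u₁ → Differentiable ℂ u₂ → ∀ v, |(u₁ v).im| < r →
      |(u₂ v).im| < r → DifferentiableAt ℂ
        (fun v => matOp (szegoExt sz (lam * F (u₁ v) (u₂ v)) (lam * G (u₁ v) (u₂ v)))) v := by
    intro u₁ u₂ h₁ h₂ v hv₁ hv₂
    refine differentiableAt_szegoExt ((hF.1 u₁ u₂ h₁ h₂ v hv₁ hv₂).const_mul _)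
      ((hG.1 u₁ u₂ h₁ h₂ v hv₁ hv₂).const_mul _) ?_
    rw [norm_mul]
    have h3 := hle hF.2 _ _ hv₁ hv₂
    have h4 := hle hG.2 _ _ hv₁ hv₂
    nlinarith [norm_nonneg ((lam : ℂ) * F (u₁ v) (u₂ v)), norm_nonneg ((lam : ℂ) * G (u₁ v) (u₂ v))]
  have hn : ∀ z w : ℂ, |z.im| < r → |w.im| < r →
      ‖matOp (szegoExt sz (lam * F z w) (lam * G z w))‖ ≤ Real.exp B := by
    intro z w hz hw
    exact (hCM _ _ fun i j => norm_szegoExt_apply_le hsz hk (hle hF.2 z w hz hw)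
      (hle hG.2 z w hz hw) i j).trans hBC
  have hT := transferExt_real (sz := sz) hl0 hl1 h1 hF.3 hG.3 a
  generalize hA : (fun z w => szegoExt sz (lam * F z w) (lam * G z w)) = A at hT
  have hA' : ∀ z w, szegoExt sz (lam * F z w) (lam * G z w) = A z w := fun z w => by rw [← hA]
  simp only [hA'] at hd hn
  exact ⟨_, isTransferExtension_transferExt hh hr3 hd hn hT⟩

lemma continuous_transfer (hα : IsRealAnalyticT2 α) (hl0 : 0 ≤ lam) (hl1 : lam ≤ 1)
    (h1 : ∀ p, ‖α p‖ < 1) (ω : Torus) (n : ℕ) : Continuous (transfer α lam ω sz n) := by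
  induction n with
  | zero =>
    have : transfer α lam ω sz 0 = fun _ => 1 := by funext p; rfl
    rw [this]
    exact continuous_const
  | succ n ih =>
    have : transfer α lam ω sz (n + 1) = fun p =>
        szegoCocycle α lam sz ((skewShift ω)^[n] p) * transfer α lam ω sz n p := by funext p; rfl
    rw [this]
    have hc := hα.continuous
    have hpos : ∀ p, (Real.sqrt (1 - ‖(lam : ℂ) * α p‖ ^ 2) : ℂ) ≠ 0 := by
      intro p
      have h : ‖(lam : ℂ) * α p‖ < 1 := by
        rw [norm_mul, norm_real, Real.norm_of_nonneg hl0]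
        exact mul_lt_one_of_nonneg_of_lt_one_right hl1 (norm_nonneg _) (h1 p)
      have : 0 < 1 - ‖(lam : ℂ) * α p‖ ^ 2 := by nlinarith [norm_nonneg ((lam : ℂ) * α p)]
      exact_mod_cast (Real.sqrt_pos.mpr this).ne'
    have hS : Continuous (szegoCocycle α lam sz) := by
      unfold szegoCocycle
      refine Continuous.smul (Continuous.inv₀ ?_ hpos) ?_
      · fun_prop
      · refine continuous_matrix fun i j => ?_
        fin_cases i <;> fin_cases j <;> simp <;> fun_prop
    exact (hS.comp ((continuous_skewShift ω).iterate n)).matrix_mul ih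

end transfer

/-- The transfer matrices of a unimodular cocycle over the skew-shift, analytic with uniform
bounds. -/
structure IsAnalyticCocycle (ω : Torus) (T : ℕ → Torus2 → Matrix (Fin 2) (Fin 2) ℂ)
    (h B : ℝ) : Prop where
  h_pos : 0 < h
  h_le : h ≤ 1
  B_ge : 1 ≤ B
  zero : ∀ p, T 0 p = 1
  add : ∀ a b p, T (a + b) p = T b ((skewShift ω)^[a] p) * T a p
  det : ∀ m p, (T m p).det = 1
  continuous : ∀ m, Continuous (T m)
  exists_extension : ∃ A, IsTransferExtension T h B A

theorem exists_isAnalyticCocycle {α : Torus2 → ℂ} (hα : IsRealAnalyticT2 α)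
    (h1 : ∀ p, ‖α p‖ < 1) : ∃ h > 0, ∃ B ≥ 1, h ≤ 1 ∧ ∀ lam, 0 ≤ lam → lam ≤ 1 →
      ∀ sz : ℂ, ‖sz‖ = 1 → ∀ ω, IsAnalyticCocycle ω (transfer α lam ω sz) h B := by
  obtain ⟨h, hh, hh1, B, hB, H⟩ := exists_isTransferExtension hα h1
  exact ⟨h, hh, B, hB, hh1, fun lam hl0 hl1 sz hsz ω => ⟨hh, hh1, hB, fun p => rfl,
    transfer_add ω, det_transfer hl0 hl1 h1 hsz ω, continuous_transfer hα hl0 hl1 h1 ω,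
    H lam hl0 hl1 sz hsz ω⟩⟩

/-- The averaged logarithm of the norm of the `m`-step matrix. -/
def avgLog (T : ℕ → Torus2 → Matrix (Fin 2) (Fin 2) ℂ) (m : ℕ) (p : Torus2) : ℝ :=
  (m : ℝ)⁻¹ * Real.log ‖matOp (T m p)‖

namespace IsAnalyticCocycle

variable {ω : Torus} {T : ℕ → Torus2 → Matrix (Fin 2) (Fin 2) ℂ} {h B : ℝ}
  (hT : IsAnalyticCocycle ω T h B)
include hT

lemma one_le_norm (m : ℕ) (p : Torus2) : 1 ≤ ‖matOp (T m p)‖ := one_le_norm_matOp (hT.det m p)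

lemma log_nonneg (m : ℕ) (p : Torus2) : 0 ≤ Real.log ‖matOp (T m p)‖ :=
  Real.log_nonneg (hT.one_le_norm m p)

lemma log_le (m : ℕ) (p : Torus2) : Real.log ‖matOp (T m p)‖ ≤ B * m := by
  obtain ⟨A, hA⟩ := hT.exists_extension
  obtain ⟨x, y⟩ := p
  induction x using QuotientAddGroup.induction_on with | H x
  induction y using QuotientAddGroup.induction_on with | H y
  have := hA.norm_le m x y (by simpa using hT.h_pos.le) (by simpa using hT.h_pos.le)
  rw [hA.eq_real] at this
  rwa [Real.log_le_iff_le_exp (zero_lt_one.trans_le (hT.one_le_norm m _))]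

lemma continuous_log (m : ℕ) : Continuous fun p => Real.log ‖matOp (T m p)‖ := by
  have hc := hT.continuous m
  have : Continuous fun p => matOp (T m p) := continuous_matOp fun i j => by fun_prop
  exact this.norm.log fun p => (zero_lt_one.trans_le (hT.one_le_norm m p)).ne'

lemma continuous_avgLog (m : ℕ) : Continuous (avgLog T m) :=
  (hT.continuous_log m).const_mul _

lemma avgLog_nonneg (m : ℕ) (p : Torus2) : 0 ≤ avgLog T m p :=
  mul_nonneg (by positivity) (hT.log_nonneg m p)

lemma avgLog_le (m : ℕ) (p : Torus2) : avgLog T m p ≤ B := by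
  rcases Nat.eq_zero_or_pos m with rfl | hm
  · simpa [avgLog] using zero_le_one.trans hT.B_ge
  · have : (0 : ℝ) < m := by exact_mod_cast hm
    rw [avgLog, inv_mul_le_iff₀ this, mul_comm]
    exact hT.log_le m p

lemma isSmoothableSnd {m : ℕ} (hm : 0 < m) : IsSmoothableSnd (avgLog T m) B (4 * B * m / h) := by
  refine ⟨hT.continuous_avgLog m, hT.avgLog_nonneg m, hT.avgLog_le m, fun η hη x => ?_⟩
  obtain ⟨A, hA⟩ := hT.exists_extension
  induction x using QuotientAddGroup.induction_on with | H x
  have hm0 : (0 : ℝ) < m := by exact_mod_cast hm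
  have hB := zero_le_one.trans hT.B_ge
  have hh := hT.h_pos
  have hx : |(x : ℂ).im| ≤ h := by simpa using hh.le
  have hw : ∀ w : ℂ, |w.im| ≤ h / m → m * |w.im| ≤ h := fun w hw => by
    rwa [le_div_iff₀ hm0, mul_comm] at hw
  have hS : IsStripBounded (A m x) (h / m) (B * m) :=
    ⟨fun w h1 => hA.differentiableAt_snd m x w hx (hw w h1),
      fun w h1 => hA.norm_le m x w hx (hw w h1)⟩
  set u : Torus → ℝ := fun y => Real.log ‖matOp (T m ((x : Torus), y))‖ with hu
  have huc : Continuous u := (hT.continuous_log m).comp (by fun_prop)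
  have key := hS.integral_abs_heightAvg_sub_le (by positivity) (by positivity) hη huc
    (fun y => hT.log_nonneg m _) fun y => by
      rw [hA.eq_real, Real.exp_log (zero_lt_one.trans_le (hT.one_le_norm m _))]
  have e : ∀ y : Torus, |smoothSnd (2 * η) (avgLog T m) ((x : Torus), y) -
      avgLog T m ((x : Torus), y)| = (m : ℝ)⁻¹ * |heightAvg (2 * η) u y - u y| := by
    intro y
    rw [← abs_of_pos (inv_pos.mpr hm0), ← abs_mul, mul_sub]
    congr 2
    simp only [smoothSnd, heightAvg, poissonAvg, avgLog]
    rw [← integral_const_mul]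
    congr 1
    funext t
    ring
  have e2 : ∫ y : Torus, |smoothSnd (2 * η) (avgLog T m) ((x : Torus), y) -
      avgLog T m ((x : Torus), y)| = (m : ℝ)⁻¹ * ∫ y, |heightAvg (2 * η) u y - u y| := by
    rw [← integral_const_mul]
    exact integral_congr_ae (Eventually.of_forall e)
  refine e2.trans_le ((mul_le_mul_of_nonneg_left key (by positivity)).trans_eq ?_)
  field_simp

lemma isOrbitCocycle (p : Torus2) :
    IsOrbitCocycle (fun j m => T m ((skewShift ω)^[j] p)) B := by
  refine ⟨fun j => hT.zero _, fun j a b => ?_, fun j m => hT.det m _, fun j => ?_⟩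
  · rw [hT.add, ← Function.iterate_add_apply, add_comm a j]
  · simpa using hT.log_le 1 ((skewShift ω)^[j] p)

end IsAnalyticCocycle

namespace IsAnalyticCocycle

variable {ω : Torus} {T : ℕ → Torus2 → Matrix (Fin 2) (Fin 2) ℂ} {h B : ℝ}
  (hT : IsAnalyticCocycle ω T h B)
include hT

lemma orbitAvg_nonneg (m N : ℕ) (p : Torus2) : 0 ≤ orbitAvg ω N (avgLog T m) p :=
  div_nonneg (Finset.sum_nonneg fun _ _ => hT.avgLog_nonneg m _) (by positivity)

lemma orbitAvg_le (m N : ℕ) (p : Torus2) : orbitAvg ω N (avgLog T m) p ≤ B := by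
  rcases Nat.eq_zero_or_pos N with rfl | hN
  · simpa [orbitAvg] using zero_le_one.trans hT.B_ge
  · have hN0 : (0 : ℝ) < N := by exact_mod_cast hN
    rw [orbitAvg, div_le_iff₀ hN0]
    refine (Finset.sum_le_card_nsmul _ _ B fun _ _ => hT.avgLog_le m _).trans_eq ?_
    rw [Finset.card_range, nsmul_eq_mul, mul_comm]

lemma abs_avgLog_sub_orbitAvg_le (n N : ℕ) (p : Torus2) :
    |avgLog T N p - (2 * orbitAvg ω N (avgLog T (2 * n)) p - orbitAvg ω N (avgLog T n) p)| ≤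
      3 * B := by
  have h1 := hT.avgLog_nonneg N p
  have h2 := hT.avgLog_le N p
  have h3 := hT.orbitAvg_nonneg (2 * n) N p
  have h4 := hT.orbitAvg_le (2 * n) N p
  have h5 := hT.orbitAvg_nonneg n N p
  have h6 := hT.orbitAvg_le n N p
  rw [abs_le]
  constructor <;> linarith

lemma abs_avgLog_sub_orbitAvg_le_of_good {n N : ℕ} (hn : 0 < n) (hnN : n ≤ N) (hN : 32 ≤ N)
    {G l l' : ℝ} (hl : G ≤ l) (hll : l - l' ≤ G / 40) (hG : 10 * Real.log (2 * N) ≤ 9 * G * n)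
    {p : Torus2} (hp : ∀ j < N, |avgLog T n ((skewShift ω)^[j] p) - l| ≤ G / 10)
    (hp' : ∀ j < N, |avgLog T (2 * n) ((skewShift ω)^[j] p) - l'| ≤ G / 10) :
    |avgLog T N p - (2 * orbitAvg ω N (avgLog T (2 * n)) p - orbitAvg ω N (avgLog T n) p)| ≤
      (16 + 5 * n * B) / N := by
  have hn0 : (0 : ℝ) < n := by exact_mod_cast hn
  have hN0 : (0 : ℝ) < N := by exact_mod_cast hn.trans_le hnN
  have e1 : ∀ q, Real.log ‖matOp (T n q)‖ = n * avgLog T n q := fun q => by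
    rw [avgLog, mul_inv_cancel_left₀ hn0.ne']
  have e2 : ∀ q, Real.log ‖matOp (T (2 * n) q)‖ = 2 * n * avgLog T (2 * n) q := fun q => by
    have : (((2 * n : ℕ) : ℝ)) ≠ 0 := by positivity
    rw [avgLog]
    push_cast at this ⊢
    rw [mul_inv_cancel_left₀ this]
  have key := (hT.isOrbitCocycle p).abs_log_div_sub_average_le (μ := Real.exp (9 * G * n / 10)) hn
    hnN hN ?_ ?_ ?_
  · convert key using 3
    · rw [avgLog, Function.iterate_zero, id, div_eq_inv_mul]
    · simp only [orbitAvg, ← mul_div_assoc, ← sub_div]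
      congr 1
      rw [Finset.mul_sum, ← Finset.sum_sub_distrib]
      refine Finset.sum_congr rfl fun j _ => ?_
      rw [e1, e2]
      field_simp
  · rw [← Real.log_le_iff_le_exp (by positivity)]
    linarith
  · intro j hj
    rw [Real.log_exp, e1]
    have := (abs_le.mp (hp j hj)).1
    nlinarith
  · intro j hj
    rw [Real.log_exp, e1, e1, e2]
    have h1 := (abs_le.mp (hp j (by omega))).2
    have h2 := (abs_le.mp (hp (j + n) hj)).2
    have h3 := (abs_le.mp (hp' j (by omega))).1
    nlinarith

/-- Off a set of small measure, the averaged logarithm at scale `N` is given by Birkhoff averages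
at scales `n` and `2n`. -/
lemma integral_max_abs_avgLog_sub_le {n N : ℕ} (hn : 0 < n) (hnN : n ≤ N) (hN : 32 ≤ N)
    {G l l' e : ℝ} (he : 0 ≤ e) (hl : G ≤ l) (hll : l - l' ≤ G / 40)
    (hG : 10 * Real.log (2 * N) ≤ 9 * G * n)
    (hb : volume {p : Torus2 | |avgLog T n p - l| > G / 10} ≤ ENNReal.ofReal e)
    (hb' : volume {p : Torus2 | |avgLog T (2 * n) p - l'| > G / 10} ≤ ENNReal.ofReal e) :
    ∫ p, max (|avgLog T N p - (2 * orbitAvg ω N (avgLog T (2 * n)) p -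
      orbitAvg ω N (avgLog T n) p)| - (16 + 5 * n * B) / N) 0 ≤ 6 * B * (N * e) := by
  have hB := zero_le_one.trans hT.B_ge
  set D : Torus2 → ℝ := fun p => |avgLog T N p - (2 * orbitAvg ω N (avgLog T (2 * n)) p -
      orbitAvg ω N (avgLog T n) p)| with hD
  have hn1 := hT.continuous_avgLog n
  have hn2 := hT.continuous_avgLog (2 * n)
  have hDc : Continuous D := by
    have h1 := continuous_orbitAvg ω N hn1
    have h2 := continuous_orbitAvg ω N hn2
    have h3 := hT.continuous_avgLog N
    fun_prop
  set S : Set Torus2 := {p | |avgLog T n p - l| > G / 10} ∪ {p | |avgLog T (2 * n) p - l'| > G / 10}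
    with hS
  have hSm : MeasurableSet S := by
    refine (IsOpen.union ?_ ?_).measurableSet
    · exact isOpen_lt continuous_const (by fun_prop)
    · exact isOpen_lt continuous_const (by fun_prop)
  have hSv : volume S ≤ ENNReal.ofReal (2 * e) := by
    rw [two_mul, ENNReal.ofReal_add he he]
    exact (measure_union_le _ _).trans (add_le_add hb hb')
  set U : Set Torus2 := ⋃ j ∈ Finset.range N, (skewShift ω)^[j] ⁻¹' S with hU
  have hUm : MeasurableSet U := Finset.measurableSet_biUnion _ fun j _ =>
    ((continuous_skewShift ω).iterate j).measurable hSm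
  have hUv : volume U ≤ ENNReal.ofReal (N * (2 * e)) := by
    refine (measure_biUnion_finset_le _ _).trans ?_
    refine (Finset.sum_le_card_nsmul _ _ (ENNReal.ofReal (2 * e)) fun j _ => ?_).trans_eq ?_
    · rw [((measurePreserving_skewShift ω).iterate j).measure_preimage hSm.nullMeasurableSet]
      exact hSv
    · rw [Finset.card_range, nsmul_eq_mul, ENNReal.ofReal_mul (p := (N : ℝ)) N.cast_nonneg,
        ENNReal.ofReal_natCast]
  have hle : ∀ p, max (D p - (16 + 5 * n * B) / N) 0 ≤ U.indicator (fun _ => 3 * B) p := by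
    intro p
    by_cases hp : p ∈ U
    · rw [Set.indicator_of_mem hp]
      refine max_le ?_ (by positivity)
      have := hT.abs_avgLog_sub_orbitAvg_le n N p
      have : 0 ≤ (16 + 5 * n * B) / N := by positivity
      simp only [hD]
      linarith
    · rw [Set.indicator_of_notMem hp]
      refine max_le ?_ le_rfl
      rw [sub_nonpos]
      have hg : ∀ j < N, (skewShift ω)^[j] p ∉ S := by
        intro j hj hjS
        refine hp ?_
        simp only [hU, Set.mem_iUnion]
        exact ⟨j, Finset.mem_range.mpr hj, hjS⟩
      refine hT.abs_avgLog_sub_orbitAvg_le_of_good hn hnN hN hl hll hG (fun j hj => ?_)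
        fun j hj => ?_
      · by_contra hc
        exact hg j hj (Or.inl (not_le.mp hc))
      · by_contra hc
        exact hg j hj (Or.inr (not_le.mp hc))
  calc _ ≤ ∫ p, U.indicator (fun _ => 3 * B) p :=
        integral_mono (integrable_of_continuous_torus2 (by fun_prop))
          ((integrable_const _).indicator hUm) hle
    _ = volume.real U * (3 * B) := by rw [integral_indicator_const _ hUm, smul_eq_mul]
    _ ≤ N * (2 * e) * (3 * B) := by
        refine mul_le_mul_of_nonneg_right ?_ (by positivity)
        exact ENNReal.toReal_le_of_le_ofReal (by positivity) hUv
    _ = _ := by ring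

end IsAnalyticCocycle

lemma rpow_error_le {N : ℝ} (hN : 1 ≤ N) {κ : ℝ} (hκ : 0 < κ) {B h m C : ℝ} (hB : 1 ≤ B)
    (hh : 0 < h) (hC : 0 ≤ C) (hmN : m ≤ 2 * √N) :
    16 / (N ^ (-(1 / 12) : ℝ) * (N ^ (-(1 / 12) : ℝ) / N)) * (4 * B * m / h / N ^ 2) +
      C * (B * √(4 * B * m / h)) * (N ^ κ) ^ 5 / ((N ^ (-(1 / 12) : ℝ)) ^ 2 * √N) ≤
    (128 * B / h + C * B * √(8 * B / h)) * N ^ (-(1 / 12) + 5 * κ) := by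
  have hN0 : 0 < N := by linarith
  have hs : √N = N ^ (1 / 2 : ℝ) := Real.sqrt_eq_rpow N
  have hK : 4 * B * m / h ≤ 8 * B / h * N ^ (1 / 2 : ℝ) := by
    rw [div_mul_eq_mul_div, div_le_div_iff_of_pos_right hh, ← hs]
    nlinarith
  have e1 : 16 / (N ^ (-(1 / 12) : ℝ) * (N ^ (-(1 / 12) : ℝ) / N)) * (N ^ (1 / 2 : ℝ) / N ^ 2) =
      16 * N ^ (-(1 / 3) : ℝ) := by
    have : N ^ (-(1 / 3) : ℝ) * (N ^ (-(1 / 12) : ℝ) * N ^ (-(1 / 12) : ℝ)) * N =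
        N ^ (1 / 2 : ℝ) := by
      rw [← Real.rpow_add hN0, ← Real.rpow_add hN0]
      nth_rw 2 [← Real.rpow_one N]
      rw [← Real.rpow_add hN0]
      norm_num
    rw [← this]
    have : 0 < N ^ (-(1 / 12) : ℝ) := Real.rpow_pos_of_pos hN0 _
    field_simp
  have e2 : N ^ (1 / 4 : ℝ) * (N ^ κ) ^ 5 / ((N ^ (-(1 / 12) : ℝ)) ^ 2 * √N) =
      N ^ (-(1 / 12) + 5 * κ) := by
    rw [hs, div_eq_iff (by positivity), ← Real.rpow_natCast, ← Real.rpow_natCast,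
      ← Real.rpow_mul hN0.le,
      ← Real.rpow_mul hN0.le, ← Real.rpow_add hN0, ← Real.rpow_add hN0, ← Real.rpow_add hN0]
    congr 1
    push_cast
    ring
  have h1 : N ^ (-(1 / 3) : ℝ) ≤ N ^ (-(1 / 12) + 5 * κ) :=
    Real.rpow_le_rpow_of_exponent_le hN (by linarith)
  have h2 : √(4 * B * m / h) ≤ √(8 * B / h) * N ^ (1 / 4 : ℝ) := by
    refine (Real.sqrt_le_sqrt hK).trans_eq ?_
    rw [Real.sqrt_mul (by positivity), Real.sqrt_eq_rpow (N ^ (1 / 2 : ℝ)), ← Real.rpow_mul hN0.le]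
    norm_num
  calc _ ≤ 16 / (N ^ (-(1 / 12) : ℝ) * (N ^ (-(1 / 12) : ℝ) / N)) *
          (8 * B / h * N ^ (1 / 2 : ℝ) / N ^ 2) +
        C * (B * (√(8 * B / h) * N ^ (1 / 4 : ℝ))) * (N ^ κ) ^ 5 /
          ((N ^ (-(1 / 12) : ℝ)) ^ 2 * √N) := by gcongr
    _ = 8 * B / h * (16 / (N ^ (-(1 / 12) : ℝ) * (N ^ (-(1 / 12) : ℝ) / N)) *
          (N ^ (1 / 2 : ℝ) / N ^ 2)) + C * B * √(8 * B / h) *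
          (N ^ (1 / 4 : ℝ) * (N ^ κ) ^ 5 / ((N ^ (-(1 / 12) : ℝ)) ^ 2 * √N)) := by ring
    _ = 128 * B / h * N ^ (-(1 / 3) : ℝ) + C * B * √(8 * B / h) * N ^ (-(1 / 12) + 5 * κ) := by
        rw [e1, e2]; ring
    _ ≤ _ := by
        rw [add_mul]
        gcongr

lemma rpow_exceptional_le {N : ℝ} (hN : 1 ≤ N) {κ : ℝ} (hκ : 0 < κ) {B : ℝ} (hB : 0 ≤ B) :
    6 * B * (N * N ^ (-10 : ℝ)) ≤ 96 * B * N ^ (-(1 / 12) + 5 * κ) ∧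
    16 / (N ^ (-(1 / 12) : ℝ) * (N ^ (-(1 / 12) : ℝ) / N)) * (6 * B * (N * N ^ (-10 : ℝ))) ≤
      96 * B * N ^ (-(1 / 12) + 5 * κ) := by
  have hN0 : 0 < N := by linarith
  have e0 : N * N ^ (-10 : ℝ) = N ^ (-9 : ℝ) := by
    nth_rw 1 [← Real.rpow_one N]
    rw [← Real.rpow_add hN0]
    norm_num
  have e1 : 16 / (N ^ (-(1 / 12) : ℝ) * (N ^ (-(1 / 12) : ℝ) / N)) * N ^ (-9 : ℝ) =
      16 * N ^ (-(47 / 6) : ℝ) := by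
    have : N ^ (-(47 / 6) : ℝ) * (N ^ (-(1 / 12) : ℝ) * N ^ (-(1 / 12) : ℝ)) =
        N ^ (-9 : ℝ) * N := by
      nth_rw 5 [← Real.rpow_one N]
      rw [← Real.rpow_add hN0, ← Real.rpow_add hN0, ← Real.rpow_add hN0]
      norm_num
    have h2 : 0 < N ^ (-(1 / 12) : ℝ) := Real.rpow_pos_of_pos hN0 _
    field_simp
    linarith
  have h1 : N ^ (-9 : ℝ) ≤ N ^ (-(1 / 12) + 5 * κ) :=
    Real.rpow_le_rpow_of_exponent_le hN (by linarith)
  have h2 : N ^ (-(47 / 6) : ℝ) ≤ N ^ (-(1 / 12) + 5 * κ) :=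
    Real.rpow_le_rpow_of_exponent_le hN (by linarith)
  have h3 : 0 ≤ N ^ (-9 : ℝ) := by positivity
  rw [e0]
  constructor
  · nlinarith [mul_le_mul_of_nonneg_left h1 hB, mul_nonneg hB h3]
  · calc _ = 6 * B * (16 / (N ^ (-(1 / 12) : ℝ) * (N ^ (-(1 / 12) : ℝ) / N)) *
        N ^ (-9 : ℝ)) := by ring
      _ = 96 * B * N ^ (-(47 / 6) : ℝ) := by rw [e1]; ring
      _ ≤ _ := by gcongr

lemma rpow_birkhoff_le {N : ℝ} (hN : 1 ≤ N) {κ : ℝ} (hκ : 0 < κ) {B m : ℝ} (hB : 1 ≤ B)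
    (hmN : m ≤ √N) : (16 + 5 * m * B) / N ≤ 21 * B * N ^ (-(1 / 12) + 5 * κ) := by
  have hN0 : 0 < N := by linarith
  have h1 : 1 ≤ √N := Real.one_le_sqrt.mpr hN
  have h2 : N ^ (-(1 / 2) : ℝ) ≤ N ^ (-(1 / 12) + 5 * κ) :=
    Real.rpow_le_rpow_of_exponent_le hN (by linarith)
  have h3 : √N / N = N ^ (-(1 / 2) : ℝ) := by
    rw [Real.sqrt_eq_rpow, div_eq_iff hN0.ne']
    nth_rw 3 [← Real.rpow_one N]
    rw [← Real.rpow_add hN0]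
    norm_num
  calc _ ≤ 21 * B * √N / N := by
        gcongr
        nlinarith
    _ = 21 * B * N ^ (-(1 / 2) : ℝ) := by rw [← h3, mul_div_assoc]
    _ ≤ _ := by gcongr

lemma abs_boxAvg_sub_le {s t : ℝ} (hs : 0 < s) (ht : 0 < t) {U V W M : Torus2 → ℝ}
    (hU : Continuous U) (hV : Continuous V) (hW : Continuous W) (hM : Continuous M) {c : ℝ}
    (hc : ∀ p, |U p - (2 * V p - W p)| ≤ c + M p) (p : Torus2) :
    |boxAvg s t U p - (2 * boxAvg s t V p - boxAvg s t W p)| ≤ c + boxAvg s t M p := by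
  have cUW : Continuous fun q => U q + W q := hU.add hW
  have cVV : Continuous fun q => V q + V q := hV.add hV
  have ccM : Continuous fun q => c + M q := continuous_const.add hM
  have h1 := boxAvg_mono hs ht cUW (W := fun q => (V q + V q) + (c + M q)) (cVV.add ccM)
    (fun q => by linarith [(abs_le.mp (hc q)).2]) p
  have h2 := boxAvg_mono hs ht cVV (W := fun q => (U q + W q) + (c + M q)) (cUW.add ccM)
    (fun q => by linarith [(abs_le.mp (hc q)).1]) p
  rw [boxAvg_add hs ht hU hW, boxAvg_add hs ht cVV ccM, boxAvg_add hs ht hV hV,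
    boxAvg_add hs ht continuous_const hM, boxAvg_const hs ht] at h1
  rw [boxAvg_add hs ht cUW ccM, boxAvg_add hs ht hU hW, boxAvg_add hs ht hV hV,
    boxAvg_add hs ht continuous_const hM, boxAvg_const hs ht] at h2
  rw [abs_le]
  constructor <;> linarith

lemma abs_integral_sub_le {U V W M : Torus2 → ℝ}
    (hU : Continuous U) (hV : Continuous V) (hW : Continuous W) (hM : Continuous M) {c : ℝ}
    (hc : ∀ p, |U p - (2 * V p - W p)| ≤ c + M p) :
    |(∫ p, U p) - (2 * (∫ p, V p) - ∫ p, W p)| ≤ c + ∫ p, M p := by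
  have iU := integrable_of_continuous_torus2 hU
  have iV := integrable_of_continuous_torus2 hV
  have iW := integrable_of_continuous_torus2 hW
  have iM := integrable_of_continuous_torus2 hM
  have iVW : Integrable (fun p => 2 * V p - W p) := (iV.const_mul 2).sub iW
  have h1 : |∫ p, (U p - (2 * V p - W p))| ≤ ∫ p, (c + M p) :=
    (abs_integral_le_integral_abs).trans (integral_mono
      (iU.sub iVW).abs ((integrable_const c).add iM) hc)
  rwa [integral_sub iU iVW, integral_sub (iV.const_mul 2) iW,
    integral_const_mul, integral_add (integrable_const c) iM, integral_const, probReal_univ,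
    one_smul] at h1

/-- Box averages at scale `N^{-1/12}` of the averaged logarithm are close to a constant, given
weak large deviation estimates at two small scales. -/
theorem exists_abs_boxAvg_avgLog_sub_le {c κ : ℝ} (hc : 0 < c) (hκ : 0 < κ) (hκ1 : 4 * κ ≤ 1)
    {h B : ℝ} (hh : 0 < h) (hB : 1 ≤ B) : ∃ C > 0, ∀ ω : Torus,
      (∀ q : ℕ, 0 < q → c * (q : ℝ) ^ (-(1 + κ)) ≤ ‖q • ω‖) → ∀ T, IsAnalyticCocycle ω T h B →
      ∀ n N : ℕ, 0 < n → n < N → n ^ 2 ≤ N → 32 ≤ N → ∀ G,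
      G ≤ ∫ p, avgLog T n p → (∫ p, avgLog T n p) - ∫ p, avgLog T (2 * n) p ≤ G / 40 →
      10 * Real.log (2 * N) ≤ 9 * G * n →
      volume {p : Torus2 | |avgLog T n p - ∫ p, avgLog T n p| > G / 10} ≤
        ENNReal.ofReal ((N : ℝ) ^ (-10 : ℝ)) →
      volume {p : Torus2 | |avgLog T (2 * n) p - ∫ p, avgLog T (2 * n) p| > G / 10} ≤
        ENNReal.ofReal ((N : ℝ) ^ (-10 : ℝ)) →
      ∃ L, |(∫ p, avgLog T N p) - L| ≤ C * (N : ℝ) ^ (-(1 / 12) + 5 * κ) ∧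
        ∀ p, |boxAvg ((N : ℝ) ^ (-(1 / 12) : ℝ)) ((N : ℝ) ^ (-(1 / 12) : ℝ) / N)
          (avgLog T N) p - L| ≤
          C * (N : ℝ) ^ (-(1 / 12) + 5 * κ) := by
  obtain ⟨C, hC, hbox⟩ := exists_abs_boxAvg_orbitAvg_sub_le hc hκ hκ1
  refine ⟨3 * (128 * B / h + C * B * √(8 * B / h)) + 21 * B + 96 * B, by positivity, ?_⟩
  intro ω hω T hT n N hn hnN hnN2 hN G hl hll hG hb hb'
  have hN1 : 1 ≤ N := by omega
  have hN1' : (1 : ℝ) ≤ N := by exact_mod_cast hN1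
  have hN0 : (0 : ℝ) < N := by linarith
  have hn1 : (1 : ℝ) ≤ n := by exact_mod_cast hn
  have hnsq : (n : ℝ) ≤ √N := Real.le_sqrt_of_sq_le (by exact_mod_cast hnN2)
  have hK : ∀ m : ℝ, 1 ≤ m → 1 ≤ 4 * B * m / h := fun m hm => by
    rw [one_le_div hh]
    nlinarith [hT.h_le]
  set E : ℝ := (N : ℝ) ^ (-(1 / 12) + 5 * κ) with hE
  have hE0 : 0 < E := Real.rpow_pos_of_pos hN0 _
  set s : ℝ := (N : ℝ) ^ (-(1 / 12) : ℝ) with hs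
  have hs0 : 0 < s := Real.rpow_pos_of_pos hN0 _
  have hs1 : s ≤ 1 := Real.rpow_le_one_of_one_le_of_nonpos hN1' (by norm_num)
  have ht0 : 0 < s / N := by positivity
  have ht1 : s / N ≤ 1 := (div_le_one hN0).mpr (hs1.trans hN1')
  set o := orbitAvg ω N (avgLog T n) with ho
  set o' := orbitAvg ω N (avgLog T (2 * n)) with ho'
  have cu := hT.continuous_avgLog N
  have co : Continuous o := continuous_orbitAvg ω N (hT.continuous_avgLog n)
  have co' : Continuous o' := continuous_orbitAvg ω N (hT.continuous_avgLog (2 * n))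
  set b : ℝ := (16 + 5 * n * B) / N with hbdef
  set M : Torus2 → ℝ := fun p => max (|avgLog T N p - (2 * o' p - o p)| - b) 0 with hM
  have cM : Continuous M := by fun_prop
  have hM0 : ∀ p, 0 ≤ M p := fun p => le_max_right _ _
  have hMle : ∀ p, |avgLog T N p - (2 * o' p - o p)| ≤ b + M p := fun p => by
    linarith [le_max_left (|avgLog T N p - (2 * o' p - o p)| - b) 0]
  have hb1 : b ≤ 21 * B * E := rpow_birkhoff_le hN1' hκ hB hnsq
  have hMint : ∫ p, M p ≤ 6 * B * (N * (N : ℝ) ^ (-10 : ℝ)) :=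
    hT.integral_max_abs_avgLog_sub_le hn hnN.le hN (by positivity) hl hll hG hb hb'
  obtain ⟨hx1, hx2⟩ := rpow_exceptional_le hN1' hκ (zero_le_one.trans hB)
  have hn2 : 1 ≤ ((2 * n : ℕ) : ℝ) := by exact_mod_cast (by omega : 1 ≤ 2 * n)
  have herr : ∀ m : ℕ, 0 < m → (m : ℝ) ≤ 2 * √N → ∀ p,
      |boxAvg s (s / N) (orbitAvg ω N (avgLog T m)) p - ∫ q, avgLog T m q| ≤
        (128 * B / h + C * B * √(8 * B / h)) * E := fun m hm hmN p =>
    (hbox ω hω _ _ _ (hT.isSmoothableSnd hm) hB (hK m (by exact_mod_cast hm)) N s (s / N) hN1 hs0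
      hs1 ht0 ht1 p).trans (rpow_error_le hN1' hκ hB hh hC.le hmN)
  have hpos : 0 ≤ (128 * B / h + C * B * √(8 * B / h)) * E := by positivity
  refine ⟨2 * (∫ p, avgLog T (2 * n) p) - ∫ p, avgLog T n p, ?_, fun p => ?_⟩
  · have h1 := abs_integral_sub_le cu co' co cM hMle
    rw [ho, ho', integral_orbitAvg ω hN1 (hT.continuous_avgLog n),
      integral_orbitAvg ω hN1 (hT.continuous_avgLog (2 * n))] at h1
    nlinarith
  · have h1 := abs_le.mp (abs_boxAvg_sub_le hs0 ht0 cu co' co cM hMle p)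
    have h2 := abs_le.mp (herr n hn (by linarith) p)
    have h3 := abs_le.mp (herr (2 * n) (by omega) (by push_cast; linarith) p)
    have h4 : boxAvg s (s / N) M p ≤ 96 * B * E :=
      (boxAvg_le_integral hs0 hs1 ht0 ht1 cM hM0 p).trans
        ((mul_le_mul_of_nonneg_left hMint (by positivity)).trans hx2)
    rw [abs_le]
    constructor <;> nlinarith [h1.1, h1.2, h2.1, h2.2, h3.1, h3.2]

namespace IsAnalyticCocycle

variable {ω : Torus} {T : ℕ → Torus2 → Matrix (Fin 2) (Fin 2) ℂ} {h B : ℝ}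
  (hT : IsAnalyticCocycle ω T h B)
include hT

/-- An upper bound for box averages of `log ‖T N‖` bounds the complexified cocycle on a
neighbourhood of the torus. -/
lemma norm_extension_le {A : ℕ → ℂ → ℂ → (Plane →L[ℂ] Plane)} (hA : IsTransferExtension T h B A)
    {N : ℕ} (hN : 0 < N) {s K : ℝ} (hs : 0 < s) (hsh : 2 * s ≤ h)
    (hK : ∀ p, boxAvg s (s / N) (fun q => Real.log ‖matOp (T N q)‖) p ≤ K) {z w : ℂ}
    (hz : |z.im| ≤ s) (hw : |w.im| ≤ s / N) :
    ‖A N z w‖ ≤ Real.exp (K + 6 * (B * N * s / h)) := by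
  have hN0 : (0 : ℝ) < N := by exact_mod_cast hN
  have hB := zero_le_one.trans hT.B_ge
  have hh := hT.h_pos
  have ht : 0 < s / N := by positivity
  have hth : s / N ≤ h / N := by gcongr; linarith
  set U : Torus2 → ℝ := fun q => Real.log ‖matOp (T N q)‖ with hU
  have cU : Continuous U := hT.continuous_log N
  have cF := continuous_smoothFst hs cU
  have hU0 : ∀ q, 0 ≤ U q := hT.log_nonneg N
  have hF0 : ∀ q, 0 ≤ smoothFst s U q := fun q =>
    le_heightAvg hs (u := fun x => U (x, q.2)) (by fun_prop) (fun x => hU0 _) _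
  have hw' : ∀ w : ℂ, |w.im| ≤ h / N → N * |w.im| ≤ h := fun w hw => by
    rwa [le_div_iff₀ hN0, mul_comm] at hw
  have S1 : ∀ w : ℂ, |w.im| ≤ h / N → IsStripBounded (fun z => A N z w) h (B * N) := fun w hw =>
    ⟨fun z hz => hA.differentiableAt_fst N z w hz (hw' w hw),
      fun z hz => hA.norm_le N z w hz (hw' w hw)⟩
  have S2 : ∀ z : ℂ, |z.im| ≤ h → IsStripBounded (A N z) (h / N) (B * N) := fun z hz =>
    ⟨fun w hw => hA.differentiableAt_snd N z w hz (hw' w hw),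
      fun w hw => hA.norm_le N z w hz (hw' w hw)⟩
  have him : ∀ (x a : ℝ), 0 ≤ a → |((x : ℂ) - a * I).im| = a := fun x a ha => by
    simpa using ha
  set δ : ℝ := B * N * s / h with hδ
  have hδ0 : 0 ≤ δ := by positivity
  have hδ' : B * N * (s / N) / (h / N) = δ := by rw [hδ]; field_simp
  have b1 : ∀ x y : ℝ, ‖A N (x - s * I) y‖ ≤ Real.exp (smoothFst s U (x, y) + δ) := fun x y =>
    (S1 y (by simpa using by positivity)).norm_le_exp_heightAvg_neg (by positivity) hs (by linarith)
      (u := fun x => U (x, y)) (by fun_prop) (fun x => hU0 _) (fun x => by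
        rw [hA.eq_real, Real.exp_log (zero_lt_one.trans_le (hT.one_le_norm N _))]) x
  have b2 : ∀ x y : ℝ, ‖A N (x - s * I) (y - (s / N : ℝ) * I)‖ ≤ Real.exp (K + 2 * δ) := by
    intro x y
    have := (S2 (x - s * I) (by rw [him x s hs.le]; linarith)).norm_le_exp_heightAvg_neg
      (by positivity) ht hth (u := fun y => smoothFst s U (x, y) + δ) (by fun_prop)
      (fun y => add_nonneg (hF0 _) hδ0) (b1 x) y
    rw [heightAvg_add_const ht (u := fun y => smoothFst s U (x, y)) (by fun_prop), hδ'] at this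
    refine this.trans (Real.exp_le_exp.mpr ?_)
    have h1 := hK ((x : Torus), (y : Torus))
    rw [boxAvg_eq_smooth hs ht cU] at h1
    simp only [smoothSnd] at h1
    linarith
  have hK0 : 0 ≤ K := by
    refine le_trans ?_ (hK 0)
    rw [← boxAvg_const hs ht 0 0]
    exact boxAvg_mono hs ht continuous_const cU hU0 0
  have b3 : ∀ y : ℝ, ‖A N z (y - (s / N : ℝ) * I)‖ ≤ Real.exp (K + 4 * δ) := fun y => by
    refine ((S1 _ (by rw [him y _ ht.le]; exact hth)).norm_le_exp_of_line_const (by positivity)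
      hs hsh
      (K := K + 2 * δ) (by positivity) (fun x => b2 x y) z hz).trans_eq ?_
    congr 1
    rw [hδ]; ring
  refine ((S2 z (by linarith)).norm_le_exp_of_line_const (by positivity) ht
    (by rw [← mul_div_assoc]; gcongr) (K := K + 4 * δ) (by positivity) b3 w hw).trans_eq ?_
  congr 1
  rw [← hδ']; ring

end IsAnalyticCocycle

lemma exists_coe_eq_of_mem_closedBall {x₀ r : ℝ} {q : Torus}
    (hq : q ∈ Metric.closedBall (x₀ : Torus) r) : ∃ x : ℝ, (x : Torus) = q ∧ |x - x₀| ≤ r := by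
  induction q using QuotientAddGroup.induction_on with | H x
  rw [Metric.mem_closedBall, dist_eq_norm] at hq
  change ‖((x - x₀ : ℝ) : UnitAddCircle)‖ ≤ r at hq
  rw [UnitAddCircle.norm_eq] at hq
  refine ⟨x - round (x - x₀), ?_, by rwa [sub_right_comm]⟩
  have : ((round (x - x₀) : ℝ) : Torus) = 0 :=
    (AddCircle.coe_eq_zero_iff 1).mpr ⟨round (x - x₀), by simp⟩
  rw [AddCircle.coe_sub, this, sub_zero]

/-- A nonnegative function with small box average is small somewhere in the box. -/
lemma exists_le_of_boxAvg_le {s t : ℝ} (hs : 0 < s) (hs1 : s ≤ 1) (ht : 0 < t) (ht1 : t ≤ 1)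
    {v : Torus2 → ℝ} (hv : Continuous v) (hv0 : ∀ q, 0 ≤ v q) {δ : ℝ} (hδ : 0 < δ) (x₀ y₀ : ℝ)
    (h : boxAvg s t v ((x₀ : Torus), (y₀ : Torus)) ≤ δ) :
    ∃ x y : ℝ, |x - x₀| ≤ s / 8 ∧ |y - y₀| ≤ t / 8 ∧
      v ((x : Torus), (y : Torus)) ≤ 2 * 1280 ^ 2 * δ := by
  by_contra! hc
  set Q : Set Torus2 := Metric.closedBall (x₀ : Torus) (s / 8) ×ˢ Metric.closedBall
      (y₀ : Torus) (t / 8)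
    with hQ
  have hQm : MeasurableSet Q := Metric.isClosed_closedBall.measurableSet.prod
    Metric.isClosed_closedBall.measurableSet
  have hvol : volume.real Q = s * t / 16 := by
    rw [hQ, Measure.volume_eq_prod, measureReal_prod_prod, measureReal_def, measureReal_def,
      AddCircle.volume_closedBall, AddCircle.volume_closedBall, min_eq_right (by linarith),
      min_eq_right (by linarith), ENNReal.toReal_ofReal (by positivity),
      ENNReal.toReal_ofReal (by positivity)]
    ring
  have hle : ∀ q, Q.indicator (fun _ => 1 / (320 * s) * (1 / (320 * t)) * (2 * 1280 ^ 2 * δ)) q ≤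
      boxKernel s t (((x₀ : Torus), (y₀ : Torus)) - q) * v q := by
    intro q
    by_cases hq : q ∈ Q
    · rw [Set.indicator_of_mem hq]
      obtain ⟨x, hx, hx'⟩ := exists_coe_eq_of_mem_closedBall hq.1
      obtain ⟨y, hy, hy'⟩ := exists_coe_eq_of_mem_closedBall hq.2
      obtain rfl : q = ((x : Torus), (y : Torus)) := Prod.ext hx.symm hy.symm
      have hk1 := le_circlePoisson_exp hs hs1 (x := x₀ - x)
        (by rw [abs_sub_comm]; linarith)
      have hk2 := le_circlePoisson_exp ht ht1 (x := y₀ - y)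
        (by rw [abs_sub_comm]; linarith)
      have hk : 1 / (320 * s) * (1 / (320 * t)) ≤
          boxKernel s t (((x₀ : Torus), (y₀ : Torus)) - ((x : Torus), (y : Torus))) :=
        mul_le_mul hk1 hk2 (by positivity) (le_trans (by positivity) hk1)
      exact mul_le_mul hk (hc x y hx' hy').le (by positivity) (le_trans (by positivity) hk)
    · rw [Set.indicator_of_notMem hq]
      exact mul_nonneg (boxKernel_nonneg hs ht _) (hv0 q)
  have := integral_mono ((integrable_const _).indicator hQm)
      (integrable_boxKernel_mul hs ht hv _) hle
  rw [integral_indicator_const _ hQm, hvol, smul_eq_mul] at this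
  have h2 := this.trans h
  have : s * t / 16 * (1 / (320 * s) * (1 / (320 * t)) * (2 * 1280 ^ 2 * δ)) = 2 * δ := by
    field_simp
    norm_num
  linarith

/-- A Cartan estimate on a box for functions of two variables holomorphic in each of them. -/
lemma volume_box_small_values_le {E : Type*} [NormedAddCommGroup E] [NormedSpace ℂ E]
    [CompleteSpace E] {A : ℂ → ℂ → E} {s t M m H x₁ y₁ : ℝ} (hs : 0 < s) (ht : 0 < t) (hM : 0 < M)
    (hm : 1 ≤ m) (hH : 1 ≤ H)
    (hd1 : ∀ z w : ℂ, |z.im| ≤ s → |w.im| ≤ t → DifferentiableAt ℂ (fun z => A z w) z)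
    (hd2 : ∀ z w : ℂ, |z.im| ≤ s → |w.im| ≤ t → DifferentiableAt ℂ (A z) w)
    (hA : ∀ z w : ℂ, |z.im| ≤ s → |w.im| ≤ t → ‖A z w‖ ≤ M)
    (hc : Continuous fun p : ℝ × ℝ => A p.1 p.2) (h1 : M * Real.exp (-m) ≤ ‖A x₁ y₁‖) :
    volume {p : ℝ × ℝ | |p.1 - x₁| ≤ s / 4 ∧ |p.2 - y₁| ≤ t / 4 ∧
      ‖A p.1 p.2‖ ≤ M * Real.exp (-(m * H ^ 2))} ≤
      ENNReal.ofReal (5 * Real.exp 1 * (s * t) * Real.exp (-((H - 1) / 3))) := by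
  set e : ℝ := 5 * Real.exp 1 * Real.exp (-((H - 1) / 3)) with he
  set S := {p : ℝ × ℝ | |p.1 - x₁| ≤ s / 4 ∧ |p.2 - y₁| ≤ t / 4 ∧
      ‖A p.1 p.2‖ ≤ M * Real.exp (-(m * H ^ 2))} with hS
  have hSc : IsClosed S := by
    refine IsClosed.and ?_ (IsClosed.and ?_ (isClosed_le hc.norm continuous_const))
    all_goals exact isClosed_le (by fun_prop) (by fun_prop)
  set X := {x : ℝ | |x - x₁| ≤ s / 4 ∧ ‖A x y₁‖ ≤ M * Real.exp (-(m * H))} with hX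
  have hXc : IsClosed X := by
    have : Continuous fun x : ℝ => A x y₁ :=
      hc.comp (g := fun p : ℝ × ℝ => A p.1 p.2) (f := fun x : ℝ => (x, y₁)) (by fun_prop)
    exact (isClosed_le (by fun_prop) (by fun_prop)).and (isClosed_le this.norm continuous_const)
  have him : ∀ {c r : ℝ} {z : ℂ}, z ∈ Metric.closedBall (c : ℂ) r → |z.im| ≤ r := by
    intro c r z hz
    rw [Metric.mem_closedBall, dist_eq_norm] at hz
    simpa using (Complex.abs_im_le_norm _).trans hz
  have hre : ∀ {r : ℝ} (x : ℝ), 0 < r → |(x : ℂ).im| ≤ r := fun x hr => by simpa using hr.le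
  have hXv : volume X ≤ ENNReal.ofReal (s * e) :=
    (volume_small_values_le hs hM hm hH (fun z hz => hd1 z y₁ (him hz) (hre _ ht))
      (fun z hz => hA z y₁ (him hz) (hre _ ht)) h1).trans_eq (by rw [he]; ring_nf)
  have hball : ∀ c r : ℝ, {x : ℝ | |x - c| ≤ r} = Metric.closedBall c r := fun c r => by
    ext x; simp [Real.dist_eq]
  have hpt : ∀ x : ℝ, volume (Prod.mk x ⁻¹' S) ≤ X.indicator (fun _ => ENNReal.ofReal (t / 2)) x +
      (Metric.closedBall x₁ (s / 4)).indicator (fun _ => ENNReal.ofReal (t * e)) x := by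
    intro x
    by_cases hx : |x - x₁| ≤ s / 4
    · by_cases hxX : x ∈ X
      · rw [Set.indicator_of_mem hxX]
        refine le_add_right ((measure_mono (t := Metric.closedBall y₁ (t / 4)) ?_).trans_eq ?_)
        · intro y hy
          exact hy.2.1
        · rw [Real.volume_closedBall]
          ring_nf
      · rw [Set.indicator_of_mem (s := Metric.closedBall _ _) (by rwa [← hball])]
        have hx1 : M * Real.exp (-(m * H)) ≤ ‖A x y₁‖ := by
          by_contra hlt
          exact hxX ⟨hx, (not_le.mp hlt).le⟩
        refine le_add_left ?_
        refine le_trans (measure_mono ?_) ((volume_small_values_le ht hM (m := m * H) (by nlinarith)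
          hH (fun w hw => hd2 x w (hre _ hs) (him hw)) (fun w hw => hA x w (hre _ hs) (him hw))
          hx1).trans_eq (by rw [he]; ring_nf))
        intro y hy
        refine ⟨hy.2.1, hy.2.2.trans_eq ?_⟩
        ring_nf
    · have : Prod.mk x ⁻¹' S = ∅ := by
        ext y
        simp [hS, hx]
      rw [this, measure_empty]
      exact zero_le
  rw [Measure.volume_eq_prod, Measure.prod_apply hSc.measurableSet]
  refine (lintegral_mono hpt).trans ?_
  rw [lintegral_add_left (by fun_prop (disch := exact hXc.measurableSet)),
    lintegral_indicator_const hXc.measurableSet,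
    lintegral_indicator_const Metric.isClosed_closedBall.measurableSet, Real.volume_closedBall]
  have he0 : 0 < e := by positivity
  calc _ ≤ ENNReal.ofReal (t / 2) * ENNReal.ofReal (s * e) +
        ENNReal.ofReal (t * e) * ENNReal.ofReal (2 * (s / 4)) := by gcongr
    _ = ENNReal.ofReal (t / 2 * (s * e) + t * e * (2 * (s / 4))) := by
        rw [← ENNReal.ofReal_mul (by positivity), ← ENNReal.ofReal_mul (by positivity),
          ← ENNReal.ofReal_add (by positivity) (by positivity)]
    _ = _ := by
        rw [he]; ring_nf

/-- A subset of the torus whose intersections with all small boxes are small is small. -/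
lemma volume_torus_le_of_box {s t e : ℝ} (hs : 0 < s) (hs1 : s ≤ 1) (ht : 0 < t) (ht1 : t ≤ 1)
    (he : 0 ≤ e) {S : Set Torus2} (hS : MeasurableSet S)
    (h : ∀ x y : ℝ, volume {p : ℝ × ℝ | |p.1 - x| ≤ s / 8 ∧ |p.2 - y| ≤ t / 8 ∧
      ((p.1 : Torus), (p.2 : Torus)) ∈ S} ≤ ENNReal.ofReal (s * t * e)) :
    volume S ≤ ENNReal.ofReal (25 * e) := by
  set π : ℝ × ℝ → Torus2 := Prod.map (fun x : ℝ => (x : Torus)) (fun x : ℝ => (x : Torus)) with hπ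
  have hmp : MeasurePreserving π ((volume.restrict (Set.Ioc (0 : ℝ) (0 + 1))).prod
      (volume.restrict (Set.Ioc (0 : ℝ) (0 + 1)))) volume :=
    (AddCircle.measurePreserving_mk 1 0).prod (AddCircle.measurePreserving_mk 1 0)
  rw [← hmp.measure_preimage hS.nullMeasurableSet, Measure.prod_restrict,
    ← Measure.volume_eq_prod, Measure.restrict_apply (hmp.measurable hS)]
  set a := ⌊4 / s⌋₊ + 1 with ha
  set b := ⌊4 / t⌋₊ + 1 with hb
  have hab : ∀ {r : ℝ}, 0 < r → r ≤ 1 → ((⌊4 / r⌋₊ + 1 : ℕ) : ℝ) ≤ 5 / r := by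
    intro r hr hr1
    push_cast
    have h1 := Nat.floor_le (by positivity : 0 ≤ 4 / r)
    have h2 : 5 / r = 4 / r + 1 / r := by ring
    have h3 : 1 ≤ 1 / r := (one_le_div hr).mpr hr1
    linarith
  have hcov : ∀ {r x : ℝ}, 0 < r → x ∈ Set.Ioc (0 : ℝ) (0 + 1) →
      ∃ i ∈ Finset.range (⌊4 / r⌋₊ + 1), |x - (i + 1 / 2) * (r / 4)| ≤ r / 8 := by
    intro r x hr hx
    refine ⟨⌊x * (4 / r)⌋₊, Finset.mem_range.mpr (Nat.lt_succ_of_le (Nat.floor_le_floor ?_)), ?_⟩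
    · have := hx.2
      have h4 : 0 < 4 / r := by positivity
      nlinarith
    · have h1 := Nat.floor_le (mul_nonneg hx.1.le (by positivity : 0 ≤ 4 / r))
      have h2 := Nat.lt_floor_add_one (x * (4 / r))
      have h3 : x = x * (4 / r) * (r / 4) := by field_simp
      rw [abs_le]
      constructor <;> nlinarith
  calc _ ≤ volume (⋃ ij ∈ Finset.range a ×ˢ Finset.range b, {p : ℝ × ℝ |
        |p.1 - ((ij.1 : ℝ) + 1 / 2) * (s / 4)| ≤ s / 8 ∧
        |p.2 - ((ij.2 : ℝ) + 1 / 2) * (t / 4)| ≤ t / 8 ∧ ((p.1 : Torus), (p.2 : Torus)) ∈ S}) := by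
        refine measure_mono ?_
        rintro p ⟨hpS, hp1, hp2⟩
        obtain ⟨i, hi, hi'⟩ := hcov hs hp1
        obtain ⟨j, hj, hj'⟩ := hcov ht hp2
        simp only [Set.mem_iUnion]
        exact ⟨(i, j), Finset.mk_mem_product hi hj, hi', hj', hpS⟩
    _ ≤ ∑ ij ∈ Finset.range a ×ˢ Finset.range b, ENNReal.ofReal (s * t * e) :=
        (measure_biUnion_finset_le _ _).trans (Finset.sum_le_sum fun ij _ => h _ _)
    _ = ENNReal.ofReal ((a * b : ℕ) * (s * t * e)) := by
        rw [Finset.sum_const, Finset.card_product, Finset.card_range, Finset.card_range,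
          nsmul_eq_mul,
          ENNReal.ofReal_mul (p := ((a * b : ℕ) : ℝ)) (Nat.cast_nonneg _), ENNReal.ofReal_natCast]
    _ ≤ _ := by
        refine ENNReal.ofReal_le_ofReal ?_
        have h1 := hab hs hs1
        have h2 := hab ht ht1
        push_cast at h1 h2 ⊢
        calc _ ≤ (5 / s * (5 / t)) * (s * t * e) := by
              refine mul_le_mul_of_nonneg_right (mul_le_mul ?_ ?_ (by positivity) (by positivity))
                (by positivity)
              · rw [ha]; push_cast; exact h1
              · rw [hb]; push_cast; exact h2
          _ = 25 * e := by field_simp; ring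

/-- If box averages of the averaged logarithm are nearly constant, then the averaged logarithm is
nearly constant off an exponentially small set. -/
theorem IsAnalyticCocycle.volume_abs_avgLog_sub_gt_le {ω : Torus}
    {T : ℕ → Torus2 → Matrix (Fin 2) (Fin 2) ℂ} {h B : ℝ} (hT : IsAnalyticCocycle ω T h B) {N : ℕ}
    (hN : 0 < N) {s L D H : ℝ} (hs : 0 < s) (hsh : 2 * s ≤ h) (hNs : 1 ≤ N * s) (hH : 1 ≤ H)
    (hD : 0 ≤ D) (hbox : ∀ p, |boxAvg s (s / N) (avgLog T N) p - L| ≤ D) :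
    volume {p : Torus2 | |avgLog T N p - L| > 2 * 1280 ^ 2 * (2 * D + 6 * (B * s / h)) * H ^ 2} ≤
      ENNReal.ofReal (125 * Real.exp 1 * Real.exp (-((H - 1) / 3))) := by
  obtain ⟨A, hA⟩ := hT.exists_extension
  have hN0 : (0 : ℝ) < N := by exact_mod_cast hN
  have hN1 : (1 : ℝ) ≤ N := by exact_mod_cast hN
  have hh := hT.h_pos
  have hh1 := hT.h_le
  have hB := hT.B_ge
  have hs1 : s ≤ 1 := by linarith
  have ht : 0 < s / N := by positivity
  have ht1 : s / N ≤ 1 := (div_le_one hN0).mpr (hs1.trans hN1)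
  set U : Torus2 → ℝ := fun q => Real.log ‖matOp (T N q)‖ with hU
  have cU : Continuous U := hT.continuous_log N
  have hUavg : ∀ p, U p = N * avgLog T N p := fun p => by rw [avgLog, mul_inv_cancel_left₀ hN0.ne']
  have hexp : ∀ p, ‖matOp (T N p)‖ = Real.exp (U p) := fun p =>
    (Real.exp_log (zero_lt_one.trans_le (hT.one_le_norm N p))).symm
  have hboxU : ∀ p, boxAvg s (s / N) U p = N * boxAvg s (s / N) (avgLog T N) p := fun p => by
    unfold boxAvg
    rw [← integral_const_mul]
    congr 1
    funext q
    rw [hUavg]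
    ring
  set β : ℝ := B * s / h with hβ
  have hβ0 : 0 < β := by positivity
  have hNβ : B * N * s / h = N * β := by rw [hβ]; ring
  have hβs : s ≤ β := by
    rw [hβ, le_div_iff₀ hh]
    nlinarith
  set K : ℝ := N * (L + D + 6 * β) with hK
  have hAK : ∀ z w : ℂ, |z.im| ≤ s → |w.im| ≤ s / N → ‖A N z w‖ ≤ Real.exp K := by
    intro z w hz hw
    refine (hT.norm_extension_le hA hN hs hsh (K := N * (L + D)) (fun p => ?_) hz hw).trans_eq ?_
    · rw [hboxU]
      have := (abs_le.mp (hbox p)).2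
      gcongr
      linarith
    · rw [hNβ, hK]
      ring_nf
  have hUK : ∀ p, U p ≤ K := by
    rintro ⟨x, y⟩
    induction x using QuotientAddGroup.induction_on with | H x
    induction y using QuotientAddGroup.induction_on with | H y
    have := hAK x y (by simpa using hs.le) (by simpa using by positivity)
    rw [hA.eq_real] at this
    exact Real.exp_le_exp.mp ((hexp _).symm.trans_le this)
  set δ : ℝ := N * (2 * D + 6 * β) with hδ
  have hδ0 : 0 < δ := by positivity
  set m : ℝ := 2 * 1280 ^ 2 * δ with hm
  have hm1 : 1 ≤ m := by
    have : N * s ≤ N * β := by gcongr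
    have h2 : 0 ≤ N * D := by positivity
    rw [hm, hδ]
    nlinarith
  set S : Set Torus2 := {p | U p ≤ K - m * H ^ 2} with hS
  have hSm : MeasurableSet S := (isClosed_le cU continuous_const).measurableSet
  have hcA : Continuous fun p : ℝ × ℝ => A N p.1 p.2 := by
    have h1 := hT.continuous N
    have h2 : Continuous fun M : Matrix (Fin 2) (Fin 2) ℂ => matOp M :=
      LinearMap.continuous_of_finiteDimensional
        (Matrix.toEuclideanCLM (n := Fin 2) (𝕜 := ℂ)).toAlgEquiv.toLinearMap
    have h3 : Continuous fun x : ℝ => (x : Torus) := AddCircle.continuous_mk' 1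
    simp only [hA.eq_real]
    exact h2.comp (h1.comp (by fun_prop))
  have hcover : volume S ≤ ENNReal.ofReal (25 * (5 * Real.exp 1 * Real.exp (-((H - 1) / 3)))) := by
    refine volume_torus_le_of_box hs hs1 ht ht1 (by positivity) hSm fun x₀ y₀ => ?_
    obtain ⟨x₁, y₁, hx, hy, hv⟩ := exists_le_of_boxAvg_le hs hs1 ht ht1
      (v := fun q => K - U q) (by fun_prop) (fun q => sub_nonneg.mpr (hUK q)) hδ0 x₀ y₀ (by
        rw [boxAvg_sub hs ht continuous_const cU, boxAvg_const hs ht, hboxU, hK, hδ, ← mul_sub]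
        have := (abs_le.mp (hbox ((x₀ : Torus), (y₀ : Torus)))).1
        gcongr
        linarith)
    refine le_trans (measure_mono ?_) ((volume_box_small_values_le (A := A N) (x₁ := x₁) (y₁ := y₁)
      hs ht (Real.exp_pos K) hm1 hH
      (fun z w hz hw => hA.differentiableAt_fst N z w ?_ ?_)
      (fun z w hz hw => hA.differentiableAt_snd N z w ?_ ?_) hAK hcA ?_).trans_eq (by ring_nf))
    · rintro p ⟨hp1, hp2, hpS⟩
      refine ⟨?_, ?_, ?_⟩
      · have := abs_sub_le p.1 x₀ x₁
        rw [abs_sub_comm x₀ x₁] at this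
        linarith
      · have := abs_sub_le p.2 y₀ y₁
        rw [abs_sub_comm y₀ y₁] at this
        linarith
      · rw [hA.eq_real, hexp, ← Real.exp_add]
        exact Real.exp_le_exp.mpr hpS
    · linarith
    · rw [le_div_iff₀ hN0] at hw
      linarith
    · linarith
    · rw [le_div_iff₀ hN0] at hw
      linarith
    · rw [hA.eq_real, hexp, ← Real.exp_add]
      exact Real.exp_le_exp.mpr (by linarith)
  refine (measure_mono fun p hp => ?_).trans (hcover.trans_eq (by ring_nf))
  have hH2 : 1 ≤ H ^ 2 := one_le_pow₀ hH
  have hp' : 2 * 1280 ^ 2 * (2 * D + 6 * β) * H ^ 2 < |avgLog T N p - L| := hp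
  have hup : avgLog T N p - L ≤ D + 6 * β := by
    have := hUK p
    rw [hUavg, hK] at this
    linarith [le_of_mul_le_mul_left this hN0]
  have hbig : 2 * D + 6 * β ≤ (2 * D + 6 * β) * H ^ 2 := by nlinarith
  rcases lt_abs.mp hp' with h1 | h1
  · nlinarith
  · change U p ≤ K - m * H ^ 2
    rw [hUavg, hK, hm, hδ]
    have : avgLog T N p ≤ L + D + 6 * β - 2 * 1280 ^ 2 * (2 * D + 6 * β) * H ^ 2 := by linarith
    linarith [mul_le_mul_of_nonneg_left this hN0.le]

lemma lyapFin_eq_integral_avgLog (α : Torus2 → ℂ) (lam : ℝ) (ω : Torus) (sz : ℂ) (m : ℕ) :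
    LyapFin α lam ω sz m = ∫ p, avgLog (transfer α lam ω sz) m p := by
  rw [LyapFin, ← integral_const_mul]
  rfl

lemma one_half_le_pscale (α : Torus2 → ℂ) {lam Cα : ℝ} (hlam : 0 < lam) (hlam1 : lam < 1)
    (hC : 0 ≤ Cα) {z : ℂ} (hz : ‖z‖ = 1) : 1 / 2 ≤ Pscale α lam Cα z := by
  have h1 : 1 ≤ (1 - lam ^ 2)⁻¹ := one_le_inv₀ (by nlinarith) |>.mpr (by nlinarith)
  have h2 : 0 ≤ (√(1 - lam ^ 2 * (⨆ p : Torus2, ‖α p‖) ^ 2))⁻¹ := by positivity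
  have h3 := Real.log_two_gt_d9
  have h4 : Real.log 2 ≤ Pscale α lam Cα z :=
    Real.log_le_log two_pos (by rw [hz]; linarith)
  linarith

/-- The numerical conditions on a large scale `N`. -/
lemma exists_scale_threshold {d κ h C : ℝ} (hd : 0 < d) (hκ : 0 < κ) (hh : 0 < h) :
    ∃ N₀ : ℕ, ∀ N : ℕ, N₀ ≤ N → 32 ≤ N ∧ 3 ≤ (N : ℝ) ^ κ ∧ C ≤ (N : ℝ) ^ (d / 4) ∧
      2 * (N : ℝ) ^ (-(1 / 12) : ℝ) ≤ h := by
  have hlim : ∀ {a : ℝ}, 0 < a → Tendsto (fun N : ℕ => (N : ℝ) ^ a) atTop atTop := fun ha =>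
    (tendsto_rpow_atTop ha).comp tendsto_natCast_atTop_atTop
  have h0 : Tendsto (fun N : ℕ => 2 * (N : ℝ) ^ (-(1 / 12) : ℝ)) atTop (nhds (2 * 0)) :=
    ((tendsto_rpow_neg_atTop (by norm_num)).comp tendsto_natCast_atTop_atTop).const_mul 2
  rw [mul_zero] at h0
  refine eventually_atTop.mp ?_
  filter_upwards [eventually_ge_atTop 32, (hlim hκ).eventually_ge_atTop 3,
    (hlim (a := d / 4) (by positivity)).eventually_ge_atTop C, h0.eventually_le_const hh]
    with N h1 h2 h3 h4
  exact ⟨h1, h2, h3, h4⟩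

/-- **Lemma 3.1, second part** (large deviation estimate at the new scale). For any
`σ < 1/24` there is `τ = τ(σ) > 0` such that, under the hypotheses of the inductive step
(with `γ` below some absolute threshold `γ₀`), the deviation set at scale `N` satisfies
`mes[|N⁻¹ log‖M_N‖ − L_N| > P·N^{−τ}] ≤ C·exp(−N^σ)` with `C = C(α,σ,ε)`. -/
theorem large_deviation_new_scale :
    ∀ σ : ℝ, 0 < σ → σ < 1 / 24 →
    ∃ τ > (0:ℝ), ∃ γ₀ > (0:ℝ),
      ∀ ε : ℝ, 0 < ε →
      ∀ α : Torus2 → ℂ, (∀ p, ‖α p‖ < 1) → IsRealAnalyticT2 α →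
      ∃ C > (0:ℝ),
      ∀ ω ∈ DiophSet ε,
      ∀ lam : ℝ, 0 < lam → lam < 1 →
      ∀ z sz : ℂ, ‖z‖ = 1 → sz ^ 2 = z →
      ∀ Cα : ℝ, 0 ≤ Cα →
      (∀ m : ℕ, 0 < m → ∀ p : Torus2,
        Real.log (matOpNorm (transfer α lam ω sz m p)) ≤ m * Pscale α lam Cα z) →
      ∀ γ : ℝ, 0 < γ → γ ≤ γ₀ →
      ∀ n N : ℕ, 0 < n → n < N →
      volume {p : Torus2 |
          |(n : ℝ)⁻¹ * Real.log (matOpNorm (transfer α lam ω sz n p)) - LyapFin α lam ω sz n|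
            > γ / 10 * Pscale α lam Cα z} ≤ ENNReal.ofReal ((N : ℝ) ^ (-10 : ℝ)) →
      volume {p : Torus2 |
          |((2 * n : ℕ) : ℝ)⁻¹ * Real.log (matOpNorm (transfer α lam ω sz (2 * n) p)) -
            LyapFin α lam ω sz (2 * n)|
            > γ / 10 * Pscale α lam Cα z} ≤ ENNReal.ofReal ((N : ℝ) ^ (-10 : ℝ)) →
      min (LyapFin α lam ω sz n) (LyapFin α lam ω sz (2 * n)) ≥ γ * Pscale α lam Cα z →
      LyapFin α lam ω sz n - LyapFin α lam ω sz (2 * n) ≤ γ / 40 * Pscale α lam Cα z →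
      9 * γ * n * Pscale α lam Cα z ≥ 10 * Real.log (2 * N) →
      n ^ 2 ≤ N →
      volume {p : Torus2 |
          |(N : ℝ)⁻¹ * Real.log (matOpNorm (transfer α lam ω sz N p)) - LyapFin α lam ω sz N|
            > Pscale α lam Cα z * (N : ℝ) ^ (-τ)}
        ≤ ENNReal.ofReal (C * Real.exp (-(N : ℝ) ^ σ)) := by
  intro σ hσ hσ1
  set d : ℝ := 1 / 12 - 2 * σ with hd
  have hd0 : 0 < d := by linarith
  set κ : ℝ := d / 14 with hκd
  have hκ : 0 < κ := by positivity
  refine ⟨d / 4, by positivity, 1, one_pos, ?_⟩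
  intro ε hε α hα1 hα
  obtain ⟨h, hh, B, hB, hh1, hcoc⟩ := exists_isAnalyticCocycle hα hα1
  obtain ⟨c, hc, hdioph⟩ := exists_rpow_le_of_mem_diophSet hε hκ
  obtain ⟨C₁, hC₁, hbox⟩ := exists_abs_boxAvg_avgLog_sub_le hc hκ (by linarith) hh hB
  set C₂ : ℝ := 2 * 1280 ^ 2 * (2 * C₁ + 6 * (B / h)) with hC₂
  obtain ⟨N₀, hN₀⟩ := exists_scale_threshold (C := 2 * (C₁ + C₂)) hd0 hκ hh
  refine ⟨125 * Real.exp 1 * Real.exp 1 + Real.exp ((N₀ : ℝ) ^ σ), by positivity, ?_⟩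
  intro ω hω lam hlam hlam1 z sz hz hsz Cα hCα _ γ hγ _ n N hn hnN hb hb' hmin hdiff hlog hnN2
  rcases lt_or_ge N N₀ with hlt | hge
  · refine prob_le_one.trans (ENNReal.one_le_ofReal.mpr ?_)
    have h1 : (N : ℝ) ^ σ ≤ (N₀ : ℝ) ^ σ :=
      Real.rpow_le_rpow N.cast_nonneg (by exact_mod_cast hlt.le) hσ.le
    calc (1 : ℝ) = Real.exp ((N : ℝ) ^ σ) * Real.exp (-(N : ℝ) ^ σ) := by
          rw [← Real.exp_add, add_neg_cancel, Real.exp_zero]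
      _ ≤ _ := by
          gcongr
          have := Real.exp_le_exp.mpr h1
          have : 0 < 125 * Real.exp 1 * Real.exp 1 := by positivity
          linarith
  obtain ⟨hN32, hNκ, hNd, hNh⟩ := hN₀ N hge
  have hsz1 : ‖sz‖ = 1 := by
    have : ‖sz‖ ^ 2 = 1 := by rw [← norm_pow, hsz, hz]
    exact (pow_eq_one_iff_of_nonneg (norm_nonneg _) two_ne_zero).mp this
  have hT := hcoc lam hlam.le hlam1.le sz hsz1 ω
  have hP := one_half_le_pscale α hlam hlam1 hCα hz
  set P := Pscale α lam Cα z with hPdef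
  set T := transfer α lam ω sz with hTdef
  have hN1 : (1 : ℝ) ≤ N := by exact_mod_cast (by omega : 1 ≤ N)
  have hN0 : (0 : ℝ) < N := by linarith
  have hG : γ / 10 * P = γ * P / 10 := by ring
  rw [hG] at hb hb'
  rw [lyapFin_eq_integral_avgLog] at hb hb' hmin hdiff ⊢
  rw [lyapFin_eq_integral_avgLog] at hmin hdiff
  obtain ⟨L, hL, hLbox⟩ := hbox ω (hdioph ω hω) T hT n N hn hnN hnN2 hN32 (γ * P)
    (hmin.le.trans (min_le_left _ _)) (by linarith) (by linarith)
    hb hb'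
  set E : ℝ := (N : ℝ) ^ (-(1 / 12) + 5 * κ) with hE
  have hE0 : 0 < E := Real.rpow_pos_of_pos hN0 _
  set s : ℝ := (N : ℝ) ^ (-(1 / 12) : ℝ) with hs
  have hs0 : 0 < s := Real.rpow_pos_of_pos hN0 _
  have hsE : s ≤ E := Real.rpow_le_rpow_of_exponent_le hN1 (by linarith)
  have hNs : 1 ≤ N * s := by
    nth_rw 1 [hs, ← Real.rpow_one (N : ℝ)]
    rw [← Real.rpow_add hN0]
    exact Real.one_le_rpow hN1 (by norm_num)
  set H : ℝ := (N : ℝ) ^ (σ + κ) with hH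
  have hH1 : 1 ≤ H := Real.one_le_rpow hN1 (by positivity)
  have key := hT.volume_abs_avgLog_sub_gt_le (by omega) hs0 hNh hNs hH1 (by positivity) hLbox
  refine (measure_mono fun p hp => ?_).trans (key.trans (ENNReal.ofReal_le_ofReal ?_))
  · have hp' : P * (N : ℝ) ^ (-(d / 4)) < |avgLog T N p - ∫ p, avgLog T N p| := hp
    change _ < |avgLog T N p - L|
    have hHE : E * H ^ 2 = (N : ℝ) ^ (-(d / 4)) * (N : ℝ) ^ (-(d / 4)) := by
      rw [hE, hH, ← Real.rpow_natCast, ← Real.rpow_mul hN0.le, ← Real.rpow_add hN0,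
        ← Real.rpow_add hN0]
      congr 1
      rw [hκd, hd]
      push_cast
      ring
    set r : ℝ := (N : ℝ) ^ (-(d / 4)) with hr
    have hr0 : 0 < r := Real.rpow_pos_of_pos hN0 _
    have hrC : (C₁ + C₂) * r ≤ 1 / 2 := by
      have : (N : ℝ) ^ (d / 4) * r = 1 := by
        rw [hr, ← Real.rpow_add hN0, add_neg_cancel, Real.rpow_zero]
      calc (C₁ + C₂) * r = 2 * (C₁ + C₂) * r / 2 := by ring
        _ ≤ (N : ℝ) ^ (d / 4) * r / 2 := by gcongr
        _ = 1 / 2 := by rw [this]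
    have hdev : 2 * 1280 ^ 2 * (2 * (C₁ * E) + 6 * (B * s / h)) * H ^ 2 ≤ C₂ * (r * r) := by
      rw [← hHE, hC₂]
      calc _ ≤ 2 * 1280 ^ 2 * (2 * (C₁ * E) + 6 * (B * E / h)) * H ^ 2 := by gcongr
        _ = _ := by ring
    have hE1 : E ≤ r * r := hHE ▸ le_mul_of_one_le_right hE0.le (one_le_pow₀ hH1)
    have h1 : C₁ * E ≤ C₁ * (r * r) := by gcongr
    have h2 : C₂ * (r * r) + C₁ * (r * r) ≤ P * r := by
      calc _ = (C₁ + C₂) * r * r := by ring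
        _ ≤ P * r := by gcongr; exact hrC.trans hP
    have h3 := abs_sub_le (avgLog T N p) L (∫ p, avgLog T N p)
    rw [abs_sub_comm L] at h3
    linarith
  · have h1 : 3 * (N : ℝ) ^ σ ≤ H := by
      rw [hH, Real.rpow_add hN0, mul_comm]
      gcongr
    calc _ ≤ 125 * Real.exp 1 * Real.exp (1 + -(N : ℝ) ^ σ) := by
          gcongr
          linarith
      _ ≤ _ := by
          rw [Real.exp_add, ← mul_assoc]
          gcongr
          have := Real.exp_pos ((N₀ : ℝ) ^ σ)
          linarith
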